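/- The functions U and A and their first partial derivatives U_t, U_θ, A_t, A_θ are bounded on (t_p,t_i] × ℝ, and the support of f in the velocity variables is bounded uniformly on (t_p,t_i]: there exists a compact set 𝒦 ⊆ ℝ³ such that f(t,θ,v) = 0 for all t ∈ (t_p,t_i], θ ∈ ℝ, and v ∉ 𝒦. -/

import Mathlib

open MeasureTheory Set

noncomputable section

set_option linter.unusedVariables false

/-- the velocity space `ℝ³` -/
abbrev V3 : Type := ℝ × ℝ × ℝ

/-- partial derivative with respect to the time variable `t` -/
def pt (F : ℝ → ℝ → ℝ) : ℝ → ℝ → ℝ := fun t θ => deriv (fun s => F s θ) t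

/-- partial derivative with respect to the space variable `θ` -/
def pθ (F : ℝ → ℝ → ℝ) : ℝ → ℝ → ℝ := fun t θ => deriv (fun x => F t x) θ

/-- time derivative within `Ici tp` (one-sided at the left endpoint `tp`) -/
def ptW (tp : ℝ) (F : ℝ → ℝ → ℝ) : ℝ → ℝ → ℝ :=
  fun t θ => derivWithin (fun s => F s θ) (Set.Ici tp) t

/-- time derivative of the matter distribution function -/
def ptf (f : ℝ → ℝ → V3 → ℝ) (t θ : ℝ) (v : V3) : ℝ := deriv (fun s => f s θ v) t

/-- one-sided time derivative of the matter distribution function -/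
def ptWf (tp : ℝ) (f : ℝ → ℝ → V3 → ℝ) (t θ : ℝ) (v : V3) : ℝ :=
  derivWithin (fun s => f s θ v) (Set.Ici tp) t

/-- `θ`-derivative of the matter distribution function -/
def pθf (f : ℝ → ℝ → V3 → ℝ) (t θ : ℝ) (v : V3) : ℝ := deriv (fun x => f t x v) θ

/-- derivative in the first velocity variable `v₁` -/
def pv1 (g : V3 → ℝ) (v : V3) : ℝ := deriv (fun y => g (y, v.2.1, v.2.2)) v.1

/-- derivative in the second velocity variable `v₂` -/
def pv2 (g : V3 → ℝ) (v : V3) : ℝ := deriv (fun y => g (v.1, y, v.2.2)) v.2.1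

/-- derivative in the third velocity variable `v₃` -/
def pv3 (g : V3 → ℝ) (v : V3) : ℝ := deriv (fun y => g (v.1, v.2.1, y)) v.2.2

/-- the velocity component `v₀ = −√(α e^{2ν−2U} + α v₁² + α e^{2ν−4U} v₂² + α t⁻² e^{2ν} (v₃ − A v₂)²)` -/
def v0 (α ν U A : ℝ → ℝ → ℝ) (t θ : ℝ) (v : V3) : ℝ :=
  - Real.sqrt (α t θ * Real.exp (2 * ν t θ - 2 * U t θ)
    + α t θ * v.1 ^ 2
    + α t θ * Real.exp (2 * ν t θ - 4 * U t θ) * v.2.1 ^ 2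
    + α t θ * (t ^ 2)⁻¹ * Real.exp (2 * ν t θ) * (v.2.2 - A t θ * v.2.1) ^ 2)

/-- `β = ν + (ln α)/2` -/
def betaF (ν α : ℝ → ℝ → ℝ) : ℝ → ℝ → ℝ := fun t θ => ν t θ + Real.log (α t θ) / 2

/-- the energy `𝓔̃(t) = ∫₀¹ ν_t/(√α t) dθ` -/
def Etilde (ν α : ℝ → ℝ → ℝ) (t : ℝ) : ℝ :=
  ∫ θ in (0:ℝ)..1, pt ν t θ / (Real.sqrt (α t θ) * t)

section

open Filter Topology

/-- smoothness in `(t, θ)` on `s × ℝ` -/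
def SmOn (s : Set ℝ) (G : ℝ → ℝ → ℝ) : Prop :=
  ContDiffOn ℝ (⊤ : ℕ∞) (fun p : ℝ × ℝ => G p.1 p.2) (s ×ˢ (univ : Set ℝ))

namespace SmOn

variable {s : Set ℝ} {G H : ℝ → ℝ → ℝ} {t θ : ℝ}

lemma mono {s' : Set ℝ} (hG : SmOn s G) (h : s' ⊆ s) : SmOn s' G :=
  ContDiffOn.mono hG (prod_mono h Subset.rfl)

lemma continuousOn (hG : SmOn s G) :
    ContinuousOn (fun p : ℝ × ℝ => G p.1 p.2) (s ×ˢ (univ : Set ℝ)) :=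
  ContDiffOn.continuousOn hG

lemma continuous_slice (hG : SmOn s G) (ht : t ∈ s) : Continuous (fun x => G t x) := by
  have : ContinuousOn (fun x : ℝ => (fun p : ℝ × ℝ => G p.1 p.2) (t, x)) univ :=
    hG.continuousOn.comp (by fun_prop) (fun x _ => ⟨ht, mem_univ _⟩)
  exact continuousOn_univ.1 this

lemma contDiffAt (hs : IsOpen s) (hG : SmOn s G) (ht : t ∈ s) :
    ContDiffAt ℝ (⊤ : ℕ∞) (fun p : ℝ × ℝ => G p.1 p.2) (t, θ) :=
  ContDiffOn.contDiffAt hG ((hs.prod isOpen_univ).mem_nhds ⟨ht, mem_univ _⟩)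

lemma hasFDerivAt (hs : IsOpen s) (hG : SmOn s G) (ht : t ∈ s) :
    HasFDerivAt (fun p : ℝ × ℝ => G p.1 p.2) (fderiv ℝ (fun p : ℝ × ℝ => G p.1 p.2) (t, θ))
      (t, θ) :=
  ((hG.contDiffAt hs ht).differentiableAt (by simp)).hasFDerivAt

lemma hasDerivAt_t' (hs : IsOpen s) (hG : SmOn s G) (ht : t ∈ s) :
    HasDerivAt (fun r => G r θ) (fderiv ℝ (fun p : ℝ × ℝ => G p.1 p.2) (t, θ) (1, 0)) t := by
  have h1 : HasDerivAt (fun r : ℝ => (r, θ)) ((1 : ℝ), (0 : ℝ)) t :=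
    (hasDerivAt_id t).prodMk (hasDerivAt_const t θ)
  exact HasFDerivAt.comp_hasDerivAt t (f := fun r : ℝ => (r, θ)) (hG.hasFDerivAt hs ht) h1

lemma hasDerivAt_θ' (hs : IsOpen s) (hG : SmOn s G) (ht : t ∈ s) :
    HasDerivAt (fun r => G t r) (fderiv ℝ (fun p : ℝ × ℝ => G p.1 p.2) (t, θ) (0, 1)) θ := by
  have h1 : HasDerivAt (fun r : ℝ => (t, r)) ((0 : ℝ), (1 : ℝ)) θ :=
    (hasDerivAt_const θ t).prodMk (hasDerivAt_id θ)
  exact HasFDerivAt.comp_hasDerivAt θ (f := fun r : ℝ => (t, r)) (hG.hasFDerivAt hs ht) h1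

lemma pt_eq (hs : IsOpen s) (hG : SmOn s G) (ht : t ∈ s) :
    pt G t θ = fderiv ℝ (fun p : ℝ × ℝ => G p.1 p.2) (t, θ) (1, 0) :=
  (hG.hasDerivAt_t' hs ht).deriv

lemma pθ_eq (hs : IsOpen s) (hG : SmOn s G) (ht : t ∈ s) :
    pθ G t θ = fderiv ℝ (fun p : ℝ × ℝ => G p.1 p.2) (t, θ) (0, 1) :=
  (hG.hasDerivAt_θ' hs ht).deriv

lemma hasDerivAt_t (hs : IsOpen s) (hG : SmOn s G) (ht : t ∈ s) :
    HasDerivAt (fun r => G r θ) (pt G t θ) t := by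
  rw [hG.pt_eq hs ht]; exact hG.hasDerivAt_t' hs ht

lemma hasDerivAt_θ (hs : IsOpen s) (hG : SmOn s G) (ht : t ∈ s) :
    HasDerivAt (fun r => G t r) (pθ G t θ) θ := by
  rw [hG.pθ_eq hs ht]; exact hG.hasDerivAt_θ' hs ht

lemma hasDerivAt_line (hs : IsOpen s) (hG : SmOn s G) (ht : t ∈ s) (c : ℝ) :
    HasDerivAt (fun r => G (t + r) (θ + c * r)) (pt G t θ + c * pθ G t θ) 0 := by
  have h1 : HasDerivAt (fun r : ℝ => (t + r, θ + c * r)) ((1 : ℝ), c) 0 := by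
    have := ((hasDerivAt_id (0 : ℝ)).const_add t).prodMk
      (((hasDerivAt_id (0 : ℝ)).const_mul c).const_add θ)
    simpa using this
  have h2 := hG.hasFDerivAt hs ht (θ := θ)
  have h3 := HasFDerivAt.comp_hasDerivAt (0 : ℝ) (f := fun r : ℝ => (t + r, θ + c * r))
    (by simpa using h2) h1
  rw [hG.pt_eq hs ht, hG.pθ_eq hs ht]
  refine h3.congr_deriv ?_
  have : ((1 : ℝ), c) = (1, 0) + c • ((0 : ℝ), (1 : ℝ)) := by simp
  rw [this, map_add, map_smul]; simp

lemma dt (hs : IsOpen s) (hG : SmOn s G) : SmOn s (pt G) := by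
  have h1 : ContDiffOn ℝ (⊤ : ℕ∞) (fderiv ℝ (fun p : ℝ × ℝ => G p.1 p.2)) (s ×ˢ (univ : Set ℝ)) :=
    ContDiffOn.fderiv_of_isOpen hG (hs.prod isOpen_univ) (by simp)
  exact (h1.clm_apply contDiffOn_const (g := fun _ => ((1 : ℝ), (0 : ℝ)))).congr
    (fun p hp => hG.pt_eq hs hp.1)

lemma dθ (hs : IsOpen s) (hG : SmOn s G) : SmOn s (pθ G) := by
  have h1 : ContDiffOn ℝ (⊤ : ℕ∞) (fderiv ℝ (fun p : ℝ × ℝ => G p.1 p.2)) (s ×ˢ (univ : Set ℝ)) :=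
    ContDiffOn.fderiv_of_isOpen hG (hs.prod isOpen_univ) (by simp)
  exact (h1.clm_apply contDiffOn_const (g := fun _ => ((0 : ℝ), (1 : ℝ)))).congr
    (fun p hp => hG.pθ_eq hs hp.1)

lemma pθ_pt (hs : IsOpen s) (hG : SmOn s G) (ht : t ∈ s) :
    pθ (pt G) t θ = pt (pθ G) t θ := by
  set F := fun p : ℝ × ℝ => G p.1 p.2 with hF
  have hc := hG.contDiffAt hs ht (θ := θ)
  have hd : DifferentiableAt ℝ (fderiv ℝ F) (t, θ) :=
    ((hc.fderiv_right (m := 1) (by norm_cast)).differentiableAt (by simp))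
  have e1 : pθ (pt G) t θ = fderiv ℝ (fderiv ℝ F) (t, θ) (0, 1) (1, 0) := by
    have : (fun x => pt G t x) = fun x => fderiv ℝ F (t, x) (1, 0) := by
      ext x; exact hG.pt_eq hs ht
    have h1 : HasDerivAt (fun r : ℝ => (t, r)) ((0 : ℝ), (1 : ℝ)) θ :=
      (hasDerivAt_const θ t).prodMk (hasDerivAt_id θ)
    have h2 := (HasFDerivAt.comp_hasDerivAt θ (f := fun r : ℝ => (t, r)) hd.hasFDerivAt h1).clm_apply
      (hasDerivAt_const θ ((1 : ℝ), (0 : ℝ)))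
    unfold pθ
    rw [this]
    simpa using h2.deriv
  have e2 : pt (pθ G) t θ = fderiv ℝ (fderiv ℝ F) (t, θ) (1, 0) (0, 1) := by
    have : (fun x => pθ G x θ) =ᶠ[𝓝 t] fun x => fderiv ℝ F (x, θ) (0, 1) := by
      filter_upwards [hs.mem_nhds ht] with x hx
      exact hG.pθ_eq hs hx
    have h1 : HasDerivAt (fun r : ℝ => (r, θ)) ((1 : ℝ), (0 : ℝ)) t :=
      (hasDerivAt_id t).prodMk (hasDerivAt_const t θ)
    have h2 := (HasFDerivAt.comp_hasDerivAt t (f := fun r : ℝ => (r, θ)) hd.hasFDerivAt h1).clm_apply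
      (hasDerivAt_const t ((0 : ℝ), (1 : ℝ)))
    unfold pt
    rw [this.deriv_eq]
    simpa using h2.deriv
  rw [e1, e2]
  have := hc.isSymmSndFDerivAt (by simp; exact WithTop.coe_le_coe.2 (le_top : (2 : ℕ∞) ≤ ⊤))
  exact this (0, 1) (1, 0)

lemma add (hG : SmOn s G) (hH : SmOn s H) : SmOn s (fun t θ => G t θ + H t θ) :=
  ContDiffOn.add hG hH

lemma sub (hG : SmOn s G) (hH : SmOn s H) : SmOn s (fun t θ => G t θ - H t θ) :=
  ContDiffOn.sub hG hH

lemma mul (hG : SmOn s G) (hH : SmOn s H) : SmOn s (fun t θ => G t θ * H t θ) :=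
  ContDiffOn.mul hG hH

lemma const (c : ℝ) : SmOn s (fun _ _ => c) := contDiffOn_const

lemma time : SmOn s (fun t _ => t) := contDiffOn_fst

lemma const_mul (c : ℝ) (hG : SmOn s G) : SmOn s (fun t θ => c * G t θ) :=
  (SmOn.const c).mul hG

lemma pow (hG : SmOn s G) (n : ℕ) : SmOn s (fun t θ => G t θ ^ n) :=
  ContDiffOn.pow hG n

lemma exp (hG : SmOn s G) : SmOn s (fun t θ => Real.exp (G t θ)) :=
  ContDiffOn.exp hG

lemma inv (hG : SmOn s G) (h0 : ∀ t ∈ s, ∀ θ, G t θ ≠ 0) : SmOn s (fun t θ => (G t θ)⁻¹) :=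
  ContDiffOn.inv hG (fun p hp => h0 p.1 hp.1 p.2)

lemma div (hG : SmOn s G) (hH : SmOn s H) (h0 : ∀ t ∈ s, ∀ θ, H t θ ≠ 0) :
    SmOn s (fun t θ => G t θ / H t θ) :=
  ContDiffOn.div hG hH (fun p hp => h0 p.1 hp.1 p.2)

lemma sqrt (hG : SmOn s G) (h0 : ∀ t ∈ s, ∀ θ, 0 < G t θ) :
    SmOn s (fun t θ => Real.sqrt (G t θ)) :=
  ContDiffOn.sqrt hG (fun p hp => (h0 p.1 hp.1 p.2).ne')

end SmOn

/-- periodicity in `θ` with period `1` -/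
def Per (G : ℝ → ℝ → ℝ) : Prop := ∀ t θ, G t (θ + 1) = G t θ

namespace Per
variable {G : ℝ → ℝ → ℝ}

lemma dt (h : Per G) : Per (pt G) := fun t θ => by
  unfold pt
  congr 1
  exact funext fun s => h s θ

lemma dθ (h : Per G) : Per (pθ G) := fun t θ => by
  unfold pθ
  rw [← deriv_comp_add_const]
  congr 1
  exact funext fun x => h t x

lemma fract (h : Per G) (t θ : ℝ) : G t (Int.fract θ) = G t θ := by
  have h1 : Function.Periodic (fun x => G t x) 1 := h t
  have := h1.sub_int_mul_eq ⌊θ⌋ (x := θ)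
  rw [mul_one] at this
  exact this

end Per

lemma fract_mem_Icc (θ : ℝ) : Int.fract θ ∈ Icc (0 : ℝ) 1 :=
  ⟨Int.fract_nonneg θ, (Int.fract_lt_one θ).le⟩

lemma exists_bound_of_periodic {G : ℝ → ℝ → ℝ} (hp : Per G) {a b : ℝ}
    (hc : ContinuousOn (fun p : ℝ × ℝ => G p.1 p.2) (Icc a b ×ˢ (univ : Set ℝ))) :
    ∃ C : ℝ, 0 ≤ C ∧ ∀ t ∈ Icc a b, ∀ θ, |G t θ| ≤ C := by
  obtain ⟨C, hC⟩ := (isCompact_Icc.prod (isCompact_Icc (a := (0 : ℝ)) (b := 1))).exists_bound_of_continuousOn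
    (hc.mono (prod_mono Subset.rfl (subset_univ _)))
  refine ⟨max C 0, le_max_right _ _, fun t ht θ => ?_⟩
  rw [← hp.fract t θ]
  exact (hC (t, Int.fract θ) ⟨ht, fract_mem_Icc θ⟩).trans (le_max_left _ _)

lemma eventually_lt_of_periodic {G : ℝ → ℝ → ℝ} (hp : Per G) {s : Set ℝ} (hs : IsOpen s)
    (hc : ContinuousOn (fun p : ℝ × ℝ => G p.1 p.2) (s ×ˢ (univ : Set ℝ))) {T c : ℝ} (hT : T ∈ s)
    (h : ∀ θ, G T θ < c) : ∀ᶠ t in 𝓝 T, ∀ θ, G t θ < c := by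
  have h1 : ∀ θ ∈ Icc (0 : ℝ) 1, ∀ᶠ p : ℝ × ℝ in 𝓝 (T, θ), G p.1 p.2 < c := fun θ _ =>
    (hc.continuousAt ((hs.prod isOpen_univ).mem_nhds ⟨hT, mem_univ _⟩)).eventually_lt_const (h θ)
  have h2 := isCompact_Icc.eventually_forall_of_forall_eventually (x₀ := T)
    (P := fun t θ => G t θ < c) (K := Icc (0 : ℝ) 1) (fun θ hθ => h1 θ hθ)
  filter_upwards [h2] with t ht θ
  rw [← hp.fract t θ]
  exact ht _ (fract_mem_Icc θ)

/-- Smooth periodic functions and their first derivatives are bounded up to the end time. -/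
lemma SmOn.exists_bound_Icc {tp ti t1 : ℝ} {G : ℝ → ℝ → ℝ} (hG : SmOn (Ioc tp ti) G) (hp : Per G)
    (h1 : tp < t1) (hi : tp < ti) :
    ∃ C : ℝ, 0 ≤ C ∧ ∀ t ∈ Icc t1 ti, ∀ θ, |G t θ| ≤ C ∧ |pt G t θ| ≤ C ∧ |pθ G t θ| ≤ C ∧
      HasDerivAt (fun x => G t x) (pθ G t θ) θ := by
  set F := fun p : ℝ × ℝ => G p.1 p.2 with hF
  set S := Ioc tp ti ×ˢ (univ : Set ℝ) with hS
  have hsub : Icc t1 ti ⊆ Ioc tp ti := fun t ht => ⟨h1.trans_le ht.1, ht.2⟩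
  have hU : UniqueDiffOn ℝ S := (uniqueDiffOn_Ioc tp ti).prod uniqueDiffOn_univ
  have hdc : ContinuousOn (fderivWithin ℝ F S) S :=
    ContDiffOn.continuousOn_fderivWithin hG hU (by simp)
  have hd : ∀ p ∈ S, HasFDerivWithinAt F (fderivWithin ℝ F S p) S p := fun p hp =>
    (ContDiffOn.differentiableOn hG (by simp) p hp).hasFDerivWithinAt
  have hθ : ∀ t ∈ Ioc tp ti, ∀ θ, HasDerivAt (fun x => G t x) (fderivWithin ℝ F S (t, θ) (0, 1)) θ := by
    intro t ht θ
    have h1 : HasDerivWithinAt (fun r : ℝ => (t, r)) ((0 : ℝ), (1 : ℝ)) univ θ :=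
      ((hasDerivAt_const θ t).prodMk (hasDerivAt_id θ)).hasDerivWithinAt
    have h2 := (hd (t, θ) ⟨ht, mem_univ _⟩).comp_hasDerivWithinAt θ h1
      (fun x _ => (⟨ht, mem_univ _⟩ : (t, x) ∈ S))
    exact hasDerivWithinAt_univ.1 h2
  have htt : ∀ t ∈ Ioc tp ti, ∀ θ, |pt G t θ| ≤ |fderivWithin ℝ F S (t, θ) (1, 0)| := by
    intro t ht θ
    by_cases hdiff : DifferentiableAt ℝ (fun r => G r θ) t
    · have h1 : HasDerivWithinAt (fun r : ℝ => (r, θ)) ((1 : ℝ), (0 : ℝ)) (Ioc tp ti) t :=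
        ((hasDerivAt_id t).prodMk (hasDerivAt_const t θ)).hasDerivWithinAt
      have h2 := (hd (t, θ) ⟨ht, mem_univ _⟩).comp_hasDerivWithinAt t h1
        (fun x hx => (⟨hx, mem_univ _⟩ : (x, θ) ∈ S))
      have h3 := (uniqueDiffOn_Ioc tp ti t ht).eq_deriv _ h2 hdiff.hasDerivAt.hasDerivWithinAt
      rw [h3]; rfl
    · have : pt G t θ = 0 := deriv_zero_of_not_differentiableAt hdiff
      rw [this]; simp
  obtain ⟨C1, hC1, hb1⟩ := exists_bound_of_periodic hp (a := t1) (b := ti)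
    (hG.continuousOn.mono (prod_mono hsub Subset.rfl))
  obtain ⟨C2, hb2⟩ := (isCompact_Icc.prod (isCompact_Icc (a := (0 : ℝ)) (b := 1))).exists_bound_of_continuousOn
    (hdc.mono (prod_mono hsub (subset_univ _)))
  refine ⟨max C1 C2, le_max_of_le_left hC1, fun t ht θ => ⟨(hb1 t ht θ).trans (le_max_left _ _), ?_, ?_, ?_⟩⟩
  · rw [← hp.dt.fract t θ]
    refine (htt t (hsub ht) _).trans (le_max_of_le_right ?_)
    refine ((fderivWithin ℝ F S (t, Int.fract θ)).le_opNorm (1, 0)).trans ?_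
    have : ‖((1 : ℝ), (0 : ℝ))‖ = 1 := by simp [Prod.norm_def]
    rw [this, mul_one]
    exact hb2 (t, Int.fract θ) ⟨ht, fract_mem_Icc θ⟩
  · rw [← hp.dθ.fract t θ]
    have : pθ G t (Int.fract θ) = _ := (hθ t (hsub ht) (Int.fract θ)).deriv
    rw [this]
    refine le_max_of_le_right ?_
    refine ((fderivWithin ℝ F S (t, Int.fract θ)).le_opNorm (0, 1)).trans ?_
    have : ‖((0 : ℝ), (1 : ℝ))‖ = 1 := by simp [Prod.norm_def]
    rw [this, mul_one]
    exact hb2 (t, Int.fract θ) ⟨ht, fract_mem_Icc θ⟩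
  · exact (hθ t (hsub ht) θ).differentiableAt.hasDerivAt

lemma le_of_isCompact_of_exists_gt {X : Type*} [TopologicalSpace X] {K : Set X} (hK : IsCompact K)
    {g : X → ℝ} (hg : ContinuousOn g K) {c : ℝ} (h : ∀ z ∈ K, c < g z → ∃ z' ∈ K, g z < g z') :
    ∀ z ∈ K, g z ≤ c := by
  intro z hz
  obtain ⟨m, hm, hmax⟩ := hK.exists_isMaxOn ⟨z, hz⟩ hg
  by_contra! hlt
  obtain ⟨z', hz', hgt⟩ := h m hm (hlt.trans_le (hmax hz))
  exact absurd (hmax hz') (not_le.2 hgt)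

lemma HasDerivAt.eventually_lt_right {φ : ℝ → ℝ} {d : ℝ} (h : HasDerivAt φ d 0) (hd : 0 < d) :
    ∀ᶠ r in 𝓝[>] (0 : ℝ), φ 0 < φ r := by
  have h1 := (hasDerivAt_iff_tendsto_slope.1 h).mono_left
    (nhdsWithin_mono (0 : ℝ) (fun x (hx : 0 < x) => (ne_of_gt hx : x ≠ 0)))
  filter_upwards [h1.eventually_const_lt hd, self_mem_nhdsWithin] with r hr hpos
  rw [slope_def_field, sub_zero] at hr
  have := (div_pos_iff_of_pos_right (show (0 : ℝ) < r from hpos)).1 hr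
  linarith

/-- A maximum principle for `∂_t + a ∂_x + b ∂_y`, on a region `ψ ≤ 0` entered by the
characteristics through its boundary, solved backwards from the time `t2`. -/
lemma transport_le {t1 t2 C c : ℝ} {g a b ψ : ℝ → ℝ → ℝ → ℝ}
    (hgc : ContinuousOn (fun p : ℝ × ℝ × ℝ => g p.1 p.2.1 p.2.2) (Icc t1 t2 ×ˢ univ))
    (hgper : ∀ t x y, g t (x + 1) y = g t x y)
    (hψc : ContinuousOn (fun p : ℝ × ℝ × ℝ => ψ p.1 p.2.1 p.2.2) (Icc t1 t2 ×ˢ univ))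
    (hψper : ∀ t x y, ψ t (x + 1) y = ψ t x y)
    (hg : ∀ t ∈ Ico t1 t2, ∀ x y,
      HasDerivAt (fun s => g (t + s) (x + a t x y * s) (y + b t x y * s)) 0 0)
    (hψ : ∀ t ∈ Ico t1 t2, ∀ x y, ψ t x y = 0 → ∃ d, d < 0 ∧
      HasDerivAt (fun s => ψ (t + s) (x + a t x y * s) (y + b t x y * s)) d 0)
    (hC : 0 ≤ C) (hb : ∀ t ∈ Ico t1 t2, ∀ x y, |b t x y| ≤ C * (1 + |y|))
    (hend : ∀ x y, ψ t2 x y ≤ 0 → g t2 x y ≤ c) :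
    ∀ t ∈ Icc t1 t2, ∀ x y, ψ t x y ≤ 0 → g t x y ≤ c := by
  intro t0 ht0 x0 y0 hψ0
  set L := 4 * C + 1 with hL
  set Λ := 1 + y0 ^ 2 with hΛ
  have hΛ1 : 1 ≤ Λ := by rw [hΛ]; nlinarith [sq_nonneg y0]
  set χ : ℝ → ℝ → ℝ := fun t y => 1 + y ^ 2 - Λ * Real.exp (L * (t - t1)) with hχ
  set Y := Λ * Real.exp (L * (t2 - t1)) with hY
  set K : Set (ℝ × ℝ × ℝ) := {p | p.1 ∈ Icc t1 t2 ∧ p.2.1 ∈ Icc (0 : ℝ) 1 ∧ χ p.1 p.2.2 ≤ 0 ∧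
    ψ p.1 p.2.1 p.2.2 ≤ 0} with hK
  have hLpos : 0 < L := by rw [hL]; linarith
  have hKc : IsCompact K := by
    set B : Set (ℝ × ℝ × ℝ) := Icc t1 t2 ×ˢ (Icc (0 : ℝ) 1 ×ˢ Icc (-Y) Y)
    have hB : IsCompact B := isCompact_Icc.prod (isCompact_Icc.prod isCompact_Icc)
    have hBs : B ⊆ Icc t1 t2 ×ˢ univ := prod_mono Subset.rfl (subset_univ _)
    have h1 : IsClosed (B ∩ (fun p : ℝ × ℝ × ℝ => ψ p.1 p.2.1 p.2.2) ⁻¹' Iic 0) :=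
      (hψc.mono hBs).preimage_isClosed_of_isClosed hB.isClosed isClosed_Iic
    have h2 : IsClosed {p : ℝ × ℝ × ℝ | χ p.1 p.2.2 ≤ 0} :=
      isClosed_le (by simp only [hχ]; fun_prop) continuous_const
    have h3 := (hB.of_isClosed_subset h1 inter_subset_left).inter_right h2
    convert h3 using 1
    ext p
    constructor
    · rintro ⟨hp1, hp2, hp3, hp4⟩
      refine ⟨⟨⟨hp1, hp2, ?_⟩, hp4⟩, hp3⟩
      have e1 : Real.exp (L * (p.1 - t1)) ≤ Real.exp (L * (t2 - t1)) := by
        gcongr; exact hp1.2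
      have e2 : 1 + p.2.2 ^ 2 ≤ Y := by
        have : 1 + p.2.2 ^ 2 - Λ * Real.exp (L * (p.1 - t1)) ≤ 0 := hp3
        have : Λ * Real.exp (L * (p.1 - t1)) ≤ Y := by rw [hY]; gcongr
        linarith
      constructor <;> nlinarith [sq_nonneg (p.2.2 - 1), sq_nonneg (p.2.2 + 1)]
    · rintro ⟨⟨⟨hp1, hp2, _⟩, hp4⟩, hp3⟩
      exact ⟨hp1, hp2, hp3, hp4⟩
  have hKs : K ⊆ Icc t1 t2 ×ˢ univ := fun p hp => ⟨hp.1, mem_univ _⟩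
  have curve : ∀ t ∈ Ico t1 t2, ∀ x y a' b' : ℝ,
      Tendsto (fun s : ℝ => ((t + s, x + a' * s, y + b' * s) : ℝ × ℝ × ℝ)) (𝓝[>] 0)
        (𝓝[Icc t1 t2 ×ˢ univ] (t, x, y)) := by
    intro t ht x y a' b'
    refine tendsto_nhdsWithin_iff.2 ⟨?_, ?_⟩
    · have : Continuous (fun s : ℝ => ((t + s, x + a' * s, y + b' * s) : ℝ × ℝ × ℝ)) := by fun_prop
      have h := this.tendsto 0
      simp only [add_zero, mul_zero] at h
      exact h.mono_left nhdsWithin_le_nhds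
    · have : Ioo (0 : ℝ) (t2 - t) ∈ 𝓝[>] (0 : ℝ) := Ioo_mem_nhdsGT (by linarith [ht.2])
      filter_upwards [this] with s hs
      exact ⟨⟨by linarith [hs.1, ht.1], by linarith [hs.2]⟩, mem_univ _⟩
  have hfrac : ∀ t x y, g t (Int.fract x) y = g t x y := fun t x y =>
    Per.fract (G := fun t x => g t x y) (fun t x => hgper t x y) t x
  have hψfrac : ∀ t x y, ψ t (Int.fract x) y = ψ t x y := fun t x y =>
    Per.fract (G := fun t x => ψ t x y) (fun t x => hψper t x y) t x
  have key : ∀ ε > 0, ∀ p ∈ K, g p.1 p.2.1 p.2.2 + ε * p.1 ≤ c + ε * t2 := by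
    intro ε hε
    refine le_of_isCompact_of_exists_gt hKc (by have := hgc.mono hKs; fun_prop) ?_
    rintro ⟨t, x, y⟩ ⟨ht, hx, hχ0, hψ1⟩ hlt
    simp only at ht hx hχ0 hψ1 hlt
    have htlt : t < t2 := by
      rcases ht.2.lt_or_eq with h | h
      · exact h
      · subst h
        have := hend x y hψ1
        linarith
    have hti : t ∈ Ico t1 t2 := ⟨ht.1, htlt⟩
    set a' := a t x y
    set b' := b t x y
    have stay : ∀ᶠ s in 𝓝[>] (0 : ℝ), ψ (t + s) (x + a' * s) (y + b' * s) ≤ 0 := by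
      rcases hψ1.lt_or_eq with h | h
      · have := (hψc (t, x, y) ⟨ht, mem_univ _⟩).tendsto.comp (curve t hti x y a' b')
        filter_upwards [this.eventually_lt_const h] with s hs using hs.le
      · obtain ⟨d, hd, hder⟩ := hψ t hti x y h
        filter_upwards [(hder.neg).eventually_lt_right (neg_pos.2 hd)] with s hs
        simp only [Pi.neg_apply, add_zero, mul_zero] at hs
        linarith
    have stay' : ∀ᶠ s in 𝓝[>] (0 : ℝ), χ (t + s) (y + b' * s) ≤ 0 := by
      have hder : HasDerivAt (fun s => χ (t + s) (y + b' * s))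
          (2 * y * b' - Λ * (Real.exp (L * (t - t1)) * L)) 0 := by
        have e1 : HasDerivAt (fun s : ℝ => y + b' * s) b' 0 := by
          simpa using ((hasDerivAt_id (0 : ℝ)).const_mul b').const_add y
        have e2 : HasDerivAt (fun s : ℝ => L * (t + s - t1)) L 0 := by
          simpa using (((hasDerivAt_id (0 : ℝ)).const_add t).sub_const t1).const_mul L
        have := ((e1.pow 2).const_add 1).sub ((e2.exp).const_mul Λ)
        simp only [add_zero, mul_zero] at this
        exact this.congr_deriv (by norm_num)
      rcases hχ0.lt_or_eq with h | h
      · have hc : ContinuousAt (fun s => χ (t + s) (y + b' * s)) 0 := hder.continuousAt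
        have h' : χ (t + 0) (y + b' * 0) < 0 := by simpa using h
        filter_upwards [(hc.eventually_lt_const h').filter_mono nhdsWithin_le_nhds] with s hs
          using hs.le
      · have hneg : 2 * y * b' - Λ * (Real.exp (L * (t - t1)) * L) < 0 := by
          have h1 : Λ * Real.exp (L * (t - t1)) = 1 + y ^ 2 := by
            have : 1 + y ^ 2 - Λ * Real.exp (L * (t - t1)) = 0 := h
            linarith
          have h2 : 2 * y * b' ≤ 2 * |y| * (C * (1 + |y|)) := by
            calc 2 * y * b' ≤ |2 * y * b'| := le_abs_self _
              _ = 2 * |y| * |b'| := by rw [abs_mul, abs_mul]; norm_num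
              _ ≤ _ := by gcongr; exact hb t hti x y
          have h3 : 2 * |y| * (1 + |y|) ≤ 4 * (1 + y ^ 2) := by
            nlinarith [sq_abs y, sq_nonneg (|y| - 1)]
          have h4 : Λ * (Real.exp (L * (t - t1)) * L) = (1 + y ^ 2) * L := by rw [← h1]; ring
          rw [h4, hL]
          nlinarith [mul_le_mul_of_nonneg_left h3 hC, sq_nonneg y]
        filter_upwards [(hder.neg).eventually_lt_right (by linarith)] with s hs
        simp only [Pi.neg_apply, add_zero, mul_zero] at hs
        linarith
    have hgd : HasDerivAt (fun s => g (t + s) (x + a' * s) (y + b' * s) + ε * (t + s)) (0 + ε) 0 := by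
      refine (hg t hti x y).add ?_
      simpa using ((hasDerivAt_id (0 : ℝ)).const_add t).const_mul ε
    have hgt := hgd.eventually_lt_right (by linarith)
    have htime : Ioo (0 : ℝ) (t2 - t) ∈ 𝓝[>] (0 : ℝ) := Ioo_mem_nhdsGT (by linarith)
    obtain ⟨s, ⟨⟨hs1, hs2⟩, hs3⟩, hs4⟩ := (((stay.and stay').and hgt).and htime).exists
    refine ⟨(t + s, Int.fract (x + a' * s), y + b' * s),
      ⟨⟨by simp only; linarith [hs4.1, ht.1], by simp only; linarith [hs4.2]⟩, fract_mem_Icc _, hs2, ?_⟩, ?_⟩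
    · simp only [hψfrac]; exact hs1
    · simp only [hfrac]
      simpa using hs3
  have hmem : (t0, Int.fract x0, y0) ∈ K := by
    refine ⟨ht0, fract_mem_Icc _, ?_, by simpa only [hψfrac] using hψ0⟩
    have : 1 ≤ Real.exp (L * (t0 - t1)) := Real.one_le_exp (mul_nonneg hLpos.le (by linarith [ht0.1]))
    show 1 + y0 ^ 2 - Λ * Real.exp (L * (t0 - t1)) ≤ 0
    nlinarith
  refine le_of_forall_pos_le_add fun ε hε => ?_
  have hpos : 0 < t2 - t0 + 1 := by linarith [ht0.2]
  have := key (ε / (t2 - t0 + 1)) (by positivity) _ hmem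
  simp only [hfrac] at this
  have e : ε / (t2 - t0 + 1) * (t2 - t0) ≤ ε := by
    rw [div_mul_eq_mul_div, div_le_iff₀ hpos]; nlinarith
  nlinarith

/-- A maximum principle for a function of `(t, x)` which increases forward in time in some
direction wherever it is positive. -/
lemma nonpos_of_exists_direction {t1 t2 : ℝ} {g : ℝ → ℝ → ℝ} (hgper : Per g)
    (hgc : ContinuousOn (fun p : ℝ × ℝ => g p.1 p.2) (Icc t1 t2 ×ˢ univ))
    (hg : ∀ t ∈ Ico t1 t2, ∀ x, 0 < g t x → ∃ a d, 0 < d ∧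
      HasDerivAt (fun s => g (t + s) (x + a * s)) d 0)
    (hend : ∀ x, g t2 x ≤ 0) : ∀ t ∈ Icc t1 t2, ∀ x, g t x ≤ 0 := by
  have key := le_of_isCompact_of_exists_gt
    (isCompact_Icc.prod (isCompact_Icc (a := (0 : ℝ)) (b := 1)))
    (hgc.mono (prod_mono Subset.rfl (subset_univ _))) (c := 0) (by
      rintro ⟨t, x⟩ ⟨ht, hx⟩ hlt
      simp only at ht hx hlt
      have htlt : t < t2 := by
        rcases ht.2.lt_or_eq with h | h
        · exact h
        · subst h; exact absurd hlt (not_lt.2 (hend x))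
      obtain ⟨a, d, hd, hder⟩ := hg t ⟨ht.1, htlt⟩ x hlt
      have htime : Ioo (0 : ℝ) (t2 - t) ∈ 𝓝[>] (0 : ℝ) := Ioo_mem_nhdsGT (by linarith)
      obtain ⟨s, hs1, hs2⟩ := ((hder.eventually_lt_right hd).and htime).exists
      refine ⟨(t + s, Int.fract (x + a * s)), ⟨⟨by simp only; linarith [hs2.1, ht.1],
        by simp only; linarith [hs2.2]⟩, fract_mem_Icc _⟩, ?_⟩
      simp only [hgper.fract]
      simpa using hs1)
  intro t ht x
  have := key (t, Int.fract x) ⟨ht, fract_mem_Icc x⟩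
  simpa only [hgper.fract] using this

/-- a smooth solution of the areal Einstein–Vlasov system with `T²` symmetry -/
structure EVSol where
  (tp ti : ℝ)
  (U A ν α J K : ℝ → ℝ → ℝ)
  f : ℝ → ℝ → V3 → ℝ
  htp : 0 < tp
  hti : tp < ti
  hUsm : ContDiffOn ℝ (⊤ : ℕ∞) (fun p : ℝ × ℝ => U p.1 p.2) (Ioc tp ti ×ˢ (univ : Set ℝ))
  hAsm : ContDiffOn ℝ (⊤ : ℕ∞) (fun p : ℝ × ℝ => A p.1 p.2) (Ioc tp ti ×ˢ (univ : Set ℝ))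
  hνsm : ContDiffOn ℝ (⊤ : ℕ∞) (fun p : ℝ × ℝ => ν p.1 p.2) (Ioc tp ti ×ˢ (univ : Set ℝ))
  hαsm : ContDiffOn ℝ (⊤ : ℕ∞) (fun p : ℝ × ℝ => α p.1 p.2) (Ioc tp ti ×ˢ (univ : Set ℝ))
  hJsm : ContDiffOn ℝ (⊤ : ℕ∞) (fun p : ℝ × ℝ => J p.1 p.2) (Ioc tp ti ×ˢ (univ : Set ℝ))
  hKsm : ContDiffOn ℝ (⊤ : ℕ∞) (fun p : ℝ × ℝ => K p.1 p.2) (Ioc tp ti ×ˢ (univ : Set ℝ))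
  hfsm : ContDiffOn ℝ (⊤ : ℕ∞) (fun p : ℝ × ℝ × V3 => f p.1 p.2.1 p.2.2) (Ioc tp ti ×ˢ (univ : Set (ℝ × V3)))
  hUper : ∀ t θ, U t (θ + 1) = U t θ
  hAper : ∀ t θ, A t (θ + 1) = A t θ
  hνper : ∀ t θ, ν t (θ + 1) = ν t θ
  hαper : ∀ t θ, α t (θ + 1) = α t θ
  hJper : ∀ t θ, J t (θ + 1) = J t θ
  hKper : ∀ t θ, K t (θ + 1) = K t θ
  hfper : ∀ t θ v, f t (θ + 1) v = f t θ v
  hαpos : ∀ t ∈ Ioc tp ti, ∀ θ : ℝ, 0 < α t θ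
  hfnn : ∀ t ∈ Ioc tp ti, ∀ (θ : ℝ) (v : V3), 0 ≤ f t θ v
  hfsupp : ∀ t ∈ Ioc tp ti, ∃ R : ℝ, ∀ (θ : ℝ) (v : V3), R < ‖v‖ → f t θ v = 0
  hvlasov :
      ∀ t ∈ Ioc tp ti, ∀ (θ : ℝ) (v : V3),
      ptf f t θ v
        = pv1 (v0 α ν U A t θ) v * pθf f t θ v
          - (deriv (fun x => v0 α ν U A t x v) θ
              + Real.sqrt (α t θ) * Real.exp (2 * ν t θ) / t ^ 3 * (K t θ - A t θ * J t θ) * (v.2.2 - A t θ * v.2.1)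
              + Real.sqrt (α t θ) * Real.exp (2 * ν t θ - 4 * U t θ) / t * J t θ * v.2.1)
            * pv1 (f t θ) v
  hnut :
      ∀ t ∈ Ioc tp ti, ∀ θ : ℝ,
      (pt ν t θ)
        = t * ((pt U t θ) ^ 2 + α t θ * (pθ U t θ) ^ 2
              + Real.exp (4 * U t θ) / (4 * t ^ 2) * ((pt A t θ) ^ 2 + α t θ * (pθ A t θ) ^ 2))
          + α t θ * Real.exp (2 * ν t θ - 4 * U t θ) / (4 * t) * J t θ ^ 2
          + α t θ * Real.exp (2 * ν t θ) / (4 * t ^ 3) * (K t θ - A t θ * J t θ) ^ 2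
          + Real.sqrt (α t θ) * ∫ v : V3, f t θ v * |v0 α ν U A t θ v|
  hnuth :
      ∀ t ∈ Ioc tp ti, ∀ θ : ℝ,
      (pθ ν t θ)
        = 2 * t * ((pt U t θ) * (pθ U t θ) + Real.exp (4 * U t θ) / (4 * t ^ 2) * (pt A t θ) * (pθ A t θ))
          - (pθ α t θ) / (2 * α t θ)
          - Real.sqrt (α t θ) * ∫ v : V3, f t θ v * v.1
  halt :
      ∀ t ∈ Ioc tp ti, ∀ θ : ℝ,
      (pt α t θ) / α t θ
        = - (α t θ * Real.exp (2 * ν t θ - 4 * U t θ) * J t θ ^ 2 / t)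
          - α t θ * Real.exp (2 * ν t θ) * (K t θ - A t θ * J t θ) ^ 2 / t ^ 3
          - 2 * (α t θ * Real.sqrt (α t θ)) * Real.exp (2 * ν t θ)
            * ∫ v : V3, f t θ v
                * (Real.exp (-2 * U t θ) + Real.exp (-4 * U t θ) * v.2.1 ^ 2
                    + (t ^ 2)⁻¹ * (v.2.2 - A t θ * v.2.1) ^ 2)
                / |v0 α ν U A t θ v|
  hjt :
      ∀ t ∈ Ioc tp ti, ∀ θ : ℝ,
      (pt J t θ) = -2 * α t θ * ∫ v : V3, f t θ v * v.1 * v.2.1 / |v0 α ν U A t θ v|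
  hjth :
      ∀ t ∈ Ioc tp ti, ∀ θ : ℝ,
      (pθ J t θ) = 2 * ∫ v : V3, f t θ v * v.2.1
  hkt :
      ∀ t ∈ Ioc tp ti, ∀ θ : ℝ,
      (pt K t θ) = -2 * α t θ * ∫ v : V3, f t θ v * v.1 * v.2.2 / |v0 α ν U A t θ v|
  hkth :
      ∀ t ∈ Ioc tp ti, ∀ θ : ℝ,
      (pθ K t θ) = 2 * ∫ v : V3, f t θ v * v.2.2
  hutt :
      ∀ t ∈ Ioc tp ti, ∀ θ : ℝ,
      (pt (pt U) t θ)
        = α t θ * (pθ (pθ U) t θ) - (pt U t θ) / t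
          + (pt α t θ) * (pt U t θ) / (2 * α t θ) + (pθ α t θ) * (pθ U t θ) / 2
          + Real.exp (4 * U t θ) / (2 * t ^ 2) * ((pt A t θ) ^ 2 - α t θ * (pθ A t θ) ^ 2)
          + α t θ * Real.exp (2 * ν t θ - 4 * U t θ) / (2 * t ^ 2) * J t θ ^ 2
          + (α t θ * Real.sqrt (α t θ)) * Real.exp (2 * ν t θ - 2 * U t θ) / (2 * t)
            * ∫ v : V3, f t θ v * (1 + 2 * Real.exp (-2 * U t θ) * v.2.1 ^ 2) / |v0 α ν U A t θ v|
  hatt :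
      ∀ t ∈ Ioc tp ti, ∀ θ : ℝ,
      (pt (pt A) t θ)
        = α t θ * (pθ (pθ A) t θ) + (pt A t θ) / t
          + (pt α t θ) * (pt A t θ) / (2 * α t θ) + (pθ α t θ) * (pθ A t θ) / 2
          - 4 * ((pt A t θ) * (pt U t θ) - α t θ * (pθ A t θ) * (pθ U t θ))
          + α t θ * Real.exp (2 * ν t θ - 4 * U t θ) / t ^ 2 * J t θ * (K t θ - A t θ * J t θ)
          + 2 * (α t θ * Real.sqrt (α t θ)) * Real.exp (2 * ν t θ - 4 * U t θ) / t
            * ∫ v : V3, f t θ v * v.2.1 * (v.2.2 - A t θ * v.2.1) / |v0 α ν U A t θ v|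
  hnutt :
      ∀ t ∈ Ioc tp ti, ∀ θ : ℝ,
      (pt (pt ν) t θ)
        = α t θ * (pθ (pθ ν) t θ)
          + (pt α t θ) * (pt ν t θ) / (2 * α t θ) + (pθ α t θ) * (pθ ν t θ) / 2
          + (pθ (pθ α) t θ) / 2 - (pθ α t θ) ^ 2 / (4 * α t θ)
          - (pt U t θ) ^ 2 + α t θ * (pθ U t θ) ^ 2
          + Real.exp (4 * U t θ) / (4 * t ^ 2) * ((pt A t θ) ^ 2 - α t θ * (pθ A t θ) ^ 2)
          - α t θ * Real.exp (2 * ν t θ - 4 * U t θ) * J t θ ^ 2 / (4 * t ^ 2)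
          - 3 * α t θ * Real.exp (2 * ν t θ) * (K t θ - A t θ * J t θ) ^ 2 / (4 * t ^ 4)
          - (α t θ * Real.sqrt (α t θ)) * Real.exp (2 * ν t θ) / t ^ 3
            * ∫ v : V3, f t θ v * (v.2.2 - A t θ * v.2.1) ^ 2 / |v0 α ν U A t θ v|
  hC2 : 0 < ∫ θ in (0:ℝ)..1, ∫ v : V3, f ti θ v

namespace EVSol

variable (S : EVSol)

/-- `e^{-2U} + e^{-4U} v₂² + t⁻² (v₃ - A v₂)²` -/
def w (v2 v3 : ℝ) : ℝ → ℝ → ℝ := fun t θ =>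
  Real.exp (-2 * S.U t θ) + Real.exp (-4 * S.U t θ) * v2 ^ 2
    + (t ^ 2)⁻¹ * (v3 - S.A t θ * v2) ^ 2

/-- `e^{2ν} w` -/
def g (v2 v3 : ℝ) : ℝ → ℝ → ℝ := fun t θ => Real.exp (2 * S.ν t θ) * S.w v2 v3 t θ

/-- `√α` -/
def s : ℝ → ℝ → ℝ := fun t θ => Real.sqrt (S.α t θ)

/-- `|v₀| / √α` -/
def ρ (t θ : ℝ) (v : V3) : ℝ := Real.sqrt (S.g v.2.1 v.2.2 t θ + v.1 ^ 2)

/-- the part of the force on particles due to the twists -/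
def frc (v2 v3 : ℝ) : ℝ → ℝ → ℝ := fun t θ =>
  S.s t θ * Real.exp (2 * S.ν t θ) / t ^ 3 * (S.K t θ - S.A t θ * S.J t θ) * (v3 - S.A t θ * v2)
    + S.s t θ * Real.exp (2 * S.ν t θ - 4 * S.U t θ) / t * S.J t θ * v2

/-- the characteristic speed in `θ` -/
def aa (t θ : ℝ) (v : V3) : ℝ := S.s t θ * v.1 / S.ρ t θ v

/-- the characteristic speed in `v₁` -/
def bb (t θ : ℝ) (v : V3) : ℝ :=
  -(pθ S.s t θ * S.ρ t θ v) - S.s t θ * (pθ (S.g v.2.1 v.2.2) t θ / (2 * S.ρ t θ v))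
    + S.frc v.2.1 v.2.2 t θ

/-- `ν_θ + α_θ / (2α)` -/
def bθ : ℝ → ℝ → ℝ := fun t θ => pθ S.ν t θ + pθ S.α t θ / (2 * S.α t θ)

variable {S}

lemma smU : SmOn (Ioc S.tp S.ti) S.U := S.hUsm
lemma smA : SmOn (Ioc S.tp S.ti) S.A := S.hAsm
lemma smν : SmOn (Ioc S.tp S.ti) S.ν := S.hνsm
lemma smα : SmOn (Ioc S.tp S.ti) S.α := S.hαsm
lemma smJ : SmOn (Ioc S.tp S.ti) S.J := S.hJsm
lemma smK : SmOn (Ioc S.tp S.ti) S.K := S.hKsm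

lemma mem_of_Ioo {t : ℝ} (ht : t ∈ Ioo S.tp S.ti) : t ∈ Ioc S.tp S.ti := Ioo_subset_Ioc_self ht

lemma time_pos {t : ℝ} (ht : t ∈ Ioc S.tp S.ti) : 0 < t := S.htp.trans ht.1

lemma w_pos {t : ℝ} (θ v2 v3 : ℝ) : 0 < S.w v2 v3 t θ := by
  unfold w; positivity

lemma g_pos {t : ℝ} (θ v2 v3 : ℝ) : 0 < S.g v2 v3 t θ :=
  mul_pos (Real.exp_pos _) (w_pos ..)

lemma s_pos {t : ℝ} (ht : t ∈ Ioc S.tp S.ti) (θ : ℝ) : 0 < S.s t θ :=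
  Real.sqrt_pos.2 (S.hαpos t ht θ)

lemma s_sq {t : ℝ} (ht : t ∈ Ioc S.tp S.ti) (θ : ℝ) : S.s t θ ^ 2 = S.α t θ :=
  Real.sq_sqrt (S.hαpos t ht θ).le

lemma ρ_pos (t θ : ℝ) (v : V3) : 0 < S.ρ t θ v :=
  Real.sqrt_pos.2 (by have := S.g_pos (t := t) θ v.2.1 v.2.2; positivity)

lemma ρ_sq (t θ : ℝ) (v : V3) : S.ρ t θ v ^ 2 = S.g v.2.1 v.2.2 t θ + v.1 ^ 2 :=
  Real.sq_sqrt (by have := S.g_pos (t := t) θ v.2.1 v.2.2; positivity)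

lemma abs_v1_le (t θ : ℝ) (v : V3) : |v.1| ≤ S.ρ t θ v :=
  Real.abs_le_sqrt (by have := S.g_pos (t := t) θ v.2.1 v.2.2; linarith)

lemma sqrt_g_le (t θ : ℝ) (v : V3) : Real.sqrt (S.g v.2.1 v.2.2 t θ) ≤ S.ρ t θ v :=
  Real.sqrt_le_sqrt (by nlinarith [sq_nonneg v.1])

lemma v0_eq {t : ℝ} (ht : t ∈ Ioc S.tp S.ti) (θ : ℝ) (v : V3) :
    v0 S.α S.ν S.U S.A t θ v = -(S.s t θ * S.ρ t θ v) := by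
  unfold v0 s ρ g w
  rw [← Real.sqrt_mul (S.hαpos t ht θ).le]
  congr 2
  have e1 : Real.exp (2 * S.ν t θ - 2 * S.U t θ)
      = Real.exp (2 * S.ν t θ) * Real.exp (-2 * S.U t θ) := by
    rw [← Real.exp_add]; congr 1; ring
  have e2 : Real.exp (2 * S.ν t θ - 4 * S.U t θ)
      = Real.exp (2 * S.ν t θ) * Real.exp (-4 * S.U t θ) := by
    rw [← Real.exp_add]; congr 1; ring
  rw [e1, e2]; ring

lemma abs_v0 {t : ℝ} (ht : t ∈ Ioc S.tp S.ti) (θ : ℝ) (v : V3) :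
    |v0 S.α S.ν S.U S.A t θ v| = S.s t θ * S.ρ t θ v := by
  rw [v0_eq ht, abs_neg, abs_of_pos (mul_pos (s_pos ht θ) (ρ_pos t θ v))]

lemma sms : SmOn (Ioc S.tp S.ti) S.s := smα.sqrt S.hαpos

lemma smw (v2 v3 : ℝ) : SmOn (Ioc S.tp S.ti) (S.w v2 v3) := by
  have h1 := (SmOn.time (s := Ioc S.tp S.ti)).pow 2 |>.inv
    (fun t ht θ => (pow_pos (time_pos ht) 2).ne')
  exact (((smU.const_mul (-2)).exp).add (((smU.const_mul (-4)).exp).mul (SmOn.const (v2 ^ 2)))).add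
    (h1.mul (((SmOn.const v3).sub (smA.mul (SmOn.const v2))).pow 2))

lemma smg (v2 v3 : ℝ) : SmOn (Ioc S.tp S.ti) (S.g v2 v3) :=
  ((smν.const_mul 2).exp).mul (smw v2 v3)

lemma pers : Per S.s := fun t θ => by unfold s; rw [S.hαper]
lemma perw (v2 v3 : ℝ) : Per (S.w v2 v3) := fun t θ => by unfold w; rw [S.hUper, S.hAper]
lemma perg (v2 v3 : ℝ) : Per (S.g v2 v3) := fun t θ => by unfold g; rw [S.hνper, perw]
lemma perbθ : Per S.bθ := fun t θ => by
  unfold bθ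
  rw [S.hαper, Per.dθ (G := S.ν) S.hνper, Per.dθ (G := S.α) S.hαper]

variable {t θ : ℝ}

lemma pθ_w (ht : t ∈ Ioo S.tp S.ti) (v2 v3 : ℝ) :
    pθ (S.w v2 v3) t θ = -2 * pθ S.U t θ * Real.exp (-2 * S.U t θ)
      - 4 * pθ S.U t θ * Real.exp (-4 * S.U t θ) * v2 ^ 2
      - 2 * (t ^ 2)⁻¹ * (v3 - S.A t θ * v2) * (pθ S.A t θ * v2) := by
  have hU := (smU.mono Ioo_subset_Ioc_self).hasDerivAt_θ isOpen_Ioo ht (θ := θ)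
  have hA := (smA.mono Ioo_subset_Ioc_self).hasDerivAt_θ isOpen_Ioo ht (θ := θ)
  have h := (((hU.const_mul (-2)).exp).add (((hU.const_mul (-4)).exp).mul_const (v2 ^ 2))).add
    ((((hA.mul_const v2).const_sub v3).pow 2).const_mul (t ^ 2)⁻¹)
  refine h.deriv.trans ?_
  norm_num
  ring

lemma pθ_g (ht : t ∈ Ioo S.tp S.ti) (v2 v3 : ℝ) :
    pθ (S.g v2 v3) t θ = Real.exp (2 * S.ν t θ)
      * (2 * pθ S.ν t θ * S.w v2 v3 t θ + pθ (S.w v2 v3) t θ) := by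
  have h1 := (smν.mono Ioo_subset_Ioc_self).hasDerivAt_θ isOpen_Ioo ht (θ := θ)
  have h2 := ((smw v2 v3).mono Ioo_subset_Ioc_self).hasDerivAt_θ isOpen_Ioo ht (θ := θ)
  refine (((h1.const_mul 2).exp).mul h2).deriv.trans ?_
  ring

lemma pθ_s (ht : t ∈ Ioo S.tp S.ti) : pθ S.s t θ = pθ S.α t θ / (2 * S.s t θ) := by
  have h1 := (smα.mono Ioo_subset_Ioc_self).hasDerivAt_θ isOpen_Ioo ht (θ := θ)
  exact (h1.sqrt (S.hαpos t (mem_of_Ioo ht) θ).ne').deriv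

lemma pt_s (ht : t ∈ Ioo S.tp S.ti) : pt S.s t θ = pt S.α t θ / (2 * S.s t θ) := by
  have h1 := (smα.mono Ioo_subset_Ioc_self).hasDerivAt_t isOpen_Ioo ht (θ := θ)
  exact (h1.sqrt (S.hαpos t (mem_of_Ioo ht) θ).ne').deriv

lemma hasDerivAt_ρ_θ (ht : t ∈ Ioo S.tp S.ti) (v : V3) :
    HasDerivAt (fun x => S.ρ t x v) (pθ (S.g v.2.1 v.2.2) t θ / (2 * S.ρ t θ v)) θ := by
  have h2 := ((smg v.2.1 v.2.2).mono Ioo_subset_Ioc_self).hasDerivAt_θ isOpen_Ioo ht (θ := θ)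
  exact (h2.add_const (v.1 ^ 2)).sqrt
    (by have := S.g_pos (t := t) θ v.2.1 v.2.2; positivity)

lemma hasDerivAt_ρ_v (t θ y v2 v3 : ℝ) :
    HasDerivAt (fun y => S.ρ t θ (y, v2, v3)) (y / S.ρ t θ (y, v2, v3)) y := by
  have h : HasDerivAt (fun y => S.ρ t θ (y, v2, v3)) _ y :=
    (((hasDerivAt_pow 2 y)).const_add (S.g v2 v3 t θ)).sqrt
    (by have := S.g_pos (t := t) θ v2 v3; positivity)
  refine h.congr_deriv ?_
  change _ / (2 * S.ρ t θ (y, v2, v3)) = _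
  have := S.ρ_pos t θ (y, v2, v3)
  field_simp
  norm_num

/-- the distribution function as a function on a product space -/
def F (S : EVSol) : ℝ × ℝ × V3 → ℝ := fun p => S.f p.1 p.2.1 p.2.2

lemma isOpen_dom : IsOpen (Ioo S.tp S.ti ×ˢ (univ : Set (ℝ × V3))) := isOpen_Ioo.prod isOpen_univ

lemma F_contDiffOn : ContDiffOn ℝ (⊤ : ℕ∞) S.F (Ioo S.tp S.ti ×ˢ (univ : Set (ℝ × V3))) :=
  S.hfsm.mono (prod_mono Ioo_subset_Ioc_self Subset.rfl)

lemma F_continuousOn : ContinuousOn S.F (Ioc S.tp S.ti ×ˢ (univ : Set (ℝ × V3))) :=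
  S.hfsm.continuousOn

lemma F_hasFDerivAt (ht : t ∈ Ioo S.tp S.ti) (v : V3) :
    HasFDerivAt S.F (fderiv ℝ S.F (t, θ, v)) (t, θ, v) :=
  ((F_contDiffOn.contDiffAt (isOpen_dom.mem_nhds ⟨ht, mem_univ _⟩)).differentiableAt
    (by simp)).hasFDerivAt

lemma F_line (ht : t ∈ Ioo S.tp S.ti) (v : V3) (e : ℝ × ℝ × V3) :
    HasDerivAt (fun r : ℝ => S.F ((t, θ, v) + r • e)) (fderiv ℝ S.F (t, θ, v) e) 0 := by
  have h1 : HasDerivAt (fun r : ℝ => (t, θ, v) + r • e) e 0 := by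
    simpa using ((hasDerivAt_id (0 : ℝ)).smul_const e).const_add (t, θ, v)
  exact HasFDerivAt.comp_hasDerivAt (0 : ℝ) (f := fun r : ℝ => (t, θ, v) + r • e)
    (by simpa using F_hasFDerivAt ht v) h1

lemma hasDerivAt_f_t (ht : t ∈ Ioo S.tp S.ti) (v : V3) :
    HasDerivAt (fun r => S.f r θ v) (fderiv ℝ S.F (t, θ, v) (1, 0, 0)) t := by
  have h1 : HasDerivAt (fun r : ℝ => (r, θ, v)) ((1 : ℝ), (0 : ℝ), (0 : V3)) t :=
    (hasDerivAt_id t).prodMk (hasDerivAt_const t (θ, v))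
  exact HasFDerivAt.comp_hasDerivAt t (f := fun r : ℝ => (r, θ, v)) (F_hasFDerivAt ht v) h1

lemma hasDerivAt_f_θ (ht : t ∈ Ioo S.tp S.ti) (v : V3) :
    HasDerivAt (fun r => S.f t r v) (fderiv ℝ S.F (t, θ, v) (0, 1, 0)) θ := by
  have h1 : HasDerivAt (fun r : ℝ => (t, r, v)) ((0 : ℝ), (1 : ℝ), (0 : V3)) θ :=
    (hasDerivAt_const θ t).prodMk ((hasDerivAt_id θ).prodMk (hasDerivAt_const θ v))
  exact HasFDerivAt.comp_hasDerivAt θ (f := fun r : ℝ => (t, r, v)) (F_hasFDerivAt ht v) h1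

lemma hasDerivAt_f_v (ht : t ∈ Ioo S.tp S.ti) (v : V3) :
    HasDerivAt (fun y => S.f t θ (y, v.2.1, v.2.2))
      (fderiv ℝ S.F (t, θ, v) (0, 0, 1, 0, 0)) v.1 := by
  have h1 : HasDerivAt (fun y : ℝ => (t, θ, y, v.2.1, v.2.2))
      ((0 : ℝ), (0 : ℝ), (1 : ℝ), (0 : ℝ), (0 : ℝ)) v.1 :=
    (hasDerivAt_const _ t).prodMk ((hasDerivAt_const _ θ).prodMk
      ((hasDerivAt_id _).prodMk (hasDerivAt_const _ (v.2.1, v.2.2))))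
  exact HasFDerivAt.comp_hasDerivAt v.1 (f := fun y : ℝ => (t, θ, y, v.2.1, v.2.2))
    (F_hasFDerivAt ht v) h1

/-- The Vlasov equation as a transport equation. -/
lemma vlasov (ht : t ∈ Ioo S.tp S.ti) (v : V3) :
    fderiv ℝ S.F (t, θ, v) (1, 0, 0) + S.aa t θ v * fderiv ℝ S.F (t, θ, v) (0, 1, 0)
      + S.bb t θ v * fderiv ℝ S.F (t, θ, v) (0, 0, 1, 0, 0) = 0 := by
  have ht' := mem_of_Ioo ht
  have h := S.hvlasov t ht' θ v
  have e1 : ptf S.f t θ v = fderiv ℝ S.F (t, θ, v) (1, 0, 0) := (hasDerivAt_f_t ht v).deriv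
  have e2 : pθf S.f t θ v = fderiv ℝ S.F (t, θ, v) (0, 1, 0) := (hasDerivAt_f_θ ht v).deriv
  have e3 : pv1 (S.f t θ) v = fderiv ℝ S.F (t, θ, v) (0, 0, 1, 0, 0) := (hasDerivAt_f_v ht v).deriv
  have e4 : pv1 (v0 S.α S.ν S.U S.A t θ) v = -S.aa t θ v := by
    have : (fun y => v0 S.α S.ν S.U S.A t θ (y, v.2.1, v.2.2))
        = fun y => -(S.s t θ * S.ρ t θ (y, v.2.1, v.2.2)) := funext fun y => v0_eq ht' θ _
    unfold pv1
    rw [this, (((hasDerivAt_ρ_v t θ v.1 v.2.1 v.2.2).const_mul (S.s t θ)).fun_neg).deriv]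
    unfold aa
    ring
  have e5 : deriv (fun x => v0 S.α S.ν S.U S.A t x v) θ
      = -(pθ S.s t θ * S.ρ t θ v) - S.s t θ * (pθ (S.g v.2.1 v.2.2) t θ / (2 * S.ρ t θ v)) := by
    have : (fun x => v0 S.α S.ν S.U S.A t x v) = fun x => -(S.s t x * S.ρ t x v) :=
      funext fun x => v0_eq ht' x v
    have h1 := (sms.mono Ioo_subset_Ioc_self).hasDerivAt_θ isOpen_Ioo ht (θ := θ)
    rw [this, (h1.fun_mul (hasDerivAt_ρ_θ ht v)).fun_neg.deriv]
    ring
  rw [e1, e2, e3, e4, e5] at h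
  rw [h]
  unfold bb frc s
  ring

lemma hasDerivAt_f_char (ht : t ∈ Ioo S.tp S.ti) (y v2 v3 : ℝ) :
    HasDerivAt (fun r => S.f (t + r) (θ + S.aa t θ (y, v2, v3) * r)
      (y + S.bb t θ (y, v2, v3) * r, v2, v3)) 0 0 := by
  have h := F_line ht (θ := θ) (y, v2, v3) (1, S.aa t θ (y, v2, v3), S.bb t θ (y, v2, v3), 0, 0)
  have e : fderiv ℝ S.F (t, θ, y, v2, v3)
      (1, S.aa t θ (y, v2, v3), S.bb t θ (y, v2, v3), 0, 0) = 0 := by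
    refine Eq.trans ?_ (vlasov ht (θ := θ) (y, v2, v3))
    rw [← smul_eq_mul, ← smul_eq_mul, ← map_smul, ← map_smul, ← map_add, ← map_add]
    congr 1
    simp
  rw [e] at h
  refine h.congr_of_eventuallyEq (Eventually.of_forall fun r => ?_)
  simp [F, mul_comm]

end EVSol

namespace EVSol

variable {S : EVSol} {t θ : ℝ}

lemma exists_w_le (S : EVSol) {t1 t2 : ℝ} (h1 : 0 < t1) (C R : ℝ) : ∃ B, 0 ≤ B ∧ ∀ t ∈ Icc t1 t2, ∀ θ v2 v3,
    |S.U t θ| ≤ C → |S.A t θ| ≤ C → |v2| ≤ R → |v3| ≤ R → S.w v2 v3 t θ ≤ B := by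
  obtain ⟨B, hB⟩ := (isCompact_Icc (a := t1) (b := t2)).prod ((isCompact_Icc (a := -C) (b := C)).prod
    ((isCompact_Icc (a := -C) (b := C)).prod ((isCompact_Icc (a := -R) (b := R)).prod
    (isCompact_Icc (a := -R) (b := R))))) |>.exists_bound_of_continuousOn
    (f := fun p : ℝ × ℝ × ℝ × ℝ × ℝ => Real.exp (-2 * p.2.1) + Real.exp (-4 * p.2.1) * p.2.2.2.1 ^ 2
    + (p.1 ^ 2)⁻¹ * (p.2.2.2.2 - p.2.2.1 * p.2.2.2.1) ^ 2) (by
      refine ContinuousOn.add (by fun_prop) (ContinuousOn.mul (ContinuousOn.inv₀ (by fun_prop) ?_)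
        (by fun_prop))
      rintro p ⟨hp, -⟩
      have : 0 < p.1 := h1.trans_le hp.1
      positivity)
  refine ⟨max B 0, le_max_right _ _, fun t ht θ v2 v3 hU hA h2 h3 => ?_⟩
  exact (le_abs_self _).trans ((hB (t, S.U t θ, S.A t θ, v2, v3)
    ⟨ht, abs_le.1 hU, abs_le.1 hA, abs_le.1 h2, abs_le.1 h3⟩).trans (le_max_left _ _))

lemma exists_pθ_w_le (S : EVSol) {t1 t2 : ℝ} (h1 : 0 < t1) (C R : ℝ) : ∃ B, 0 ≤ B ∧ ∀ t ∈ Icc t1 t2,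
    t ∈ Ioo S.tp S.ti → ∀ θ v2 v3, |S.U t θ| ≤ C → |S.A t θ| ≤ C → |v2| ≤ R → |v3| ≤ R →
    |pθ (S.w v2 v3) t θ| ≤ B * (|pθ S.U t θ| + |pθ S.A t θ|) := by
  obtain ⟨B, hB⟩ := (isCompact_Icc (a := t1) (b := t2)).prod ((isCompact_Icc (a := -C) (b := C)).prod
    ((isCompact_Icc (a := -C) (b := C)).prod ((isCompact_Icc (a := -R) (b := R)).prod
    (isCompact_Icc (a := -R) (b := R))))) |>.exists_bound_of_continuousOn
    (f := fun p : ℝ × ℝ × ℝ × ℝ × ℝ => ((-2 * Real.exp (-2 * p.2.1) -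
      4 * Real.exp (-4 * p.2.1) * p.2.2.2.1 ^ 2,
      -(2 * (p.1 ^ 2)⁻¹ * (p.2.2.2.2 - p.2.2.1 * p.2.2.2.1) * p.2.2.2.1)) : ℝ × ℝ)) (by
      refine ContinuousOn.prodMk (by fun_prop) (ContinuousOn.neg (ContinuousOn.mul (ContinuousOn.mul
        (ContinuousOn.mul (by fun_prop) (ContinuousOn.inv₀ (by fun_prop) ?_))
        (by fun_prop)) (by fun_prop)))
      rintro p ⟨hp, -⟩
      have : 0 < p.1 := h1.trans_le hp.1
      positivity)
  refine ⟨max B 0, le_max_right _ _, fun t ht hti θ v2 v3 hU hA h2 h3 => ?_⟩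
  have := (hB (t, S.U t θ, S.A t θ, v2, v3)
    ⟨ht, abs_le.1 hU, abs_le.1 hA, abs_le.1 h2, abs_le.1 h3⟩).trans (le_max_left B 0)
  simp only [Prod.norm_def, sup_le_iff, Real.norm_eq_abs] at this
  obtain ⟨e1, e2⟩ := this
  rw [pθ_w hti]
  set X := -2 * Real.exp (-2 * S.U t θ) - 4 * Real.exp (-4 * S.U t θ) * v2 ^ 2
  set Y := -(2 * (t ^ 2)⁻¹ * (v3 - S.A t θ * v2) * v2)
  have : -2 * pθ S.U t θ * Real.exp (-2 * S.U t θ)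
      - 4 * pθ S.U t θ * Real.exp (-4 * S.U t θ) * v2 ^ 2
      - 2 * (t ^ 2)⁻¹ * (v3 - S.A t θ * v2) * (pθ S.A t θ * v2)
      = X * pθ S.U t θ + Y * pθ S.A t θ := by simp only [X, Y]; ring
  rw [this]
  refine (abs_add_le _ _).trans ?_
  rw [abs_mul, abs_mul, mul_add]
  gcongr

lemma exists_frc_le (S : EVSol) {t1 t2 : ℝ} (h1 : 0 < t1) (C R : ℝ) : ∃ B, 0 ≤ B ∧ ∀ t ∈ Icc t1 t2,
    t ∈ Ioo S.tp S.ti → ∀ θ v2 v3, |S.U t θ| ≤ C → |S.A t θ| ≤ C → |S.J t θ| ≤ C → |S.K t θ| ≤ C →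
    |v2| ≤ R → |v3| ≤ R →
    |S.frc v2 v3 t θ| ≤ S.s t θ * Real.exp (2 * S.ν t θ) * B := by
  obtain ⟨B, hB⟩ := (isCompact_Icc (a := t1) (b := t2)).prod ((isCompact_Icc (a := -C) (b := C)).prod
    ((isCompact_Icc (a := -C) (b := C)).prod ((isCompact_Icc (a := -C) (b := C)).prod
    ((isCompact_Icc (a := -C) (b := C)).prod ((isCompact_Icc (a := -R) (b := R)).prod
    (isCompact_Icc (a := -R) (b := R))))))) |>.exists_bound_of_continuousOn
    (f := fun p : ℝ × ℝ × ℝ × ℝ × ℝ × ℝ × ℝ =>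
      (p.1 ^ 3)⁻¹ * ((p.2.2.2.2.1 - p.2.2.1 * p.2.2.2.1) * (p.2.2.2.2.2.2 - p.2.2.1 * p.2.2.2.2.2.1))
      + p.1⁻¹ * (Real.exp (-4 * p.2.1) * p.2.2.2.1 * p.2.2.2.2.2.1)) (by
      refine ContinuousOn.add (ContinuousOn.mul (ContinuousOn.inv₀ (by fun_prop) ?_) (by fun_prop))
        (ContinuousOn.mul (ContinuousOn.inv₀ (by fun_prop) ?_) (by fun_prop))
      all_goals
        rintro p ⟨hp, -⟩
        have : 0 < p.1 := h1.trans_le hp.1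
        positivity)
  refine ⟨max B 0, le_max_right _ _, fun t ht hti θ v2 v3 hU hA hJ hK h2 h3 => ?_⟩
  have := (hB (t, S.U t θ, S.A t θ, S.J t θ, S.K t θ, v2, v3)
    ⟨ht, abs_le.1 hU, abs_le.1 hA, abs_le.1 hJ, abs_le.1 hK, abs_le.1 h2, abs_le.1 h3⟩).trans
    (le_max_left B 0)
  simp only [Real.norm_eq_abs] at this
  have hs := s_pos (mem_of_Ioo hti) θ
  have e2 : Real.exp (2 * S.ν t θ - 4 * S.U t θ)
      = Real.exp (2 * S.ν t θ) * Real.exp (-4 * S.U t θ) := by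
    rw [← Real.exp_add]; congr 1; ring
  have e : S.frc v2 v3 t θ = S.s t θ * Real.exp (2 * S.ν t θ) *
    ((t ^ 3)⁻¹ * ((S.K t θ - S.A t θ * S.J t θ) * (v3 - S.A t θ * v2))
      + t⁻¹ * (Real.exp (-4 * S.U t θ) * S.J t θ * v2)) := by
    unfold frc
    rw [e2]
    simp only [div_eq_mul_inv]
    ring
  rw [e, abs_mul, abs_of_pos (by positivity : 0 < S.s t θ * Real.exp (2 * S.ν t θ))]
  gcongr

set_option maxHeartbeats 1000000 in
lemma exists_bb_le (S : EVSol) {t1 : ℝ} (h1 : S.tp < t1) {R : ℝ} (hR : 0 ≤ R) : ∃ C, 0 ≤ C ∧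
    ∀ t ∈ Ico t1 S.ti, ∀ θ (v : V3), |v.2.1| ≤ R → |v.2.2| ≤ R →
      |S.bb t θ v| ≤ C * (1 + |v.1|) := by
  obtain ⟨C1, hC1, b1⟩ := SmOn.exists_bound_Icc (smU (S := S)) S.hUper h1 S.hti
  obtain ⟨C2, hC2, b2⟩ := SmOn.exists_bound_Icc (smA (S := S)) S.hAper h1 S.hti
  obtain ⟨C3, hC3, b3⟩ := SmOn.exists_bound_Icc (smν (S := S)) S.hνper h1 S.hti
  obtain ⟨C4, hC4, b4⟩ := SmOn.exists_bound_Icc (sms (S := S)) pers h1 S.hti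
  obtain ⟨C5, hC5, b5⟩ := SmOn.exists_bound_Icc (smJ (S := S)) S.hJper h1 S.hti
  obtain ⟨C6, hC6, b6⟩ := SmOn.exists_bound_Icc (smK (S := S)) S.hKper h1 S.hti
  set C := C1 + C2 + C3 + C4 + C5 + C6 with hCdef
  have hC : 0 ≤ C := by positivity
  have ht1 : 0 < t1 := S.htp.trans h1
  obtain ⟨Bw, hBw, bw⟩ := S.exists_w_le (t2 := S.ti) ht1 C R
  obtain ⟨Bθ, hBθ, bθ⟩ := S.exists_pθ_w_le (t2 := S.ti) ht1 C R
  obtain ⟨Bf, hBf, bf⟩ := S.exists_frc_le (t2 := S.ti) ht1 C R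
  set X := Real.exp (2 * C)
  have hX : 0 < X := Real.exp_pos _
  have hX1 : 1 ≤ X := Real.one_le_exp (by linarith)
  set D := C * (1 + X * Bw) + C * (X * (2 * C * Bw + Bθ * (C + C)) / 2 * X) + C * X * Bf with hD
  refine ⟨C + D, by positivity, fun t ht θ v hv2 hv3 => ?_⟩
  have ht' : t ∈ Icc t1 S.ti := Ico_subset_Icc_self ht
  have hto : t ∈ Ioo S.tp S.ti := ⟨h1.trans_le ht.1, ht.2⟩
  obtain ⟨u1, -, u2, -⟩ := b1 t ht' θ
  obtain ⟨a1, -, a2, -⟩ := b2 t ht' θ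
  obtain ⟨n1, -, n2, -⟩ := b3 t ht' θ
  obtain ⟨s1, -, s2, -⟩ := b4 t ht' θ
  obtain ⟨j1, -, -, -⟩ := b5 t ht' θ
  obtain ⟨k1, -, -, -⟩ := b6 t ht' θ
  have hle : C1 ≤ C ∧ C2 ≤ C ∧ C3 ≤ C ∧ C4 ≤ C ∧ C5 ≤ C ∧ C6 ≤ C := by
    refine ⟨?_, ?_, ?_, ?_, ?_, ?_⟩ <;> linarith
  obtain ⟨l1, l2, l3, l4, l5, l6⟩ := hle
  have hw := bw t ht' θ v.2.1 v.2.2 (u1.trans l1) (a1.trans l2) hv2 hv3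
  have hwθ := bθ t ht' hto θ v.2.1 v.2.2 (u1.trans l1) (a1.trans l2) hv2 hv3
  have hf := bf t ht' hto θ v.2.1 v.2.2 (u1.trans l1) (a1.trans l2) (j1.trans l5) (k1.trans l6) hv2 hv3
  have hsp := s_pos (mem_of_Ioo hto) θ
  have hwp := S.w_pos (t := t) θ v.2.1 v.2.2
  have hs : S.s t θ ≤ C := (le_abs_self _).trans (s1.trans l4)
  have hν : Real.exp (2 * S.ν t θ) ≤ X := Real.exp_le_exp.2 (by linarith [le_abs_self (S.ν t θ)])
  have hg : S.g v.2.1 v.2.2 t θ ≤ X * Bw := by unfold g; gcongr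
  have hgl : X⁻¹ * X⁻¹ ≤ S.g v.2.1 v.2.2 t θ := by
    unfold g
    rw [← Real.exp_neg]
    have h1 : Real.exp (-(2 * C)) ≤ Real.exp (2 * S.ν t θ) :=
      Real.exp_le_exp.2 (by linarith [neg_abs_le (S.ν t θ)])
    have h2 : Real.exp (-(2 * C)) ≤ S.w v.2.1 v.2.2 t θ := by
      have : Real.exp (-(2 * C)) ≤ Real.exp (-2 * S.U t θ) :=
        Real.exp_le_exp.2 (by linarith [le_abs_self (S.U t θ)])
      refine this.trans ?_
      unfold w
      have : 0 ≤ Real.exp (-4 * S.U t θ) * v.2.1 ^ 2 + (t ^ 2)⁻¹ * (v.2.2 - S.A t θ * v.2.1) ^ 2 := by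
        positivity
      linarith
    gcongr
  have hρl : X⁻¹ ≤ S.ρ t θ v := by
    refine Real.le_sqrt_of_sq_le ?_
    rw [pow_two]
    linarith [sq_nonneg v.1]
  have hρp := S.ρ_pos t θ v
  have hρu : S.ρ t θ v ≤ 1 + X * Bw + |v.1| := by
    refine Real.sqrt_le_iff.2 ⟨by positivity, ?_⟩
    have : 0 ≤ X * Bw := by positivity
    have e : ∀ Y z : ℝ, 0 ≤ Y → 0 ≤ z → Y + z ^ 2 ≤ (1 + Y + z) ^ 2 := fun Y z hY hz => by
      nlinarith [mul_nonneg hY hz]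
    have := e _ _ this (abs_nonneg v.1)
    rw [sq_abs] at this
    linarith
  have hgθ : |pθ (S.g v.2.1 v.2.2) t θ| ≤ X * (2 * C * Bw + Bθ * (C + C)) := by
    rw [pθ_g hto, abs_mul, abs_of_pos (Real.exp_pos _)]
    gcongr
    refine (abs_add_le _ _).trans ?_
    rw [abs_mul, abs_mul, abs_of_pos hwp, abs_two]
    have : |pθ (S.w v.2.1 v.2.2) t θ| ≤ Bθ * (C + C) := hwθ.trans (by gcongr <;> linarith)
    have : |pθ S.ν t θ| ≤ C := n2.trans l3
    gcongr
  have i1 : |pθ S.s t θ * S.ρ t θ v| ≤ C * (1 + X * Bw + |v.1|) := by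
    rw [abs_mul, abs_of_pos hρp]
    have : |pθ S.s t θ| ≤ C := s2.trans l4
    gcongr
  have i2 : |S.s t θ * (pθ (S.g v.2.1 v.2.2) t θ / (2 * S.ρ t θ v))|
      ≤ C * (X * (2 * C * Bw + Bθ * (C + C)) / 2 * X) := by
    rw [abs_mul, abs_of_pos hsp, abs_div, abs_of_pos (by positivity : 0 < 2 * S.ρ t θ v)]
    have : (S.ρ t θ v)⁻¹ ≤ X := inv_le_of_inv_le₀ hX hρl
    have : |pθ (S.g v.2.1 v.2.2) t θ| / (2 * S.ρ t θ v)
        = |pθ (S.g v.2.1 v.2.2) t θ| / 2 * (S.ρ t θ v)⁻¹ := by field_simp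
    rw [this]
    gcongr
  have i3 : |S.frc v.2.1 v.2.2 t θ| ≤ C * X * Bf := hf.trans (by gcongr)
  have : |S.bb t θ v| ≤ C * (1 + X * Bw + |v.1|) + C * (X * (2 * C * Bw + Bθ * (C + C)) / 2 * X)
      + C * X * Bf := by
    unfold bb
    refine (abs_add_le _ _).trans (add_le_add ?_ i3)
    refine (abs_sub _ _).trans (add_le_add ?_ i2)
    rwa [abs_neg]
  have hD0 : 0 ≤ D := by positivity
  have hDv := mul_nonneg hD0 (abs_nonneg v.1)
  calc |S.bb t θ v| ≤ C * |v.1| + D := by rw [hD]; linarith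
    _ ≤ (C + D) * (1 + |v.1|) := by linarith

lemma f_continuousOn_slice {t1 : ℝ} (h1 : S.tp < t1) (v2 v3 : ℝ) :
    ContinuousOn (fun p : ℝ × ℝ × ℝ => S.f p.1 p.2.1 (p.2.2, v2, v3)) (Icc t1 S.ti ×ˢ univ) :=
  ContinuousOn.comp (g := S.F) (f := fun p : ℝ × ℝ × ℝ => (p.1, p.2.1, p.2.2, v2, v3))
    F_continuousOn (by fun_prop)
    (fun p hp => ⟨⟨h1.trans_le hp.1.1, hp.1.2⟩, mem_univ _⟩)

/-- Bounds at the initial time are preserved along characteristics. -/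
lemma f_le_of_f_ti_le {v2 v3 c : ℝ} (h : ∀ θ y, S.f S.ti θ (y, v2, v3) ≤ c)
    (ht : t ∈ Ioc S.tp S.ti) (y : ℝ) : S.f t θ (y, v2, v3) ≤ c := by
  obtain ⟨C, hC, hb⟩ := S.exists_bb_le ht.1 (R := max |v2| |v3|) (by positivity)
  exact transport_le (t1 := t) (t2 := S.ti) (g := fun t x y => S.f t x (y, v2, v3))
    (a := fun t x y => S.aa t x (y, v2, v3)) (b := fun t x y => S.bb t x (y, v2, v3))
    (ψ := fun _ _ _ => -1) (f_continuousOn_slice ht.1 v2 v3) (fun t x y => S.hfper t x _)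
    continuousOn_const (fun _ _ _ => rfl)
    (fun r hr x y => hasDerivAt_f_char ⟨ht.1.trans_le hr.1, hr.2⟩ y v2 v3)
    (fun r hr x y h0 => by norm_num at h0) hC
    (fun r hr x y => hb r hr x (y, v2, v3) (le_max_left _ _) (le_max_right _ _))
    (fun x y _ => h x y) t (left_mem_Icc.2 ht.2) θ y (by norm_num)

/-- The distribution function is bounded, and so is its support in `v₂`, `v₃`. -/
lemma exists_f_bounds (S : EVSol) : ∃ F R : ℝ, 0 ≤ F ∧ 0 < R ∧ ∀ t ∈ Ioc S.tp S.ti, ∀ θ (v : V3), S.f t θ v ≤ F ∧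
    (S.f t θ v ≠ 0 → |v.2.1| ≤ R ∧ |v.2.2| ≤ R) := by
  have hti : S.ti ∈ Ioc S.tp S.ti := ⟨S.hti, le_rfl⟩
  obtain ⟨R, hR⟩ := S.hfsupp S.ti hti
  have hRp : R ≤ |R| + 1 := by linarith [le_abs_self R]
  obtain ⟨F, hF⟩ := ((isCompact_Icc (a := (0 : ℝ)) (b := 1)).prod
    (isCompact_closedBall (0 : V3) R)).exists_bound_of_continuousOn
    (f := fun p : ℝ × V3 => S.f S.ti p.1 p.2)
    (ContinuousOn.comp (g := S.F) (f := fun p : ℝ × V3 => (S.ti, p.1, p.2)) F_continuousOn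
      (by fun_prop) (fun p _ => ⟨hti, mem_univ _⟩))
  refine ⟨max F 0, |R| + 1, le_max_right _ _, by positivity, fun t ht θ v => ⟨?_, fun h => ?_⟩⟩
  · refine f_le_of_f_ti_le (v2 := v.2.1) (v3 := v.2.2) (fun θ y => ?_) ht v.1
    by_cases hv : ‖(y, v.2.1, v.2.2)‖ ≤ R
    · rw [← Per.fract (G := fun t θ => S.f t θ (y, v.2.1, v.2.2)) (fun t θ => S.hfper t θ _)]
      exact (le_abs_self _).trans ((hF (Int.fract θ, y, v.2.1, v.2.2)
        ⟨fract_mem_Icc θ, by simpa using hv⟩).trans (le_max_left _ _))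
    · rw [hR θ _ (not_le.1 hv)]; exact le_max_right _ _
  · by_contra hcon
    refine h (le_antisymm (f_le_of_f_ti_le (v2 := v.2.1) (v3 := v.2.2) (fun θ y => ?_) ht v.1)
      (S.hfnn t ht θ v))
    refine (hR θ _ ?_).le
    have h2 : |v.2.1| ≤ ‖(y, v.2.1, v.2.2)‖ := by simp [Prod.norm_def]
    have h3 : |v.2.2| ≤ ‖(y, v.2.1, v.2.2)‖ := by simp [Prod.norm_def]
    by_contra hle
    exact hcon ⟨by linarith, by linarith⟩

/-- The velocity support of `f` is bounded uniformly away from the singular time. -/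
lemma exists_support_bound (S : EVSol) {t1 : ℝ} (h1 : S.tp < t1) : ∃ R1, 0 < R1 ∧ ∀ t ∈ Icc t1 S.ti, ∀ θ (v : V3),
    S.f t θ v ≠ 0 → ‖v‖ ≤ R1 := by
  have hti : S.ti ∈ Ioc S.tp S.ti := ⟨S.hti, le_rfl⟩
  obtain ⟨R0, hR0⟩ := S.hfsupp S.ti hti
  obtain ⟨F, R, hF, hR, hfR⟩ := S.exists_f_bounds
  obtain ⟨C, hC, hb⟩ := S.exists_bb_le h1 hR.le
  set Λ := 1 + (|R0| + 1) ^ 2 with hΛ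
  have hΛp : 0 < Λ := by positivity
  set L := 4 * C + 1 with hL
  set X := Λ * Real.exp (L * (S.ti - t1)) with hX
  have hXp : 0 < X := by positivity
  refine ⟨max X R, lt_max_of_lt_left hXp, fun t ht θ v hv => ?_⟩
  have ht' : t ∈ Ioc S.tp S.ti := ⟨h1.trans_le ht.1, ht.2⟩
  obtain ⟨hv2, hv3⟩ := (hfR t ht' θ v).2 hv
  have key := transport_le (t1 := t1) (t2 := S.ti) (c := 0) (g := fun t x y => S.f t x (y, v.2.1, v.2.2))
    (a := fun t x y => S.aa t x (y, v.2.1, v.2.2)) (b := fun t x y => S.bb t x (y, v.2.1, v.2.2))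
    (ψ := fun t _ y => Λ * Real.exp (L * (S.ti - t)) - (1 + y ^ 2))
    (f_continuousOn_slice h1 _ _) (fun t x y => S.hfper t x _)
    (by fun_prop) (fun _ _ _ => rfl)
    (fun r hr x y => hasDerivAt_f_char ⟨h1.trans_le hr.1, hr.2⟩ y _ _)
    (fun r hr x y h0 => by
      set b := S.bb r x (y, v.2.1, v.2.2) with hbdef
      refine ⟨Λ * (Real.exp (L * (S.ti - r)) * -L) - 2 * y * b, ?_, ?_⟩
      · have h2 : -(2 * y * b) ≤ 2 * |y| * (C * (1 + |y|)) := by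
          calc -(2 * y * b) ≤ |2 * y * b| := neg_le_abs _
            _ = 2 * |y| * |b| := by rw [abs_mul, abs_mul]; norm_num
            _ ≤ _ := by gcongr; exact hb r hr x _ hv2 hv3
        have h3 : 2 * |y| * (1 + |y|) ≤ 4 * (1 + y ^ 2) := by
          nlinarith [sq_abs y, sq_nonneg (|y| - 1)]
        have h4 : Λ * (Real.exp (L * (S.ti - r)) * -L) = -((1 + y ^ 2) * L) := by
          have : Λ * Real.exp (L * (S.ti - r)) = 1 + y ^ 2 := by linarith
          rw [← this]; ring
        rw [h4, hL]
        nlinarith [mul_le_mul_of_nonneg_left h3 hC, sq_nonneg y]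
      · have e1 : HasDerivAt (fun s : ℝ => y + b * s) b 0 := by
          simpa using ((hasDerivAt_id (0 : ℝ)).const_mul b).const_add y
        have e2 : HasDerivAt (fun s : ℝ => L * (S.ti - (r + s))) (-L) 0 := by
          simpa using (((hasDerivAt_id (0 : ℝ)).const_add r).const_sub S.ti).const_mul L
        have := ((e2.exp).const_mul Λ).sub ((e1.pow 2).const_add 1)
        simp only [add_zero, mul_zero] at this
        exact this.congr_deriv (by norm_num)) hC
    (fun r hr x y => hb r hr x (y, v.2.1, v.2.2) hv2 hv3)
    (fun x y h0 => (hR0 x _ (by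
      simp only [sub_self, mul_zero, Real.exp_zero, mul_one] at h0
      have h3 : |R0| + 1 ≤ |y| := by
        refine abs_le_of_sq_le_sq' ?_ (abs_nonneg y) |>.2
        rw [sq_abs]; linarith
      have h2 : |y| ≤ ‖(y, v.2.1, v.2.2)‖ := by simp [Prod.norm_def]
      linarith [le_abs_self R0])).le) t ht θ v.1
  have hpos : 0 < Λ * Real.exp (L * (S.ti - t)) - (1 + v.1 ^ 2) := by
    by_contra! hcon
    exact hv (le_antisymm (key hcon) (S.hfnn t ht' θ v))
  have hv1 : |v.1| ≤ X := by
    have : Λ * Real.exp (L * (S.ti - t)) ≤ X := by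
      rw [hX]; have : 0 ≤ L := by positivity
      gcongr; exact ht.1
    nlinarith [sq_abs v.1, sq_nonneg (|v.1| - 1)]
  simp only [Prod.norm_def, Real.norm_eq_abs, sup_le_iff]
  exact ⟨hv1.trans (le_max_left _ _), hv2.trans (le_max_right _ _), hv3.trans (le_max_right _ _)⟩

end EVSol

/-- Differentiation under the integral sign over a compact set. -/
lemma hasDerivAt_setIntegral {Y : Type*} [TopologicalSpace Y] [T2Space Y] [MeasurableSpace Y]
    [OpensMeasurableSpace Y] {μ : Measure Y} [IsFiniteMeasureOnCompacts μ] {k : Set Y}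
    (hk : IsCompact k) {s : Set ℝ} (hs : IsOpen s) {G G' : ℝ → Y → ℝ}
    (hG : ContinuousOn (fun p : ℝ × Y => G p.1 p.2) (s ×ˢ k))
    (hG' : ContinuousOn (fun p : ℝ × Y => G' p.1 p.2) (s ×ˢ k))
    (hd : ∀ x ∈ s, ∀ y ∈ k, HasDerivAt (fun x => G x y) (G' x y) x) {x : ℝ} (hx : x ∈ s) :
    HasDerivAt (fun x => ∫ y in k, G x y ∂μ) (∫ y in k, G' x y ∂μ) x := by
  obtain ⟨ε, hε, hεs⟩ := Metric.nhds_basis_closedBall.mem_iff.1 (hs.mem_nhds hx)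
  obtain ⟨C, hC⟩ := ((isCompact_closedBall x ε).prod hk).exists_bound_of_continuousOn
    (hG'.mono (prod_mono hεs Subset.rfl))
  have hi : ∀ {H : ℝ → Y → ℝ}, ContinuousOn (fun p : ℝ × Y => H p.1 p.2) (s ×ˢ k) →
      ∀ z ∈ s, IntegrableOn (H z) k μ := fun {H} hH z hz =>
    ContinuousOn.integrableOn_compact' hk hk.measurableSet
      (ContinuousOn.comp (g := fun p : ℝ × Y => H p.1 p.2) hH (f := fun y => (z, y)) (by fun_prop)
        (fun y hy => ⟨hz, hy⟩))
  refine (hasDerivAt_integral_of_dominated_loc_of_deriv_le (bound := fun _ => C)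
    (s := Metric.closedBall x ε) (Metric.closedBall_mem_nhds x hε) ?_ (hi hG x hx)
    (hi hG' x hx).aestronglyMeasurable ?_ ?_ ?_).2
  · filter_upwards [hs.mem_nhds hx] with z hz using (hi hG z hz).aestronglyMeasurable
  · filter_upwards [ae_restrict_mem hk.measurableSet] with y hy z hz using hC (z, y) ⟨hz, hy⟩
  · exact integrableOn_const hk.measure_lt_top.ne
  · filter_upwards [ae_restrict_mem hk.measurableSet] with y hy z hz using hd z (hεs hz) y hy

/-- Continuity of integrals over a compact set. -/
lemma continuousOn_setIntegral {Y : Type*} [TopologicalSpace Y] [T2Space Y] [MeasurableSpace Y]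
    [OpensMeasurableSpace Y] {μ : Measure Y} [IsFiniteMeasureOnCompacts μ] {k : Set Y}
    (hk : IsCompact k) {X : Type*} [TopologicalSpace X] [FirstCountableTopology X]
    {s : Set X} (hs : IsCompact s) {G : X → Y → ℝ}
    (hG : ContinuousOn (fun p : X × Y => G p.1 p.2) (s ×ˢ k)) :
    ContinuousOn (fun x => ∫ y in k, G x y ∂μ) s := by
  obtain ⟨C, hC⟩ := (hs.prod hk).exists_bound_of_continuousOn hG
  refine continuousOn_of_dominated (bound := fun _ => C) (fun x hx => ?_) (fun x hx => ?_) ?_ ?_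
  · exact (ContinuousOn.integrableOn_compact' hk hk.measurableSet
      (ContinuousOn.comp (g := fun p : X × Y => G p.1 p.2) hG (f := fun y => (x, y)) (by fun_prop)
        (fun y hy => ⟨hx, hy⟩))).aestronglyMeasurable
  · filter_upwards [ae_restrict_mem hk.measurableSet] with y hy using hC (x, y) ⟨hx, hy⟩
  · exact integrableOn_const hk.measure_lt_top.ne
  · filter_upwards [ae_restrict_mem hk.measurableSet] with y hy
    exact ContinuousOn.comp (g := fun p : X × Y => G p.1 p.2) hG (f := fun x => (x, y))
      (by fun_prop) (fun x hx => ⟨hx, hy⟩)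

/-- The integral over a cylinder of a derivative along the axis vanishes when the boundary values
agree. -/
lemma setIntegral_prod_deriv_eq_zero {Z : Type*} [TopologicalSpace Z] [MeasurableSpace Z]
    {μ : Measure Z} [SFinite μ] {a b : ℝ} (hab : a ≤ b) {k : Set Z} {H H' : ℝ → Z → ℝ}
    (hd : ∀ z ∈ k, ∀ x ∈ Icc a b, HasDerivAt (fun x => H x z) (H' x z) x)
    (hk : MeasurableSet k)
    (hi : IntegrableOn (fun p : ℝ × Z => H' p.1 p.2) (Icc a b ×ˢ k) (volume.prod μ))
    (hb : ∀ z ∈ k, H a z = H b z) :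
    ∫ p in Icc a b ×ˢ k, H' p.1 p.2 ∂(volume.prod μ) = 0 := by
  have hi' : Integrable (fun p : ℝ × Z => H' p.1 p.2)
      ((volume.restrict (Icc a b)).prod (μ.restrict k)) := by
    rwa [Measure.prod_restrict]
  rw [← Measure.prod_restrict, integral_prod_symm _ hi']
  refine integral_eq_zero_of_ae ?_
  filter_upwards [hi'.prod_left_ae, ae_restrict_mem hk] with z hz hzk
  change ∫ x in Icc a b, H' x z = 0
  rw [integral_Icc_eq_integral_Ioc, ← intervalIntegral.integral_of_le hab,
    intervalIntegral.integral_eq_sub_of_hasDerivAt (f := fun x => H x z)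
      (fun x hx => hd z hzk x (by rwa [uIcc_of_le hab] at hx))
      ((intervalIntegrable_iff_integrableOn_Icc_of_le hab).2 hz), hb z hzk, sub_self]

namespace EVSol

variable {S : EVSol} {t θ : ℝ}

/-- particle density -/
def n (S : EVSol) (t θ : ℝ) : ℝ := ∫ v : V3, S.f t θ v

/-- velocity box -/
def box (r : ℝ) : Set V3 := Icc (-r) r ×ˢ (Icc (-r) r ×ˢ Icc (-r) r)

lemma isCompact_box (r : ℝ) : IsCompact (box r) :=
  isCompact_Icc.prod (isCompact_Icc.prod isCompact_Icc)

lemma norm_le_iff_mem_box (r : ℝ) (v : V3) : ‖v‖ ≤ r ↔ v ∈ box r := by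
  simp only [box, Prod.norm_def, sup_le_iff, Real.norm_eq_abs, abs_le, mem_prod, mem_Icc]

lemma continuous_s (ht : t ∈ Ioc S.tp S.ti) : Continuous (S.s t) := sms.continuous_slice ht

lemma continuous_w (ht : t ∈ Ioc S.tp S.ti) :
    Continuous fun p : ℝ × V3 => S.w p.2.2.1 p.2.2.2 t p.1 := by
  have h1 : Continuous (S.U t) := smU.continuous_slice ht
  have h2 : Continuous (S.A t) := smA.continuous_slice ht
  unfold w
  fun_prop

lemma continuous_g (ht : t ∈ Ioc S.tp S.ti) :
    Continuous fun p : ℝ × V3 => S.g p.2.2.1 p.2.2.2 t p.1 := by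
  have h1 : Continuous (S.ν t) := smν.continuous_slice ht
  have h2 := S.continuous_w ht
  unfold g
  fun_prop

lemma continuous_ρ (ht : t ∈ Ioc S.tp S.ti) : Continuous fun p : ℝ × V3 => S.ρ t p.1 p.2 := by
  have h2 := S.continuous_g ht
  unfold ρ
  fun_prop

lemma continuous_frc (ht : t ∈ Ioc S.tp S.ti) :
    Continuous fun p : ℝ × V3 => S.frc p.2.2.1 p.2.2.2 t p.1 := by
  have h1 : Continuous (S.U t) := smU.continuous_slice ht
  have h2 : Continuous (S.A t) := smA.continuous_slice ht
  have h3 : Continuous (S.ν t) := smν.continuous_slice ht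
  have h4 : Continuous (S.J t) := smJ.continuous_slice ht
  have h5 : Continuous (S.K t) := smK.continuous_slice ht
  have h6 := S.continuous_s ht
  unfold frc
  fun_prop

lemma continuous_pθ_g (ht : t ∈ Ioo S.tp S.ti) :
    Continuous fun p : ℝ × V3 => pθ (S.g p.2.2.1 p.2.2.2) t p.1 := by
  have ht' := mem_of_Ioo ht
  have h1 : Continuous (S.U t) := smU.continuous_slice ht'
  have h2 : Continuous (S.A t) := smA.continuous_slice ht'
  have h3 : Continuous (S.ν t) := smν.continuous_slice ht'
  have k1 : Continuous (pθ S.U t) :=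
    ((smU.mono Ioo_subset_Ioc_self).dθ isOpen_Ioo).continuous_slice ht
  have k2 : Continuous (pθ S.A t) :=
    ((smA.mono Ioo_subset_Ioc_self).dθ isOpen_Ioo).continuous_slice ht
  have k3 : Continuous (pθ S.ν t) :=
    ((smν.mono Ioo_subset_Ioc_self).dθ isOpen_Ioo).continuous_slice ht
  have h4 := S.continuous_w ht'
  simp only [pθ_g ht, pθ_w ht]
  fun_prop

lemma continuous_aa (ht : t ∈ Ioc S.tp S.ti) : Continuous fun p : ℝ × V3 => S.aa t p.1 p.2 := by
  have h1 := S.continuous_s ht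
  exact Continuous.div (by fun_prop) (S.continuous_ρ ht) fun p => (ρ_pos _ _ _).ne'

lemma continuous_bb (ht : t ∈ Ioo S.tp S.ti) : Continuous fun p : ℝ × V3 => S.bb t p.1 p.2 := by
  have ht' := mem_of_Ioo ht
  have h1 := S.continuous_s ht'
  have k1 : Continuous (pθ S.s t) :=
    ((sms.mono Ioo_subset_Ioc_self).dθ isOpen_Ioo).continuous_slice ht
  have h2 := S.continuous_ρ ht'
  have h3 := S.continuous_pθ_g ht
  have h4 := S.continuous_frc ht'
  have h5 : Continuous fun p : ℝ × V3 =>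
      pθ (S.g p.2.2.1 p.2.2.2) t p.1 / (2 * S.ρ t p.1 p.2) :=
    h3.div (by fun_prop) fun p => by have := ρ_pos (S := S) t p.1 p.2; positivity
  unfold bb
  fun_prop

lemma continuous_f (ht : t ∈ Ioc S.tp S.ti) : Continuous fun p : ℝ × V3 => S.f t p.1 p.2 :=
  continuousOn_univ.1 <| ContinuousOn.comp (g := S.F) (f := fun p : ℝ × V3 => (t, p.1, p.2))
    F_continuousOn (by fun_prop) (fun p _ => ⟨ht, mem_univ _⟩)

lemma continuousOn_fderiv_F (e : ℝ × ℝ × V3) :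
    ContinuousOn (fun p => fderiv ℝ S.F p e) (Ioo S.tp S.ti ×ˢ (univ : Set (ℝ × V3))) :=
  (F_contDiffOn.continuousOn_fderiv_of_isOpen isOpen_dom (by simp)).clm_apply continuousOn_const

lemma continuous_fderiv_F (ht : t ∈ Ioo S.tp S.ti) (e : ℝ × ℝ × V3) :
    Continuous fun p : ℝ × V3 => fderiv ℝ S.F (t, p) e :=
  continuousOn_univ.1 <| ContinuousOn.comp (g := fun p => fderiv ℝ S.F p e)
    (f := fun p : ℝ × V3 => (t, p)) (continuousOn_fderiv_F e) (by fun_prop)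
    (fun p _ => ⟨ht, mem_univ _⟩)

/-- the divergence of the characteristic field in the `θ`-direction -/
def div (S : EVSol) (t θ : ℝ) (v : V3) : ℝ :=
  pθ S.s t θ * v.1 / S.ρ t θ v
    - S.s t θ * v.1 * (pθ (S.g v.2.1 v.2.2) t θ / (2 * S.ρ t θ v)) / S.ρ t θ v ^ 2

lemma continuous_div (ht : t ∈ Ioo S.tp S.ti) : Continuous fun p : ℝ × V3 => S.div t p.1 p.2 := by
  have ht' := mem_of_Ioo ht
  have h1 := S.continuous_s ht'
  have k1 : Continuous (pθ S.s t) :=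
    ((sms.mono Ioo_subset_Ioc_self).dθ isOpen_Ioo).continuous_slice ht
  have h2 := S.continuous_ρ ht'
  have h3 := S.continuous_pθ_g ht
  have h0 : ∀ p : ℝ × V3, 0 < S.ρ t p.1 p.2 := fun p => ρ_pos (S := S) t p.1 p.2
  have h5 : Continuous fun p : ℝ × V3 =>
      pθ (S.g p.2.2.1 p.2.2.2) t p.1 / (2 * S.ρ t p.1 p.2) :=
    h3.div (by fun_prop) fun p => by have := h0 p; positivity
  exact (Continuous.div (by fun_prop) h2 fun p => (h0 p).ne').sub
    (Continuous.div (by fun_prop) (by fun_prop) fun p => (pow_pos (h0 p) 2).ne')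

lemma hasDerivAt_aa_θ (ht : t ∈ Ioo S.tp S.ti) (v : V3) :
    HasDerivAt (fun x => S.aa t x v) (S.div t θ v) θ := by
  have h1 := (sms.mono Ioo_subset_Ioc_self).hasDerivAt_θ isOpen_Ioo ht (θ := θ)
  refine ((h1.mul_const v.1).fun_div (hasDerivAt_ρ_θ ht v) (ρ_pos t θ v).ne').congr_deriv ?_
  have := S.ρ_pos t θ v
  unfold div
  field_simp

lemma hasDerivAt_bb_v (t θ y v2 v3 : ℝ) :
    HasDerivAt (fun y => S.bb t θ (y, v2, v3)) (-S.div t θ (y, v2, v3)) y := by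
  have h1 := S.hasDerivAt_ρ_v t θ y v2 v3
  have hp := S.ρ_pos t θ (y, v2, v3)
  have h2 := (((hasDerivAt_const y (pθ (S.g v2 v3) t θ)).fun_div (h1.const_mul 2)
    (by positivity)).const_mul (S.s t θ))
  refine (((h1.const_mul (pθ S.s t θ)).fun_neg.fun_sub h2).add_const
    (S.frc v2 v3 t θ)).congr_deriv ?_
  unfold div
  field_simp
  ring

lemma exists_support_box (S : EVSol) {t1 : ℝ} (h1 : S.tp < t1) : ∃ r, 0 < r ∧
    ∀ t ∈ Icc t1 S.ti, ∀ θ (v : V3), S.f t θ v ≠ 0 → ‖v‖ < r := by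
  obtain ⟨R1, hR1, hb⟩ := S.exists_support_bound h1
  exact ⟨R1 + 1, by linarith, fun t ht θ v hv => (hb t ht θ v hv).trans_lt (by linarith)⟩

lemma setIntegral_box_eq {r : ℝ} (hr : ∀ θ (v : V3), S.f t θ v ≠ 0 → ‖v‖ < r) (H : V3 → ℝ) :
    ∫ v in box r, S.f t θ v * H v = ∫ v, S.f t θ v * H v :=
  setIntegral_eq_integral_of_forall_compl_eq_zero fun v hv => by
    by_contra h
    exact hv ((norm_le_iff_mem_box r v).1 (hr θ v (left_ne_zero_of_mul h)).le)

lemma peraa (v : V3) : S.aa t (θ + 1) v = S.aa t θ v := by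
  unfold aa ρ; rw [pers, perg]

lemma setIntegral_flux_θ (ht : t ∈ Ioo S.tp S.ti) (r : ℝ) :
    ∫ p in Icc (0 : ℝ) 1 ×ˢ box r, (fderiv ℝ S.F (t, p.1, p.2) (0, 1, 0) * S.aa t p.1 p.2
      + S.f t p.1 p.2 * S.div t p.1 p.2) = 0 := by
  have ht' := mem_of_Ioo ht
  have h1 := S.continuous_f ht'
  have h2 := S.continuous_fderiv_F ht (0, 1, 0)
  have h3 := S.continuous_aa ht'
  have h4 := S.continuous_div ht
  refine setIntegral_prod_deriv_eq_zero (μ := (volume : Measure V3)) zero_le_one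
    (H := fun x v => S.f t x v * S.aa t x v)
    (H' := fun x v => fderiv ℝ S.F (t, x, v) (0, 1, 0) * S.aa t x v + S.f t x v * S.div t x v)
    (fun v _ x _ => (hasDerivAt_f_θ ht v).fun_mul (hasDerivAt_aa_θ ht v))
    (isCompact_box r).measurableSet ?_ (fun v _ => ?_)
  · exact (Continuous.continuousOn (by fun_prop)).integrableOn_compact
      (isCompact_Icc.prod (isCompact_box r))
  · have e1 := S.hfper t 0 v
    have e2 := S.peraa (t := t) (θ := 0) v
    rw [zero_add] at e1 e2
    simp only [e1, e2]

lemma setIntegral_flux_v (ht : t ∈ Ioo S.tp S.ti) {r : ℝ} (hr0 : 0 < r)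
    (hr : ∀ θ (v : V3), S.f t θ v ≠ 0 → ‖v‖ < r) (θ : ℝ) :
    ∫ v in box r, (fderiv ℝ S.F (t, θ, v) (0, 0, 1, 0, 0) * S.bb t θ v
      - S.f t θ v * S.div t θ v) = 0 := by
  have ht' := mem_of_Ioo ht
  have h1 := S.continuous_f ht'
  have h2 := S.continuous_fderiv_F ht (0, 0, 1, 0, 0)
  have h3 := S.continuous_bb ht
  have h4 := S.continuous_div ht
  refine setIntegral_prod_deriv_eq_zero (μ := (volume : Measure (ℝ × ℝ))) (by linarith : -r ≤ r)
    (H := fun y z => S.f t θ (y, z) * S.bb t θ (y, z))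
    (H' := fun y z => fderiv ℝ S.F (t, θ, y, z) (0, 0, 1, 0, 0) * S.bb t θ (y, z)
      - S.f t θ (y, z) * S.div t θ (y, z))
    (fun z _ y _ => ?_) (isCompact_Icc.prod isCompact_Icc).measurableSet ?_ (fun z _ => ?_)
  · refine ((hasDerivAt_f_v ht (θ := θ) (y, z)).fun_mul
      (hasDerivAt_bb_v t θ y z.1 z.2)).congr_deriv ?_
    ring
  · have h : Continuous fun p : ℝ × V3 => fderiv ℝ S.F (t, p) (0, 0, 1, 0, 0) * S.bb t p.1 p.2
      - S.f t p.1 p.2 * S.div t p.1 p.2 := by fun_prop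
    exact (h.comp (g := fun p : ℝ × V3 => fderiv ℝ S.F (t, p) (0, 0, 1, 0, 0) * S.bb t p.1 p.2
      - S.f t p.1 p.2 * S.div t p.1 p.2) (Continuous.prodMk_right θ)).continuousOn.integrableOn_compact (isCompact_box r)
  · have h0 : ∀ y : ℝ, |y| = r → S.f t θ (y, z) = 0 := fun y hy => by
      by_contra h
      have := (norm_fst_le (y, z)).trans_lt (hr θ (y, z) h)
      rw [Real.norm_eq_abs, hy] at this
      exact this.false
    simp only [h0 (-r) (by rw [abs_neg, abs_of_pos hr0]), h0 r (abs_of_pos hr0), zero_mul]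

/-- Conservation of the number of particles. -/
lemma integral_n (ht : t ∈ Ioc S.tp S.ti) :
    ∫ θ in (0 : ℝ)..1, S.n t θ = ∫ θ in (0 : ℝ)..1, S.n S.ti θ := by
  obtain ⟨r, hr, hsupp⟩ := S.exists_support_box ht.1
  have hk : IsCompact (Icc (0 : ℝ) 1 ×ˢ box r) := isCompact_Icc.prod (isCompact_box r)
  have hmem : ∀ x ∈ Icc t S.ti, x ∈ Ioc S.tp S.ti := fun x hx => ⟨ht.1.trans_le hx.1, hx.2⟩
  have hN : ∀ x ∈ Icc t S.ti, ∫ θ in (0 : ℝ)..1, S.n x θ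
      = ∫ p in Icc (0 : ℝ) 1 ×ˢ box r, S.f x p.1 p.2 := fun x hx => by
    have hc : Continuous fun p : ℝ × V3 => S.f x p.1 p.2 := S.continuous_f (hmem x hx)
    have e := setIntegral_prod (μ := (volume : Measure ℝ)) (ν := (volume : Measure V3))
      (fun p : ℝ × V3 => S.f x p.1 p.2) (hc.continuousOn.integrableOn_compact hk)
    rw [intervalIntegral.integral_of_le zero_le_one, ← integral_Icc_eq_integral_Ioc]
    refine Eq.trans ?_ e.symm
    refine integral_congr_ae (Eventually.of_forall fun θ => ?_)
    have := setIntegral_box_eq (hsupp x hx) (fun _ => 1) (θ := θ)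
    simpa [n] using this.symm
  have hd : ∀ x ∈ Ico t S.ti, HasDerivAt
      (fun x => ∫ p in Icc (0 : ℝ) 1 ×ˢ box r, S.f x p.1 p.2) 0 x := fun x hx => by
    have hx' : x ∈ Ioo S.tp S.ti := ⟨ht.1.trans_le hx.1, hx.2⟩
    refine (hasDerivAt_setIntegral hk isOpen_Ioo (G := fun x p => S.f x p.1 p.2)
      (G' := fun x p => fderiv ℝ S.F (x, p.1, p.2) (1, 0, 0)) ?_ ?_
      (fun x hx p _ => hasDerivAt_f_t hx p.2) hx').congr_deriv ?_
    · exact F_contDiffOn.continuousOn.mono (prod_mono Subset.rfl (subset_univ _))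
    · exact (continuousOn_fderiv_F (1, 0, 0)).mono (prod_mono Subset.rfl (subset_univ _))
    · have hx'' := mem_of_Ioo hx'
      have h1 := S.continuous_f hx''
      have h2 := S.continuous_fderiv_F hx' (0, 0, 1, 0, 0)
      have h2' := S.continuous_fderiv_F hx' (0, 1, 0)
      have h3 := S.continuous_bb hx'
      have h3' := S.continuous_aa hx''
      have h4 := S.continuous_div hx'
      have i1 : IntegrableOn (fun p : ℝ × V3 => fderiv ℝ S.F (x, p.1, p.2) (0, 1, 0)
          * S.aa x p.1 p.2 + S.f x p.1 p.2 * S.div x p.1 p.2) (Icc (0 : ℝ) 1 ×ˢ box r) :=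
        (Continuous.continuousOn (by fun_prop)).integrableOn_compact hk
      have i2 : IntegrableOn (fun p : ℝ × V3 => fderiv ℝ S.F (x, p.1, p.2) (0, 0, 1, 0, 0)
          * S.bb x p.1 p.2 - S.f x p.1 p.2 * S.div x p.1 p.2) (Icc (0 : ℝ) 1 ×ˢ box r) :=
        (Continuous.continuousOn (by fun_prop)).integrableOn_compact hk
      have z2 : ∫ p in Icc (0 : ℝ) 1 ×ˢ box r, (fderiv ℝ S.F (x, p.1, p.2) (0, 0, 1, 0, 0)
          * S.bb x p.1 p.2 - S.f x p.1 p.2 * S.div x p.1 p.2) = 0 := by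
        refine (setIntegral_prod (μ := (volume : Measure ℝ)) (ν := (volume : Measure V3))
          _ i2).trans ?_
        simp only [setIntegral_flux_v hx' hr (hsupp x ⟨hx.1, hx.2.le⟩), integral_zero]
      have e : (fun p : ℝ × V3 => fderiv ℝ S.F (x, p.1, p.2) (1, 0, 0)) = fun p =>
          -(fderiv ℝ S.F (x, p.1, p.2) (0, 1, 0) * S.aa x p.1 p.2 + S.f x p.1 p.2 * S.div x p.1 p.2)
          - (fderiv ℝ S.F (x, p.1, p.2) (0, 0, 1, 0, 0) * S.bb x p.1 p.2
            - S.f x p.1 p.2 * S.div x p.1 p.2) := by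
        funext p
        have := vlasov hx' (θ := p.1) p.2
        linarith
      rw [e, integral_sub i1.fun_neg i2, integral_neg, setIntegral_flux_θ hx', z2]
      simp
  have hc : ContinuousOn (fun x => ∫ p in Icc (0 : ℝ) 1 ×ˢ box r, S.f x p.1 p.2)
      (Icc t S.ti) :=
    continuousOn_setIntegral hk isCompact_Icc (F_continuousOn.mono
      (prod_mono (fun x hx => hmem x hx) (subset_univ _)))
  rw [hN t ⟨le_rfl, ht.2⟩, hN S.ti ⟨ht.2, le_rfl⟩]
  exact (constant_of_has_deriv_right_zero hc (fun x hx => (hd x hx).hasDerivWithinAt) S.ti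
    ⟨ht.2, le_rfl⟩).symm

end EVSol

/-- Differentiation of the mean over a period. -/
lemma SmOn.hasDerivAt_integral {s : Set ℝ} (hs : IsOpen s) {G : ℝ → ℝ → ℝ} (hG : SmOn s G) {t : ℝ}
    (ht : t ∈ s) : HasDerivAt (fun t => ∫ θ in (0 : ℝ)..1, G t θ) (∫ θ in (0 : ℝ)..1, pt G t θ) t := by
  simp only [intervalIntegral.integral_of_le zero_le_one, ← integral_Icc_eq_integral_Ioc]
  exact hasDerivAt_setIntegral isCompact_Icc hs
    (hG.continuousOn.mono (prod_mono Subset.rfl (subset_univ _)))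
    ((hG.dt hs).continuousOn.mono (prod_mono Subset.rfl (subset_univ _)))
    (fun x hx y _ => hG.hasDerivAt_t hs hx) ht

lemma SmOn.intervalIntegrable {s : Set ℝ} {G : ℝ → ℝ → ℝ} (hG : SmOn s G) {t : ℝ}
    (ht : t ∈ s) (a b : ℝ) : IntervalIntegrable (G t) volume a b :=
  (hG.continuous_slice ht).intervalIntegrable a b

lemma SmOn.integral_pθ {s : Set ℝ} (hs : IsOpen s) {G : ℝ → ℝ → ℝ} (hG : SmOn s G) {t : ℝ}
    (ht : t ∈ s) (a b : ℝ) : ∫ θ in a..b, pθ G t θ = G t b - G t a :=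
  intervalIntegral.integral_eq_sub_of_hasDerivAt (fun x _ => hG.hasDerivAt_θ hs ht)
    ((hG.dθ hs).intervalIntegrable ht a b)

namespace EVSol

variable {S : EVSol} {t θ : ℝ}

lemma integrable_f_mul (ht : t ∈ Ioc S.tp S.ti) (θ : ℝ) {H : V3 → ℝ} (hH : Continuous H) :
    Integrable fun v => S.f t θ v * H v := by
  obtain ⟨r, hr, hsupp⟩ := S.exists_support_box ht.1
  have hf : Continuous (S.f t θ) := (S.continuous_f ht).comp (Continuous.prodMk_right θ)
  refine (hf.mul hH).integrable_of_hasCompactSupport ?_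
  refine HasCompactSupport.intro (isCompact_box r) fun v hv => ?_
  by_contra h
  exact hv ((norm_le_iff_mem_box r v).1 (hsupp t ⟨le_rfl, ht.2⟩ θ v (left_ne_zero_of_mul h)).le)

lemma integral_f_mono (ht : t ∈ Ioc S.tp S.ti) (θ : ℝ) {H1 H2 : V3 → ℝ} (h1 : Continuous H1)
    (h2 : Continuous H2) (h : ∀ v, S.f t θ v ≠ 0 → H1 v ≤ H2 v) :
    ∫ v, S.f t θ v * H1 v ≤ ∫ v, S.f t θ v * H2 v := by
  refine integral_mono (integrable_f_mul ht θ h1) (integrable_f_mul ht θ h2) fun v => ?_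
  by_cases h0 : S.f t θ v = 0
  · simp [h0]
  · exact mul_le_mul_of_nonneg_left (h v h0) (S.hfnn t ht θ v)

lemma integral_f_nonneg (ht : t ∈ Ioc S.tp S.ti) (θ : ℝ) {H : V3 → ℝ} (h : ∀ v, 0 ≤ H v) :
    0 ≤ ∫ v, S.f t θ v * H v :=
  integral_nonneg fun v => mul_nonneg (S.hfnn t ht θ v) (h v)

lemma abs_integral_f_le (ht : t ∈ Ioc S.tp S.ti) (θ : ℝ) {H1 H2 : V3 → ℝ} (h1 : Continuous H1)
    (h2 : Continuous H2) (h : ∀ v, S.f t θ v ≠ 0 → |H1 v| ≤ H2 v) :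
    |∫ v, S.f t θ v * H1 v| ≤ ∫ v, S.f t θ v * H2 v := by
  rw [abs_le, ← integral_neg]
  simp only [← mul_neg]
  exact ⟨integral_f_mono ht θ h2.neg h1 fun v hv => (abs_le.1 (h v hv)).1,
    integral_f_mono ht θ h1 h2 fun v hv => (le_abs_self _).trans (h v hv)⟩

lemma continuous_ρ_v (ht : t ∈ Ioc S.tp S.ti) (θ : ℝ) : Continuous (S.ρ t θ) :=
  (S.continuous_ρ ht).comp (Continuous.prodMk_right θ)

lemma continuous_w_v (ht : t ∈ Ioc S.tp S.ti) (θ : ℝ) :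
    Continuous fun v : V3 => S.w v.2.1 v.2.2 t θ :=
  (S.continuous_w ht).comp (Continuous.prodMk_right θ)

lemma continuous_div_ρ (ht : t ∈ Ioc S.tp S.ti) (θ : ℝ) {H : V3 → ℝ} (hH : Continuous H) :
    Continuous fun v => H v / S.ρ t θ v :=
  hH.div (continuous_ρ_v ht θ) fun v => (ρ_pos t θ v).ne'

lemma integral_abs_v0 (ht : t ∈ Ioc S.tp S.ti) (θ : ℝ) :
    ∫ v : V3, S.f t θ v * |v0 S.α S.ν S.U S.A t θ v| = S.s t θ * ∫ v : V3, S.f t θ v * S.ρ t θ v := by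
  simp only [abs_v0 ht, ← integral_const_mul]
  exact integral_congr_ae (Eventually.of_forall fun v => by ring)

lemma integral_div_abs_v0 (ht : t ∈ Ioc S.tp S.ti) (θ : ℝ) (H : V3 → ℝ) :
    ∫ v : V3, H v / |v0 S.α S.ν S.U S.A t θ v| = (S.s t θ)⁻¹ * ∫ v : V3, H v / S.ρ t θ v := by
  simp only [abs_v0 ht, ← integral_const_mul]
  refine integral_congr_ae (Eventually.of_forall fun v => ?_)
  have h1 := s_pos ht θ
  have h2 := ρ_pos (S := S) t θ v
  field_simp

/-- the energy density of the wave maps part -/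
def wv (S : EVSol) (t θ : ℝ) : ℝ :=
  (pt S.U t θ) ^ 2 + S.α t θ * (pθ S.U t θ) ^ 2
    + Real.exp (4 * S.U t θ) / (4 * t ^ 2) * ((pt S.A t θ) ^ 2 + S.α t θ * (pθ S.A t θ) ^ 2)

lemma wv_nonneg (ht : t ∈ Ioc S.tp S.ti) (θ : ℝ) : 0 ≤ S.wv t θ := by
  have := (S.hαpos t ht θ).le
  unfold wv
  positivity

lemma pt_ν (ht : t ∈ Ioc S.tp S.ti) (θ : ℝ) : pt S.ν t θ = t * S.wv t θ
    + S.α t θ * Real.exp (2 * S.ν t θ - 4 * S.U t θ) / (4 * t) * S.J t θ ^ 2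
    + S.α t θ * Real.exp (2 * S.ν t θ) / (4 * t ^ 3) * (S.K t θ - S.A t θ * S.J t θ) ^ 2
    + S.α t θ * ∫ v : V3, S.f t θ v * S.ρ t θ v := by
  have h := S.hnut t ht θ
  rw [integral_abs_v0 ht θ] at h
  rw [h, ← s_sq ht θ]
  simp only [wv, ← s_sq ht θ]
  rw [Real.sqrt_sq (s_pos ht θ).le]
  ring

/-- the energy density `ν_t / √α` -/
def e (S : EVSol) : ℝ → ℝ → ℝ := fun t θ => pt S.ν t θ / S.s t θ

lemma sme : SmOn (Ioo S.tp S.ti) S.e :=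
  ((smν.mono Ioo_subset_Ioc_self).dt isOpen_Ioo).div (sms.mono Ioo_subset_Ioc_self)
    fun t ht θ => (s_pos (mem_of_Ioo ht) θ).ne'

/-- the energy flux -/
def flux (S : EVSol) : ℝ → ℝ → ℝ := fun t θ =>
  S.s t θ * pθ S.ν t θ + pθ S.α t θ / (2 * S.s t θ)

lemma smflux : SmOn (Ioo S.tp S.ti) S.flux :=
  ((sms.mono Ioo_subset_Ioc_self).mul ((smν.mono Ioo_subset_Ioc_self).dθ isOpen_Ioo)).add
    (((smα.mono Ioo_subset_Ioc_self).dθ isOpen_Ioo).div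
      ((sms.mono Ioo_subset_Ioc_self).const_mul 2)
      fun t ht θ => by have := s_pos (mem_of_Ioo ht) θ; positivity)

lemma perflux : Per S.flux := fun t θ => by
  unfold flux
  rw [pers, Per.dθ (G := S.ν) S.hνper, Per.dθ (G := S.α) S.hαper]

lemma pt_e_ge (ht : t ∈ Ioo S.tp S.ti) (θ : ℝ) :
    pθ S.flux t θ - 3 / t * S.e t θ ≤ pt S.e t θ := by
  have ht' := mem_of_Ioo ht
  have htp := time_pos ht'
  have hs := s_pos ht' θ
  have hss := s_sq ht' θ
  have smν' := S.smν.mono Ioo_subset_Ioc_self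
  have smα' := S.smα.mono Ioo_subset_Ioc_self
  have sms' := S.sms.mono Ioo_subset_Ioc_self
  have e1 : pt S.e t θ = (pt (pt S.ν) t θ * S.s t θ - pt S.ν t θ * pt S.s t θ) / S.s t θ ^ 2 :=
    (((smν'.dt isOpen_Ioo).hasDerivAt_t isOpen_Ioo ht).div (sms'.hasDerivAt_t isOpen_Ioo ht)
      hs.ne').deriv
  have e2 : pθ S.flux t θ = pθ S.s t θ * pθ S.ν t θ + S.s t θ * pθ (pθ S.ν) t θ
      + (pθ (pθ S.α) t θ * (2 * S.s t θ) - pθ S.α t θ * (2 * pθ S.s t θ)) / (2 * S.s t θ) ^ 2 :=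
    (((sms'.hasDerivAt_θ isOpen_Ioo ht).mul ((smν'.dθ isOpen_Ioo).hasDerivAt_θ isOpen_Ioo ht)).add
      (((smα'.dθ isOpen_Ioo).hasDerivAt_θ isOpen_Ioo ht).div
        ((sms'.hasDerivAt_θ isOpen_Ioo ht).const_mul 2) (by positivity))).deriv
  have hI : Real.exp (2 * S.ν t θ) / t ^ 3
      * ∫ v : V3, S.f t θ v * (v.2.2 - S.A t θ * v.2.1) ^ 2 / S.ρ t θ v
      ≤ 1 / t * ∫ v : V3, S.f t θ v * S.ρ t θ v := by
    have h1 : ∫ v : V3, S.f t θ v * (Real.exp (2 * S.ν t θ) / t ^ 3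
        * (v.2.2 - S.A t θ * v.2.1) ^ 2 / S.ρ t θ v)
        ≤ ∫ v : V3, S.f t θ v * (1 / t * S.ρ t θ v) := by
      refine integral_f_mono ht' θ (continuous_div_ρ ht' θ (by fun_prop))
        ((continuous_ρ_v ht' θ).const_mul _) fun v _ => ?_
      have hρ := S.ρ_pos t θ v
      rw [div_le_iff₀ hρ, mul_assoc, ← sq, S.ρ_sq]
      have hg : Real.exp (2 * S.ν t θ) * ((t ^ 2)⁻¹ * (v.2.2 - S.A t θ * v.2.1) ^ 2)
          ≤ S.g v.2.1 v.2.2 t θ := by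
        unfold g w
        refine mul_le_mul_of_nonneg_left ?_ (Real.exp_pos _).le
        have : 0 ≤ Real.exp (-2 * S.U t θ) + Real.exp (-4 * S.U t θ) * v.2.1 ^ 2 := by positivity
        linarith
      have : Real.exp (2 * S.ν t θ) / t ^ 3 * (v.2.2 - S.A t θ * v.2.1) ^ 2
          = 1 / t * (Real.exp (2 * S.ν t θ) * ((t ^ 2)⁻¹ * (v.2.2 - S.A t θ * v.2.1) ^ 2)) := by
        field_simp
      rw [this]
      exact mul_le_mul_of_nonneg_left (by nlinarith [sq_nonneg v.1]) (by positivity)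
    rw [← integral_const_mul, ← integral_const_mul]
    refine Eq.trans_le ?_ (h1.trans_eq ?_)
    · exact integral_congr_ae (Eventually.of_forall fun v => by ring)
    · exact integral_congr_ae (Eventually.of_forall fun v => by ring)
  have hν := S.hnutt t ht' θ
  rw [integral_div_abs_v0 ht'] at hν
  have hν1 := pt_ν ht' θ
  have hI1 := integral_f_nonneg ht' θ (fun v => (S.ρ_pos t θ v).le)
  set I1 := ∫ v : V3, S.f t θ v * S.ρ t θ v
  set I2 := ∫ v : V3, S.f t θ v * (v.2.2 - S.A t θ * v.2.1) ^ 2 / S.ρ t θ v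
  have es : Real.sqrt (S.α t θ) = S.s t θ := rfl
  have key : (pt S.e t θ - pθ S.flux t θ + 3 / t * S.e t θ) * S.s t θ
      = 2 * (pt S.U t θ) ^ 2 + 4 * S.s t θ ^ 2 * (pθ S.U t θ) ^ 2
        + Real.exp (4 * S.U t θ) / (4 * t ^ 2)
          * (4 * (pt S.A t θ) ^ 2 + 2 * S.s t θ ^ 2 * (pθ S.A t θ) ^ 2)
        + S.s t θ ^ 2 * Real.exp (2 * S.ν t θ - 4 * S.U t θ) / (2 * t ^ 2) * S.J t θ ^ 2
        + S.s t θ ^ 2 * (3 / t * I1 - Real.exp (2 * S.ν t θ) / t ^ 3 * I2) := by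
    rw [e1, e2, hν, pt_s ht, pθ_s ht]
    unfold e
    rw [hν1, es]
    unfold wv
    rw [← hss]
    field_simp
    ring
  have hpos : 0 ≤ pt S.e t θ - pθ S.flux t θ + 3 / t * S.e t θ := by
    refine nonneg_of_mul_nonneg_left (key ▸ ?_) hs
    have h3 : 0 ≤ 3 / t * I1 - Real.exp (2 * S.ν t θ) / t ^ 3 * I2 := by
      have : 0 ≤ 1 / t * I1 := by positivity
      have h4 : 3 / t * I1 = 3 * (1 / t * I1) := by ring
      linarith
    positivity
  linarith

lemma e_ge (ht : t ∈ Ioc S.tp S.ti) (θ : ℝ) :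
    t * S.wv t θ / S.s t θ + S.s t θ * ∫ v : V3, S.f t θ v * S.ρ t θ v ≤ S.e t θ := by
  have hs := s_pos ht θ
  have htp := time_pos ht
  unfold e
  rw [pt_ν ht, ← s_sq ht θ, le_div_iff₀ hs]
  have h1 : 0 ≤ S.s t θ ^ 2 * Real.exp (2 * S.ν t θ - 4 * S.U t θ) / (4 * t) * S.J t θ ^ 2 := by
    positivity
  have h2 : 0 ≤ S.s t θ ^ 2 * Real.exp (2 * S.ν t θ) / (4 * t ^ 3)
    * (S.K t θ - S.A t θ * S.J t θ) ^ 2 := by positivity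
  have h3 : (t * S.wv t θ / S.s t θ + S.s t θ * ∫ v : V3, S.f t θ v * S.ρ t θ v) * S.s t θ
    = t * S.wv t θ + S.s t θ ^ 2 * ∫ v : V3, S.f t θ v * S.ρ t θ v := by
    field_simp
  linarith

lemma e_nonneg (ht : t ∈ Ioc S.tp S.ti) (θ : ℝ) : 0 ≤ S.e t θ := by
  refine le_trans ?_ (e_ge ht θ)
  have h1 := (s_pos ht θ).le
  have h2 := (time_pos ht).le
  have h3 := wv_nonneg ht θ
  have h4 := integral_f_nonneg ht θ (fun v => (S.ρ_pos t θ v).le)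
  positivity

/-- midpoint of the time interval -/
def tm (S : EVSol) : ℝ := (S.tp + S.ti) / 2

lemma tm_mem : S.tm ∈ Ioo S.tp S.ti := by
  have := S.hti
  unfold tm
  constructor <;> linarith

lemma mem_Ioo_of_tm (ht : t ∈ Ioc S.tp S.tm) : t ∈ Ioo S.tp S.ti :=
  ⟨ht.1, ht.2.trans_lt tm_mem.2⟩

/-- The energy is bounded towards the past. -/
lemma exists_integral_e_le (S : EVSol) :
    ∃ E, 0 < E ∧ ∀ t ∈ Ioc S.tp S.tm, ∫ θ in (0 : ℝ)..1, S.e t θ ≤ E := by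
  set N : ℝ → ℝ := fun t => ∫ θ in (0 : ℝ)..1, S.e t θ
  have hd : ∀ t ∈ Ioo S.tp S.ti, HasDerivAt N (∫ θ in (0 : ℝ)..1, pt S.e t θ) t :=
    fun t ht => sme.hasDerivAt_integral isOpen_Ioo ht
  have hmono : MonotoneOn (fun t => t ^ 3 * N t) (Ioo S.tp S.ti) := by
    refine monotoneOn_of_deriv_nonneg (convex_Ioo _ _)
      (fun t ht => ((hasDerivAt_pow 3 t).fun_mul (hd t ht)).continuousAt.continuousWithinAt) ?_ ?_
    · rw [interior_Ioo]
      exact fun t ht => ((hasDerivAt_pow 3 t).fun_mul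
        (hd t ht)).differentiableAt.differentiableWithinAt
    · rw [interior_Ioo]
      intro t ht
      rw [((hasDerivAt_pow 3 t).fun_mul (hd t ht)).deriv]
      have htp := time_pos (mem_of_Ioo ht)
      have h1 : ∫ θ in (0 : ℝ)..1, (pθ S.flux t θ - 3 / t * S.e t θ)
          ≤ ∫ θ in (0 : ℝ)..1, pt S.e t θ := by
        refine intervalIntegral.integral_mono_on zero_le_one ?_
          ((sme.dt isOpen_Ioo).intervalIntegrable ht 0 1) (fun θ _ => pt_e_ge ht θ)
        exact ((smflux.dθ isOpen_Ioo).intervalIntegrable ht 0 1).sub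
          ((sme.intervalIntegrable ht 0 1).const_mul _)
      rw [intervalIntegral.integral_sub ((smflux.dθ isOpen_Ioo).intervalIntegrable ht 0 1)
        ((sme.intervalIntegrable ht 0 1).const_mul _), intervalIntegral.integral_const_mul,
        smflux.integral_pθ isOpen_Ioo ht] at h1
      have h2 := S.perflux t 0
      rw [zero_add] at h2
      rw [h2, sub_self, zero_sub] at h1
      have h3 : t ^ 3 * (-(3 / t * N t)) ≤ t ^ 3 * ∫ θ in (0 : ℝ)..1, pt S.e t θ :=
        mul_le_mul_of_nonneg_left h1 (by positivity)
      have h4 : t ^ 3 * (-(3 / t * N t)) = -(3 * t ^ 2 * N t) := by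
        field_simp
      norm_num
      linarith
  have hN : ∀ t ∈ Ioo S.tp S.ti, 0 ≤ N t := fun t ht =>
    intervalIntegral.integral_nonneg zero_le_one fun θ _ => e_nonneg (mem_of_Ioo ht) θ
  have htm := S.tm_mem
  have htp := S.htp
  refine ⟨S.tm ^ 3 * N S.tm / S.tp ^ 3 + 1, ?_, fun t ht => ?_⟩
  · have := hN _ htm
    have := htp.trans htm.1
    positivity
  · have h1 := hmono (mem_Ioo_of_tm ht) htm ht.2
    have h2 : S.tp ^ 3 * N t ≤ t ^ 3 * N t :=
      mul_le_mul_of_nonneg_right (pow_le_pow_left₀ htp.le ht.1.le 3) (hN t (mem_Ioo_of_tm ht))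
    have h3 : N t ≤ S.tm ^ 3 * N S.tm / S.tp ^ 3 := by
      rw [le_div_iff₀ (by positivity)]
      simp only at h1
      linarith
    linarith

end EVSol

/-- A periodic function oscillates by at most the integral of a bound of its derivative. -/
lemma abs_sub_le_of_periodic {φ φ' g : ℝ → ℝ} {c : ℝ} (hp : ∀ x, φ (x + 1) = φ x)
    (hd : ∀ x, HasDerivAt φ (φ' x) x) (hφ' : Continuous φ') (hg : Continuous g)
    (hle : ∀ x, |φ' x| ≤ g x) (hI : ∫ x in (0 : ℝ)..1, g x ≤ c) (x y : ℝ) : |φ x - φ y| ≤ c := by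
  have key : ∀ x ∈ Icc (0 : ℝ) 1, ∀ y ∈ Icc (0 : ℝ) 1, x ≤ y → |φ x - φ y| ≤ c := by
    intro x hx y hy hxy
    rw [abs_sub_comm, ← intervalIntegral.integral_eq_sub_of_hasDerivAt (fun z _ => hd z)
      (hφ'.intervalIntegrable x y)]
    refine (intervalIntegral.abs_integral_le_integral_abs hxy).trans (le_trans ?_ hI)
    refine (intervalIntegral.integral_mono_on hxy (hφ'.abs.intervalIntegrable x y)
      (hg.intervalIntegrable x y) (fun z _ => hle z)).trans ?_
    exact intervalIntegral.integral_mono_interval hx.1 hxy hy.2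
      (Eventually.of_forall fun z => (abs_nonneg _).trans (hle z)) (hg.intervalIntegrable 0 1)
  have hp' : Per fun _ : ℝ => φ := fun _ x => hp x
  rw [← hp'.fract 0 x, ← hp'.fract 0 y]
  rcases le_total (Int.fract x) (Int.fract y) with h | h
  · exact key _ (fract_mem_Icc x) _ (fract_mem_Icc y) h
  · rw [abs_sub_comm]
    exact key _ (fract_mem_Icc y) _ (fract_mem_Icc x) h

namespace EVSol

variable {S : EVSol} {t θ : ℝ}

/-- `-α_t / α` -/
def κ (S : EVSol) (t θ : ℝ) : ℝ :=
  S.α t θ * Real.exp (2 * S.ν t θ) * (Real.exp (-4 * S.U t θ) * S.J t θ ^ 2 / t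
    + (S.K t θ - S.A t θ * S.J t θ) ^ 2 / t ^ 3
    + 2 * ∫ v : V3, S.f t θ v * (S.w v.2.1 v.2.2 t θ / S.ρ t θ v))

lemma κ_nonneg (ht : t ∈ Ioc S.tp S.ti) (θ : ℝ) : 0 ≤ S.κ t θ := by
  have h1 := (S.hαpos t ht θ).le
  have h2 := (time_pos ht).le
  have h3 := integral_f_nonneg ht θ (fun v => (div_pos (S.w_pos (t := t) θ v.2.1 v.2.2)
    (S.ρ_pos t θ v)).le)
  unfold κ
  positivity

lemma exp_sub_four (S : EVSol) (t θ : ℝ) : Real.exp (2 * S.ν t θ - 4 * S.U t θ)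
    = Real.exp (2 * S.ν t θ) * Real.exp (-4 * S.U t θ) := by
  rw [← Real.exp_add]; congr 1; ring

lemma pt_α (ht : t ∈ Ioc S.tp S.ti) (θ : ℝ) : pt S.α t θ = -(S.κ t θ * S.α t θ) := by
  have h := S.halt t ht θ
  rw [integral_div_abs_v0 ht] at h
  have hα := S.hαpos t ht θ
  rw [div_eq_iff hα.ne'] at h
  have e1 : ∫ v : V3, S.f t θ v * (Real.exp (-2 * S.U t θ) + Real.exp (-4 * S.U t θ) * v.2.1 ^ 2
      + (t ^ 2)⁻¹ * (v.2.2 - S.A t θ * v.2.1) ^ 2) / S.ρ t θ v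
      = ∫ v : V3, S.f t θ v * (S.w v.2.1 v.2.2 t θ / S.ρ t θ v) :=
    integral_congr_ae (Eventually.of_forall fun v => by
      simp only [w]
      ring)
  rw [e1, exp_sub_four, show Real.sqrt (S.α t θ) = S.s t θ from rfl] at h
  have hs := s_pos ht θ
  have htp := time_pos ht
  rw [h]
  unfold κ
  field_simp
  ring

/-- `1 / √α` -/
def sinv (S : EVSol) : ℝ → ℝ → ℝ := fun t θ => (S.s t θ)⁻¹

lemma smsinv : SmOn (Ioc S.tp S.ti) S.sinv := sms.inv fun t ht θ => (s_pos ht θ).ne'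
lemma persinv : Per S.sinv := fun t θ => by unfold sinv; rw [pers]
lemma sinv_pos (ht : t ∈ Ioc S.tp S.ti) (θ : ℝ) : 0 < S.sinv t θ := inv_pos.2 (s_pos ht θ)

lemma pt_sinv (ht : t ∈ Ioo S.tp S.ti) (θ : ℝ) :
    pt S.sinv t θ = S.κ t θ / 2 * S.sinv t θ := by
  have hs := s_pos (mem_of_Ioo ht) θ
  have h : pt S.sinv t θ = -pt S.s t θ / S.s t θ ^ 2 :=
    (((sms.mono Ioo_subset_Ioc_self).hasDerivAt_t isOpen_Ioo ht (θ := θ)).inv hs.ne').deriv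
  rw [h, pt_s ht, pt_α (mem_of_Ioo ht), ← s_sq (mem_of_Ioo ht)]
  unfold sinv
  field_simp

lemma pt_sinv_nonneg (ht : t ∈ Ioo S.tp S.ti) (θ : ℝ) : 0 ≤ pt S.sinv t θ := by
  rw [pt_sinv ht]
  have := κ_nonneg (mem_of_Ioo ht) θ
  have := (sinv_pos (mem_of_Ioo ht) θ).le
  positivity

/-- `α` is bounded below. -/
lemma exists_sinv_le (S : EVSol) : ∃ C, 0 < C ∧ ∀ t ∈ Ioc S.tp S.ti, ∀ θ, S.sinv t θ ≤ C := by
  obtain ⟨C, hC, hb⟩ := (smsinv (S := S)).exists_bound_Icc persinv S.tm_mem.1 S.hti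
  refine ⟨C + 1, by linarith, fun t ht θ => ?_⟩
  rcases le_total S.tm t with h | h
  · have := (hb t ⟨h, ht.2⟩ θ).1
    linarith [le_abs_self (S.sinv t θ)]
  · have hm : MonotoneOn (fun t => S.sinv t θ) (Ioo S.tp S.ti) := by
      have hd : ∀ t ∈ Ioo S.tp S.ti, HasDerivAt (fun t => S.sinv t θ) (pt S.sinv t θ) t :=
        fun t ht => (smsinv.mono Ioo_subset_Ioc_self).hasDerivAt_t isOpen_Ioo ht
      refine monotoneOn_of_deriv_nonneg (convex_Ioo _ _)
        (fun t ht => (hd t ht).continuousAt.continuousWithinAt) ?_ ?_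
      · rw [interior_Ioo]
        exact fun t ht => (hd t ht).differentiableAt.differentiableWithinAt
      · rw [interior_Ioo]
        intro t ht
        rw [(hd t ht).deriv]
        exact pt_sinv_nonneg ht θ
    have h1 := hm (mem_Ioo_of_tm ⟨ht.1, h⟩) S.tm_mem h
    have := (hb S.tm ⟨le_rfl, S.tm_mem.2.le⟩ θ).1
    simp only at h1
    linarith [le_abs_self (S.sinv S.tm θ)]

lemma n_le {F R : ℝ} (hF : 0 ≤ F) (hR : 0 < R) (hb : ∀ t ∈ Ioc S.tp S.ti, ∀ θ (v : V3),
    S.f t θ v ≤ F ∧ (S.f t θ v ≠ 0 → |v.2.1| ≤ R ∧ |v.2.2| ≤ R)) (ht : t ∈ Ioc S.tp S.ti) (θ : ℝ)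
    {X : ℝ} (hX : 0 < X) :
    S.n t θ ≤ F * (2 * R) ^ 2 * (2 * X) * S.sinv t θ + S.e t θ / X := by
  have hs := s_pos ht θ
  set k : Set V3 := Icc (-(X * S.sinv t θ)) (X * S.sinv t θ) ×ˢ (Icc (-R) R ×ˢ Icc (-R) R) with hk
  have hkc : IsCompact k := isCompact_Icc.prod (isCompact_Icc.prod isCompact_Icc)
  have hXs : 0 ≤ X * S.sinv t θ := (mul_pos hX (sinv_pos ht θ)).le
  have hvol : volume.real k = 2 * (X * S.sinv t θ) * ((2 * R) * (2 * R)) := by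
    have e1 : volume.real k = volume.real (Icc (-(X * S.sinv t θ)) (X * S.sinv t θ))
        * (volume.real (Icc (-R) R) * volume.real (Icc (-R) R)) := by
      rw [← measureReal_prod_prod, ← measureReal_prod_prod]; rfl
    rw [e1, Real.volume_real_Icc_of_le (by linarith), Real.volume_real_Icc_of_le (by linarith)]
    ring
  have i1 : Integrable (k.indicator fun _ => F) :=
    (integrable_indicator_iff hkc.measurableSet).2 (integrableOn_const hkc.measure_lt_top.ne)
  have i2 : Integrable fun v => S.f t θ v * (S.s t θ / X * S.ρ t θ v) :=
    integrable_f_mul ht θ ((continuous_ρ_v ht θ).const_mul _)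
  have i3 : Integrable fun v => S.f t θ v := by
    simpa using integrable_f_mul ht θ (continuous_const (y := (1 : ℝ)))
  have h1 : S.n t θ ≤ ∫ v, (k.indicator (fun _ => F) v
      + S.f t θ v * (S.s t θ / X * S.ρ t θ v)) := by
    refine integral_mono i3 (i1.add i2) fun v => ?_
    have hf0 := S.hfnn t ht θ v
    have hρ := S.ρ_pos t θ v
    have h0 : 0 ≤ S.f t θ v * (S.s t θ / X * S.ρ t θ v) := by positivity
    by_cases hv : v ∈ k
    · simp only [indicator_of_mem hv]
      linarith [(hb t ht θ v).1]
    · simp only [indicator_of_notMem hv, zero_add]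
      by_cases hfv : S.f t θ v = 0
      · simp [hfv]
      · have h2 := (hb t ht θ v).2 hfv
        have h3 : X * S.sinv t θ < |v.1| := by
          by_contra hc
          exact hv ⟨abs_le.1 (not_lt.1 hc), abs_le.1 h2.1, abs_le.1 h2.2⟩
        have h4 : 1 ≤ S.s t θ / X * S.ρ t θ v := by
          have h5 := S.abs_v1_le t θ v
          rw [div_mul_eq_mul_div, le_div_iff₀ hX, one_mul]
          calc X = S.s t θ * (X * S.sinv t θ) := by unfold sinv; field_simp
            _ ≤ _ := mul_le_mul_of_nonneg_left (by linarith) hs.le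
        nlinarith
  rw [integral_add i1 i2, integral_indicator hkc.measurableSet, setIntegral_const, hvol,
    smul_eq_mul] at h1
  have h2 : ∫ v, S.f t θ v * (S.s t θ / X * S.ρ t θ v)
      = (S.s t θ * ∫ v, S.f t θ v * S.ρ t θ v) / X := by
    rw [← integral_const_mul, ← integral_div]
    exact integral_congr_ae (Eventually.of_forall fun v => by ring)
  have h3 : S.s t θ * ∫ v, S.f t θ v * S.ρ t θ v ≤ S.e t θ := by
    have h4 := e_ge ht θ
    have h5 : 0 ≤ t * S.wv t θ / S.s t θ := by
      have := (time_pos ht).le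
      have := wv_nonneg ht θ
      positivity
    linarith
  have h4 := div_le_div_of_nonneg_right h3 hX.le
  linarith

lemma continuous_n (ht : t ∈ Ioc S.tp S.ti) : Continuous (S.n t) := by
  obtain ⟨r, hr, hsupp⟩ := S.exists_support_box ht.1
  have h := continuousOn_integral_of_compact_support (μ := (volume : Measure V3))
    (f := fun θ v => S.f t θ v) (s := univ) (isCompact_box r) (S.continuous_f ht).continuousOn
    (fun θ v _ hv => by
      by_contra h0
      exact hv ((norm_le_iff_mem_box r v).1 (hsupp t ⟨le_rfl, ht.2⟩ θ v h0).le))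
  exact continuousOn_univ.1 h

/-- The mean of `1 / √α` is bounded below. -/
lemma exists_integral_sinv_ge (S : EVSol) :
    ∃ c, 0 < c ∧ ∀ t ∈ Ioc S.tp S.tm, c ≤ ∫ θ in (0 : ℝ)..1, S.sinv t θ := by
  obtain ⟨F, R, hF, hR, hb⟩ := S.exists_f_bounds
  obtain ⟨E, hE, hEb⟩ := S.exists_integral_e_le
  set C2 := ∫ θ in (0 : ℝ)..1, S.n S.ti θ with hC2
  have hC2p : 0 < C2 := S.hC2
  set X := 2 * E / C2 with hX
  have hXp : 0 < X := by positivity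
  set B := (F + 1) * (2 * R) ^ 2 * (2 * X) with hB
  have hBp : 0 < B := by positivity
  refine ⟨C2 / 2 / B, by positivity, fun t ht => ?_⟩
  have ht' := mem_Ioo_of_tm ht
  have ht'' := mem_of_Ioo ht'
  have h1 : ∫ θ in (0 : ℝ)..1, S.n t θ ≤ ∫ θ in (0 : ℝ)..1, (B * S.sinv t θ + S.e t θ / X) := by
    refine intervalIntegral.integral_mono_on zero_le_one
      ((continuous_n ht'').intervalIntegrable 0 1)
      (((smsinv.intervalIntegrable ht'' 0 1).const_mul _).add
        ((sme.intervalIntegrable ht' 0 1).div_const _)) fun θ _ => ?_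
    exact n_le (F := F + 1) (by linarith) hR (fun t ht θ v => ⟨by linarith [(hb t ht θ v).1],
      (hb t ht θ v).2⟩) ht'' θ hXp
  rw [integral_n ht'', intervalIntegral.integral_add ((smsinv.intervalIntegrable ht'' 0 1).const_mul _)
        ((sme.intervalIntegrable ht' 0 1).div_const _), intervalIntegral.integral_const_mul,
        intervalIntegral.integral_div] at h1
  have h2 : (∫ θ in (0 : ℝ)..1, S.e t θ) / X ≤ C2 / 2 := by
    rw [div_le_iff₀ hXp, hX]
    have : C2 / 2 * (2 * E / C2) = E := by field_simp
    rw [this]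
    exact hEb t ht
  rw [div_le_iff₀ hBp]
  linarith

/-- A function is bounded if its weighted mean varies in a controlled way and it oscillates in a
controlled way. -/
lemma exists_bound_of_osc {X : ℝ → ℝ → ℝ} (hX : SmOn (Ioc S.tp S.ti) X) {c1 c2 : ℝ}
    (h1 : ∀ t ∈ Ioc S.tp S.tm, ∫ θ in (0 : ℝ)..1, |pt X t θ| * S.sinv t θ ≤ c1)
    (h2 : ∀ t ∈ Ioc S.tp S.tm, ∀ θ y, |X t θ - X t y| ≤ c2) :
    ∃ C, ∀ t ∈ Ioc S.tp S.tm, ∀ θ, |X t θ| ≤ C := by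
  obtain ⟨c, hc, hM⟩ := S.exists_integral_sinv_ge
  have hX' := hX.mono Ioo_subset_Ioc_self
  have hv' := S.smsinv.mono Ioo_subset_Ioc_self
  set M : ℝ → ℝ := fun t => ∫ θ in (0 : ℝ)..1, S.sinv t θ with hMdef
  set Q : ℝ → ℝ := fun t => ∫ θ in (0 : ℝ)..1, X t θ * S.sinv t θ with hQdef
  set M' : ℝ → ℝ := fun t => ∫ θ in (0 : ℝ)..1, pt S.sinv t θ with hM'def
  have dM : ∀ t ∈ Ioo S.tp S.ti, HasDerivAt M (M' t) t :=
    fun t ht => hv'.hasDerivAt_integral isOpen_Ioo ht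
  have dQ : ∀ t ∈ Ioo S.tp S.ti, HasDerivAt Q
      ((∫ θ in (0 : ℝ)..1, pt X t θ * S.sinv t θ)
        + ∫ θ in (0 : ℝ)..1, X t θ * pt S.sinv t θ) t := fun t ht => by
    refine ((hX'.mul hv').hasDerivAt_integral isOpen_Ioo ht).congr_deriv ?_
    rw [← intervalIntegral.integral_add
      (((hX'.dt isOpen_Ioo).mul hv').intervalIntegrable ht 0 1)
      ((hX'.mul (hv'.dt isOpen_Ioo)).intervalIntegrable ht 0 1)]
    refine intervalIntegral.integral_congr fun θ _ => ?_
    exact ((hX'.hasDerivAt_t isOpen_Ioo ht).mul (hv'.hasDerivAt_t isOpen_Ioo ht)).deriv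
  -- the weighted mean stays close to the function
  have hmean : ∀ t ∈ Ioc S.tp S.tm, ∀ θ, |X t θ * M t - Q t| ≤ c2 * M t := fun t ht θ => by
    have ht' := mem_of_Ioo (mem_Ioo_of_tm ht)
    have e1 : X t θ * M t - Q t = ∫ y in (0 : ℝ)..1, (X t θ - X t y) * S.sinv t y := by
      simp only [sub_mul]
      rw [intervalIntegral.integral_sub ((smsinv.intervalIntegrable ht' 0 1).const_mul _)
        ((hX.mul smsinv).intervalIntegrable ht' 0 1), intervalIntegral.integral_const_mul]
    have i1 : Continuous fun y => (X t θ - X t y) * S.sinv t y :=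
      (continuous_const.sub (hX.continuous_slice ht')).mul (smsinv.continuous_slice ht')
    rw [e1, ← intervalIntegral.integral_const_mul]
    refine (intervalIntegral.abs_integral_le_integral_abs zero_le_one).trans ?_
    refine intervalIntegral.integral_mono_on zero_le_one (i1.abs.intervalIntegrable 0 1)
      ((smsinv.intervalIntegrable ht' 0 1).const_mul _) fun y _ => ?_
    rw [abs_mul, abs_of_pos (sinv_pos ht' y)]
    exact mul_le_mul_of_nonneg_right (h2 t ht θ y) (sinv_pos ht' y).le
  have hM' : ∀ t ∈ Ioo S.tp S.ti, 0 ≤ M' t := fun t ht =>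
    intervalIntegral.integral_nonneg zero_le_one fun θ _ => pt_sinv_nonneg ht θ
  have hMp : ∀ t ∈ Ioc S.tp S.tm, 0 < M t := fun t ht => hc.trans_le (hM t ht)
  have hc2 : 0 ≤ c2 := (abs_nonneg _).trans (h2 S.tm ⟨S.tm_mem.1, le_rfl⟩ 0 0)
  have hc1 : 0 ≤ c1 := by
    refine le_trans ?_ (h1 S.tm ⟨S.tm_mem.1, le_rfl⟩)
    exact intervalIntegral.integral_nonneg zero_le_one fun θ _ => mul_nonneg (abs_nonneg _)
      (sinv_pos (mem_of_Ioo S.tm_mem) θ).le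
  -- derivative of the weighted mean
  have hW : ∀ t ∈ Ioc S.tp S.tm, ∃ d, HasDerivAt (fun t => Q t / M t) d t ∧
      |d| ≤ c1 / c + c2 / c * M' t := fun t ht => by
    have ht' := mem_Ioo_of_tm ht
    have ht'' := mem_of_Ioo ht'
    have hMt := hMp t ht
    refine ⟨_, (dQ t ht').div (dM t ht') hMt.ne', ?_⟩
    have hA : |∫ θ in (0 : ℝ)..1, pt X t θ * S.sinv t θ| ≤ c1 := by
      refine (intervalIntegral.abs_integral_le_integral_abs zero_le_one).trans
        (le_trans (le_of_eq ?_) (h1 t ht))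
      refine intervalIntegral.integral_congr fun θ _ => ?_
      simp only [abs_mul, abs_of_pos (sinv_pos ht'' θ)]
    have hB : |(∫ θ in (0 : ℝ)..1, X t θ * pt S.sinv t θ) - Q t / M t * M' t| ≤ c2 * M' t := by
      rw [hM'def, ← intervalIntegral.integral_const_mul, ← intervalIntegral.integral_sub
        ((hX'.mul (hv'.dt isOpen_Ioo)).intervalIntegrable ht' 0 1)
        (((hv'.dt isOpen_Ioo).intervalIntegrable ht' 0 1).const_mul _),
        ← intervalIntegral.integral_const_mul]
      refine (intervalIntegral.abs_integral_le_integral_abs zero_le_one).trans ?_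
      refine intervalIntegral.integral_mono_on zero_le_one
        (Continuous.intervalIntegrable (Continuous.abs (((hX'.mul (hv'.dt
          isOpen_Ioo)).continuous_slice ht').sub (continuous_const.mul
          ((hv'.dt isOpen_Ioo).continuous_slice ht')))) 0 1)
        (((hv'.dt isOpen_Ioo).intervalIntegrable ht' 0 1).const_mul _) fun y _ => ?_
      rw [← sub_mul, abs_mul, abs_of_nonneg (pt_sinv_nonneg ht' y)]
      refine mul_le_mul_of_nonneg_right ?_ (pt_sinv_nonneg ht' y)
      have h3 := hmean t ht y
      have h4 : X t y - Q t / M t = (X t y * M t - Q t) / M t := by field_simp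
      rw [h4, abs_div, abs_of_pos hMt, div_le_iff₀ hMt]
      exact h3
    set a := ∫ θ in (0 : ℝ)..1, pt X t θ * S.sinv t θ
    set b := ∫ θ in (0 : ℝ)..1, X t θ * pt S.sinv t θ
    have e2 : ((a + b) * M t - Q t * M' t) / M t ^ 2 = (a + (b - Q t / M t * M' t)) / M t := by
      field_simp
      ring
    rw [e2, abs_div, abs_of_pos hMt]
    have h5 : |a + (b - Q t / M t * M' t)| ≤ c1 + c2 * M' t :=
      (abs_add_le _ _).trans (add_le_add hA hB)
    have h6 := hM' t ht'
    calc _ ≤ (c1 + c2 * M' t) / M t := div_le_div_of_nonneg_right h5 hMt.le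
      _ ≤ (c1 + c2 * M' t) / c := div_le_div_of_nonneg_left (by positivity) hc (hM t ht)
      _ = _ := by ring
  have hmono : ∀ σ : ℝ, |σ| = 1 → MonotoneOn
      (fun t => c1 / c * t + c2 / c * M t + σ * (Q t / M t)) (Ioc S.tp S.tm) := fun σ hσ => by
    choose! d hd hdb using hW
    have hd' : ∀ t ∈ Ioc S.tp S.tm, HasDerivAt
        (fun t => c1 / c * t + c2 / c * M t + σ * (Q t / M t))
        (c1 / c * 1 + c2 / c * M' t + σ * d t) t := fun t ht =>
      (((hasDerivAt_id t).const_mul _).fun_add ((dM t (mem_Ioo_of_tm ht)).const_mul _)).fun_add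
        ((hd t ht).const_mul σ)
    refine monotoneOn_of_deriv_nonneg (convex_Ioc _ _)
      (fun t ht => (hd' t ht).continuousAt.continuousWithinAt) ?_ ?_
    · exact fun t ht => (hd' t (interior_subset ht)).differentiableAt.differentiableWithinAt
    · intro t ht
      have ht' := interior_subset ht
      rw [(hd' t ht').deriv]
      have h5 := hdb t ht'
      have h6 : |σ * d t| ≤ c1 / c + c2 / c * M' t := by rwa [abs_mul, hσ, one_mul]
      linarith [(abs_le.1 h6).1]
  have htm : S.tm ∈ Ioc S.tp S.tm := ⟨S.tm_mem.1, le_rfl⟩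
  refine ⟨c2 + (c1 / c * S.tm + c2 / c * M S.tm + |Q S.tm / M S.tm|), fun t ht θ => ?_⟩
  have hMt := hMp t ht
  have h3 : |X t θ - Q t / M t| ≤ c2 := by
    have h4 : X t θ - Q t / M t = (X t θ * M t - Q t) / M t := by field_simp
    rw [h4, abs_div, abs_of_pos hMt, div_le_iff₀ hMt]
    exact hmean t ht θ
  have h5 := hmono 1 (by simp) ht htm ht.2
  have h6 := hmono (-1) (by simp) ht htm ht.2
  simp only at h5 h6
  have h7 : 0 ≤ c1 / c * t + c2 / c * M t := by
    have := time_pos (mem_of_Ioo (mem_Ioo_of_tm ht))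
    positivity
  have h8 := abs_le.1 h3
  have h9 := neg_abs_le (Q S.tm / M S.tm)
  have h10 := le_abs_self (Q S.tm / M S.tm)
  rw [abs_le]
  constructor <;> linarith

end EVSol

namespace EVSol

variable {S : EVSol} {t θ : ℝ}

/-- A periodic function is bounded if its derivatives are dominated by a density of bounded
integral. -/
lemma exists_bound_of_density {X G : ℝ → ℝ → ℝ} (hX : SmOn (Ioc S.tp S.ti) X) (hper : Per X)
    (hG : ∀ t ∈ Ioc S.tp S.tm, Continuous (G t)) {c : ℝ}
    (hc : ∀ t ∈ Ioc S.tp S.tm, ∫ θ in (0 : ℝ)..1, G t θ ≤ c)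
    (ht : ∀ t ∈ Ioc S.tp S.tm, ∀ θ, |pt X t θ| * S.sinv t θ ≤ G t θ)
    (hθ : ∀ t ∈ Ioc S.tp S.tm, ∀ θ, |pθ X t θ| ≤ G t θ) :
    ∃ C, ∀ t ∈ Ioc S.tp S.tm, ∀ θ, |X t θ| ≤ C := by
  have hX' := hX.mono Ioo_subset_Ioc_self
  refine exists_bound_of_osc hX (c1 := c) (c2 := c) (fun t h => ?_) fun t h θ y => ?_
  · have h' := mem_Ioo_of_tm h
    refine le_trans (intervalIntegral.integral_mono_on zero_le_one
      ((((hX'.dt isOpen_Ioo).continuous_slice h').abs.mul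
        (smsinv.continuous_slice (mem_of_Ioo h'))).intervalIntegrable 0 1)
      ((hG t h).intervalIntegrable 0 1) fun θ _ => ht t h θ) (hc t h)
  · have h' := mem_Ioo_of_tm h
    exact abs_sub_le_of_periodic (hper t) (fun x => hX'.hasDerivAt_θ isOpen_Ioo h')
      ((hX'.dθ isOpen_Ioo).continuous_slice h') (hG t h) (hθ t h) (hc t h) θ y

lemma exists_bound_of_energy {X : ℝ → ℝ → ℝ} (hX : SmOn (Ioc S.tp S.ti) X) (hper : Per X) {k : ℝ}
    (hk : 0 ≤ k) (h : ∀ t ∈ Ioc S.tp S.tm, ∀ θ,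
      pt X t θ ^ 2 + S.α t θ * pθ X t θ ^ 2 ≤ k * S.wv t θ) :
    ∃ C, ∀ t ∈ Ioc S.tp S.tm, ∀ θ, |X t θ| ≤ C := by
  obtain ⟨E, hE, hEb⟩ := S.exists_integral_e_le
  obtain ⟨B, hB, hBb⟩ := S.exists_sinv_le
  have htp := S.htp
  have key : ∀ t ∈ Ioc S.tp S.tm, ∀ θ, ((pt X t θ ^ 2 + S.α t θ * pθ X t θ ^ 2) + 1) * S.sinv t θ
      ≤ k / S.tp * S.e t θ + B := fun t ht θ => by
    have ht' := mem_of_Ioo (mem_Ioo_of_tm ht)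
    have hs := s_pos ht' θ
    have h1 : t * S.wv t θ / S.s t θ ≤ S.e t θ := by
      have h2 := integral_f_nonneg ht' θ (fun v => (S.ρ_pos t θ v).le)
      have := mul_nonneg hs.le h2
      linarith [e_ge ht' θ]
    have hw := wv_nonneg ht' θ
    have h3 : S.wv t θ * S.sinv t θ ≤ 1 / S.tp * S.e t θ := by
      have h4 : S.wv t θ * S.sinv t θ = 1 / S.tp * (S.tp * S.wv t θ / S.s t θ) := by
        unfold sinv; field_simp
      rw [h4]
      refine mul_le_mul_of_nonneg_left (le_trans ?_ h1) (by positivity)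
      gcongr
      exact ht.1.le
    have h5 := mul_le_mul_of_nonneg_right (h t ht θ) (sinv_pos ht' θ).le
    have h6 := mul_le_mul_of_nonneg_left h3 hk
    have h7 := hBb t ht' θ
    have h8 : k / S.tp * S.e t θ = k * (1 / S.tp * S.e t θ) := by ring
    rw [h8]
    nlinarith
  refine exists_bound_of_density hX hper (G := fun t θ => k / S.tp * S.e t θ + B)
    (c := k / S.tp * E + B)
    (fun t ht => (continuous_const.mul (sme.continuous_slice (mem_Ioo_of_tm ht))).add
      continuous_const) (fun t ht => ?_) (fun t ht θ => ?_) fun t ht θ => ?_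
  · have i := sme.intervalIntegrable (mem_Ioo_of_tm ht) 0 1
    rw [intervalIntegral.integral_add (i.const_mul _) intervalIntegrable_const,
      intervalIntegral.integral_const_mul]
    have := mul_le_mul_of_nonneg_left (hEb t ht) (div_nonneg hk htp.le)
    simpa using this
  · have ht' := mem_of_Ioo (mem_Ioo_of_tm ht)
    refine le_trans ?_ (key t ht θ)
    refine mul_le_mul_of_nonneg_right ?_ (sinv_pos ht' θ).le
    have := mul_nonneg (S.hαpos t ht' θ).le (sq_nonneg (pθ X t θ))
    nlinarith [sq_abs (pt X t θ), sq_nonneg (|pt X t θ| - 1), abs_nonneg (pt X t θ)]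
  · have ht' := mem_of_Ioo (mem_Ioo_of_tm ht)
    refine le_trans ?_ (key t ht θ)
    have hs := s_pos ht' θ
    have e1 : S.sinv t θ = 1 / S.s t θ := by unfold sinv; field_simp
    rw [e1, ← s_sq ht', mul_one_div, le_div_iff₀ hs]
    have : 0 ≤ |pθ X t θ| * S.s t θ := by positivity
    nlinarith [sq_abs (pθ X t θ), sq_nonneg (|pθ X t θ| * S.s t θ - 1), sq_nonneg (pt X t θ)]

lemma exists_bound_U (S : EVSol) : ∃ C, ∀ t ∈ Ioc S.tp S.tm, ∀ θ, |S.U t θ| ≤ C := by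
  refine exists_bound_of_energy smU S.hUper zero_le_one fun t ht θ => ?_
  have := (S.hαpos t (mem_of_Ioo (mem_Ioo_of_tm ht)) θ).le
  have h2 : 0 ≤ Real.exp (4 * S.U t θ) / (4 * t ^ 2)
      * ((pt S.A t θ) ^ 2 + S.α t θ * (pθ S.A t θ) ^ 2) := by positivity
  unfold wv
  linarith

lemma exists_bound_A (S : EVSol) : ∃ C, ∀ t ∈ Ioc S.tp S.tm, ∀ θ, |S.A t θ| ≤ C := by
  obtain ⟨C, hC⟩ := S.exists_bound_U
  refine exists_bound_of_energy (k := 4 * S.tm ^ 2 * Real.exp (4 * C)) smA S.hAper (by positivity)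
    fun t ht θ => ?_
  have ht' := mem_of_Ioo (mem_Ioo_of_tm ht)
  have hα := (S.hαpos t ht' θ).le
  have htp := time_pos ht'
  set q := (pt S.A t θ) ^ 2 + S.α t θ * (pθ S.A t θ) ^ 2 with hq
  have hq0 : 0 ≤ q := by positivity
  have h1 : Real.exp (4 * S.U t θ) / (4 * t ^ 2) * q ≤ S.wv t θ := by
    have : 0 ≤ (pt S.U t θ) ^ 2 + S.α t θ * (pθ S.U t θ) ^ 2 := by positivity
    unfold wv
    linarith
  have h2 : q = 4 * t ^ 2 * Real.exp (-(4 * S.U t θ))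
      * (Real.exp (4 * S.U t θ) / (4 * t ^ 2) * q) := by
    rw [Real.exp_neg]
    field_simp
  rw [h2]
  have h3 := (abs_le.1 (hC t ht θ)).1
  refine mul_le_mul ?_ h1 (by positivity) (by positivity)
  have h5 := ht.2
  gcongr
  linarith

lemma exists_bound_of_matter {X : ℝ → ℝ → ℝ} (hX : SmOn (Ioc S.tp S.ti) X) (hper : Per X) {k : ℝ}
    (ht : ∀ t ∈ Ioc S.tp S.tm, ∀ θ, |pt X t θ| * S.sinv t θ ≤ k * S.n t θ)
    (hθ : ∀ t ∈ Ioc S.tp S.tm, ∀ θ, |pθ X t θ| ≤ k * S.n t θ) :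
    ∃ C, ∀ t ∈ Ioc S.tp S.tm, ∀ θ, |X t θ| ≤ C := by
  refine exists_bound_of_density hX hper (G := fun t θ => k * S.n t θ)
    (c := k * ∫ θ in (0 : ℝ)..1, S.n S.ti θ)
    (fun t h => continuous_const.mul (continuous_n (mem_of_Ioo (mem_Ioo_of_tm h))))
    (fun t h => ?_) ht hθ
  rw [intervalIntegral.integral_const_mul, integral_n (mem_of_Ioo (mem_Ioo_of_tm h))]

lemma abs_matter_t_le {R : ℝ} {H : V3 → ℝ} (hH : Continuous H) (ht : t ∈ Ioc S.tp S.ti)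
    (hR : ∀ v, S.f t θ v ≠ 0 → |H v| ≤ R) :
    |(-2 * S.α t θ * ∫ v : V3, S.f t θ v * v.1 * H v / |v0 S.α S.ν S.U S.A t θ v|)| * S.sinv t θ
      ≤ 2 * R * S.n t θ := by
  rw [integral_div_abs_v0 ht]
  have hs := s_pos ht θ
  have h1 : |∫ v : V3, S.f t θ v * (v.1 * H v / S.ρ t θ v)| ≤ ∫ v : V3, S.f t θ v * R := by
    refine abs_integral_f_le ht θ (continuous_div_ρ ht θ (by fun_prop)) continuous_const
      fun v hv => ?_
    have hρ := S.ρ_pos t θ v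
    rw [abs_div, abs_mul, abs_of_pos hρ, div_le_iff₀ hρ, mul_comm R]
    exact mul_le_mul (S.abs_v1_le t θ v) (hR v hv) (abs_nonneg _) hρ.le
  have e1 : ∫ v : V3, S.f t θ v * v.1 * H v / S.ρ t θ v
      = ∫ v : V3, S.f t θ v * (v.1 * H v / S.ρ t θ v) :=
    integral_congr_ae (Eventually.of_forall fun v => by ring)
  have e2 : ∫ v : V3, S.f t θ v * R = R * S.n t θ := by
    rw [integral_mul_const, mul_comm]; rfl
  rw [e1, ← s_sq ht, abs_mul, abs_mul, abs_mul]
  rw [e2] at h1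
  set I := ∫ v : V3, S.f t θ v * (v.1 * H v / S.ρ t θ v)
  rw [abs_of_pos (inv_pos.2 hs), abs_of_nonneg (sq_nonneg (S.s t θ))]
  have e3 : |(-2 : ℝ)| * S.s t θ ^ 2 * ((S.s t θ)⁻¹ * |I|) * S.sinv t θ = 2 * |I| := by
    unfold sinv
    rw [abs_neg, abs_of_pos two_pos]
    field_simp
  rw [e3]
  linarith

lemma abs_matter_θ_le {R : ℝ} {H : V3 → ℝ} (hH : Continuous H) (ht : t ∈ Ioc S.tp S.ti)
    (hR : ∀ v, S.f t θ v ≠ 0 → |H v| ≤ R) :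
    |2 * ∫ v : V3, S.f t θ v * H v| ≤ 2 * R * S.n t θ := by
  have h1 : |∫ v : V3, S.f t θ v * H v| ≤ ∫ v : V3, S.f t θ v * R :=
    abs_integral_f_le ht θ hH continuous_const hR
  have e2 : ∫ v : V3, S.f t θ v * R = R * S.n t θ := by
    rw [integral_mul_const, mul_comm]; rfl
  rw [abs_mul, abs_of_pos two_pos]
  linarith

lemma exists_bound_J (S : EVSol) : ∃ C, ∀ t ∈ Ioc S.tp S.tm, ∀ θ, |S.J t θ| ≤ C := by
  obtain ⟨F, R, hF, hR, hb⟩ := S.exists_f_bounds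
  refine exists_bound_of_matter (k := 2 * R) smJ S.hJper (fun t ht θ => ?_) fun t ht θ => ?_
  · have ht' := mem_of_Ioo (mem_Ioo_of_tm ht)
    rw [S.hjt t ht' θ]
    exact abs_matter_t_le (H := fun v => v.2.1) (by fun_prop) ht' fun v hv => ((hb t ht' θ v).2 hv).1
  · have ht' := mem_of_Ioo (mem_Ioo_of_tm ht)
    rw [S.hjth t ht' θ]
    exact abs_matter_θ_le (H := fun v => v.2.1) (by fun_prop) ht' fun v hv => ((hb t ht' θ v).2 hv).1

lemma exists_bound_K (S : EVSol) : ∃ C, ∀ t ∈ Ioc S.tp S.tm, ∀ θ, |S.K t θ| ≤ C := by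
  obtain ⟨F, R, hF, hR, hb⟩ := S.exists_f_bounds
  refine exists_bound_of_matter (k := 2 * R) smK S.hKper (fun t ht θ => ?_) fun t ht θ => ?_
  · have ht' := mem_of_Ioo (mem_Ioo_of_tm ht)
    rw [S.hkt t ht' θ]
    exact abs_matter_t_le (H := fun v => v.2.2) (by fun_prop) ht' fun v hv => ((hb t ht' θ v).2 hv).2
  · have ht' := mem_of_Ioo (mem_Ioo_of_tm ht)
    rw [S.hkth t ht' θ]
    exact abs_matter_θ_le (H := fun v => v.2.2) (by fun_prop) ht' fun v hv => ((hb t ht' θ v).2 hv).2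

end EVSol

namespace EVSol

variable {S : EVSol} {t θ : ℝ}

lemma bθ_eq (ht : t ∈ Ioc S.tp S.ti) (θ : ℝ) : S.bθ t θ
    = 2 * t * (pt S.U t θ * pθ S.U t θ
        + Real.exp (4 * S.U t θ) / (4 * t ^ 2) * pt S.A t θ * pθ S.A t θ)
      - S.s t θ * ∫ v : V3, S.f t θ v * v.1 := by
  unfold bθ
  rw [S.hnuth t ht θ, show Real.sqrt (S.α t θ) = S.s t θ from rfl]
  ring

lemma abs_bθ_le_e (ht : t ∈ Ioc S.tp S.ti) (θ : ℝ) : |S.bθ t θ| ≤ S.e t θ := by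
  refine le_trans ?_ (e_ge ht θ)
  rw [bθ_eq ht]
  have hs := s_pos ht θ
  have htp := time_pos ht
  have h1 : |∫ v : V3, S.f t θ v * v.1| ≤ ∫ v : V3, S.f t θ v * S.ρ t θ v :=
    abs_integral_f_le ht θ (by fun_prop) (continuous_ρ_v ht θ) fun v _ => S.abs_v1_le t θ v
  refine (abs_sub _ _).trans (add_le_add ?_ ?_)
  · rw [le_div_iff₀ hs]
    unfold wv
    rw [← s_sq ht]
    set a := pt S.U t θ
    set b := pθ S.U t θ
    set c := pt S.A t θ
    set d := pθ S.A t θ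
    set q := Real.exp (4 * S.U t θ) / (4 * t ^ 2) with hq
    set s := S.s t θ
    have hq0 : 0 ≤ q := by positivity
    have h2 : |2 * t * (a * b + q * c * d)| * s = t * |2 * (a * (s * b)) + q * (2 * (c * (s * d)))| := by
      rw [← abs_of_pos hs, ← abs_mul, ← abs_of_pos htp, ← abs_mul, abs_of_pos hs, abs_of_pos htp]
      congr 1
      ring
    rw [h2]
    refine mul_le_mul_of_nonneg_left ?_ htp.le
    have h3 := mul_nonneg hq0 (sq_nonneg (c - s * d))
    have h4 := mul_nonneg hq0 (sq_nonneg (c + s * d))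
    rw [abs_le]
    constructor <;> nlinarith [sq_nonneg (a - s * b), sq_nonneg (a + s * b)]
  · rw [abs_mul, abs_of_pos hs]
    exact mul_le_mul_of_nonneg_left h1 hs.le

/-- `√α e^ν` is bounded. -/
lemma exists_bound_s_mul_exp (S : EVSol) :
    ∃ C, ∀ t ∈ Ioc S.tp S.tm, ∀ θ, S.s t θ * Real.exp (S.ν t θ) ≤ C := by
  obtain ⟨E, hE, hEb⟩ := S.exists_integral_e_le
  obtain ⟨C, hC⟩ := S.exists_bound_U
  set N := ∫ θ in (0 : ℝ)..1, S.n S.ti θ with hN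
  have hNp : 0 < N := S.hC2
  refine ⟨Real.exp (E + C) * E / N, fun t ht θ => ?_⟩
  have hto := mem_Ioo_of_tm ht
  have ht' := mem_of_Ioo hto
  have smν' := S.smν.mono Ioo_subset_Ioc_self
  have smα' := S.smα.mono Ioo_subset_Ioc_self
  have sms' := S.sms.mono Ioo_subset_Ioc_self
  set β : ℝ → ℝ := fun x => S.ν t x + Real.log (S.s t x) with hβ
  have hexp : ∀ x, Real.exp (β x) = S.s t x * Real.exp (S.ν t x) := fun x => by
    rw [hβ]
    simp only
    rw [Real.exp_add, Real.exp_log (s_pos ht' x), mul_comm]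
  have hbc : Continuous (S.bθ t) :=
    ((smν'.dθ isOpen_Ioo).continuous_slice hto).add
      (((smα'.dθ isOpen_Ioo).continuous_slice hto).div
        (continuous_const.mul (S.smα.continuous_slice ht'))
        fun x => (mul_pos two_pos (S.hαpos t ht' x)).ne')
  have hosc : ∀ x y, |β x - β y| ≤ E := by
    refine abs_sub_le_of_periodic (fun x => ?_) (fun x => ?_) hbc (sme.continuous_slice hto)
      (abs_bθ_le_e ht') (hEb t ht)
    · simp only [hβ, S.hνper, S.pers t]
    · refine ((smν'.hasDerivAt_θ isOpen_Ioo hto).add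
        ((sms'.hasDerivAt_θ isOpen_Ioo hto).log (s_pos ht' x).ne')).congr_deriv ?_
      rw [pθ_s hto]
      unfold bθ
      rw [← s_sq ht']
      have := s_pos ht' x
      field_simp
  have hle : ∀ y, Real.exp (β θ) * S.n t y ≤ Real.exp (E + C) * S.e t y := fun y => by
    have hs := s_pos ht' y
    have h1 : Real.exp (S.ν t y) * Real.exp (-C) * S.n t y ≤ ∫ v : V3, S.f t y v * S.ρ t y v := by
      have e1 : Real.exp (S.ν t y) * Real.exp (-C) * S.n t y
          = ∫ v : V3, S.f t y v * (Real.exp (S.ν t y) * Real.exp (-C)) := by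
        rw [integral_mul_const, mul_comm]; rfl
      rw [e1]
      refine integral_f_mono ht' y continuous_const (continuous_ρ_v ht' y) fun v _ => ?_
      refine le_trans (Real.le_sqrt_of_sq_le ?_) (S.sqrt_g_le t y v)
      have h2 : Real.exp (-C) ^ 2 ≤ Real.exp (-2 * S.U t y) := by
        rw [← Real.exp_nat_mul]
        apply Real.exp_le_exp.2
        have := (abs_le.1 (hC t ht y)).2
        push_cast
        linarith
      have h3 : Real.exp (S.ν t y) ^ 2 = Real.exp (2 * S.ν t y) := by
        rw [← Real.exp_nat_mul]; norm_num
      rw [mul_pow, h3]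
      unfold g w
      refine mul_le_mul_of_nonneg_left (h2.trans ?_) (Real.exp_pos _).le
      have : 0 ≤ Real.exp (-4 * S.U t y) * v.2.1 ^ 2
        + (t ^ 2)⁻¹ * (v.2.2 - S.A t y * v.2.1) ^ 2 := by positivity
      linarith
    have h4 : S.s t y * ∫ v : V3, S.f t y v * S.ρ t y v ≤ S.e t y := by
      have h5 : 0 ≤ t * S.wv t y / S.s t y := by
        have := (time_pos ht').le
        have := wv_nonneg ht' y
        positivity
      linarith [e_ge ht' y]
    have h5 := mul_le_mul_of_nonneg_left h1 hs.le
    have hn : 0 ≤ S.n t y := integral_nonneg fun v => S.hfnn t ht' y v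
    have h6 : Real.exp (β θ) ≤ Real.exp E * Real.exp (β y) := by
      rw [← Real.exp_add]
      apply Real.exp_le_exp.2
      linarith [(abs_le.1 (hosc θ y)).2]
    have h7 := mul_le_mul_of_nonneg_right h6 hn
    refine h7.trans ?_
    rw [hexp y]
    have h8 : Real.exp E * (S.s t y * Real.exp (S.ν t y)) * S.n t y
        = Real.exp (E + C) * (S.s t y * (Real.exp (S.ν t y) * Real.exp (-C) * S.n t y)) := by
      rw [Real.exp_add, Real.exp_neg]
      field_simp
    rw [h8]
    exact mul_le_mul_of_nonneg_left (h5.trans h4) (Real.exp_pos _).le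
  have hmean : ∫ y in (0 : ℝ)..1, Real.exp (β θ) * S.n t y
      ≤ ∫ y in (0 : ℝ)..1, Real.exp (E + C) * S.e t y :=
    intervalIntegral.integral_mono_on zero_le_one
      ((continuous_const.mul (continuous_n ht')).intervalIntegrable 0 1)
      ((sme.intervalIntegrable hto 0 1).const_mul _) fun y _ => hle y
  rw [intervalIntegral.integral_const_mul, intervalIntegral.integral_const_mul, integral_n ht',
    hexp] at hmean
  rw [le_div_iff₀ hNp]
  exact hmean.trans (mul_le_mul_of_nonneg_left (hEb t ht) (Real.exp_pos _).le)

/-- `C` bounds all quantities which are controlled by the energy -/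
structure Bound (S : EVSol) (C : ℝ) : Prop where
  one_le : 1 ≤ C
  U : ∀ t ∈ Ioc S.tp S.tm, ∀ θ, |S.U t θ| ≤ C
  A : ∀ t ∈ Ioc S.tp S.tm, ∀ θ, |S.A t θ| ≤ C
  J : ∀ t ∈ Ioc S.tp S.tm, ∀ θ, |S.J t θ| ≤ C
  K : ∀ t ∈ Ioc S.tp S.tm, ∀ θ, |S.K t θ| ≤ C
  sν : ∀ t ∈ Ioc S.tp S.tm, ∀ θ, S.s t θ * Real.exp (S.ν t θ) ≤ C
  sinv : ∀ t ∈ Ioc S.tp S.tm, ∀ θ, S.sinv t θ ≤ C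
  f : ∀ t ∈ Ioc S.tp S.tm, ∀ θ v, S.f t θ v ≤ C
  v : ∀ t ∈ Ioc S.tp S.tm, ∀ θ v, S.f t θ v ≠ 0 → |v.2.1| ≤ C ∧ |v.2.2| ≤ C

lemma exists_bound (S : EVSol) : ∃ C, S.Bound C := by
  obtain ⟨F, R, hF, hR, hb⟩ := S.exists_f_bounds
  obtain ⟨c1, h1⟩ := S.exists_bound_U
  obtain ⟨c2, h2⟩ := S.exists_bound_A
  obtain ⟨c3, h3⟩ := S.exists_bound_J
  obtain ⟨c4, h4⟩ := S.exists_bound_K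
  obtain ⟨c5, h5⟩ := S.exists_bound_s_mul_exp
  obtain ⟨c6, h6p, h6⟩ := S.exists_sinv_le
  have g := fun t (ht : t ∈ Ioc S.tp S.tm) => mem_of_Ioo (mem_Ioo_of_tm ht)
  refine ⟨1 + |F| + |R| + |c1| + |c2| + |c3| + |c4| + |c5| + |c6|, ?_, fun t ht θ => (h1 t ht θ).trans ?_,
    fun t ht θ => (h2 t ht θ).trans ?_, fun t ht θ => (h3 t ht θ).trans ?_,
    fun t ht θ => (h4 t ht θ).trans ?_, fun t ht θ => (h5 t ht θ).trans ?_,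
    fun t ht θ => (h6 t (g t ht) θ).trans ?_, fun t ht θ v => (hb t (g t ht) θ v).1.trans ?_,
    fun t ht θ v hv => ⟨((hb t (g t ht) θ v).2 hv).1.trans ?_,
      ((hb t (g t ht) θ v).2 hv).2.trans ?_⟩⟩
  all_goals
    linarith [abs_nonneg F, abs_nonneg R, abs_nonneg c1, abs_nonneg c2, abs_nonneg c3,
      abs_nonneg c4, abs_nonneg c5, abs_nonneg c6, le_abs_self F, le_abs_self R, le_abs_self c1,
      le_abs_self c2, le_abs_self c3, le_abs_self c4, le_abs_self c5, le_abs_self c6]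

end EVSol

lemma integral_div_sqrt_one_add_sq (s V : ℝ) :
    ∫ x in -V..V, s / Real.sqrt (1 + (s * x) ^ 2) = 2 * Real.arsinh (s * V) := by
  have hc : Continuous fun x => s / Real.sqrt (1 + (s * x) ^ 2) :=
    continuous_const.div (by fun_prop) fun x => (Real.sqrt_pos.2 (by positivity)).ne'
  have hd : ∀ x, HasDerivAt (fun x => Real.arsinh (s * x)) (s / Real.sqrt (1 + (s * x) ^ 2)) x :=
    fun x => by
      have h := ((hasDerivAt_id x).const_mul s).arsinh
      refine h.congr_deriv ?_
      simp [div_eq_inv_mul]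
  rw [intervalIntegral.integral_eq_sub_of_hasDerivAt (fun x _ => hd x) (hc.intervalIntegrable _ _),
    mul_neg, Real.arsinh_neg]
  ring

lemma arsinh_sqrt_le {y : ℝ} (hy : 1 ≤ y) : Real.arsinh (Real.sqrt y) ≤ 2 + Real.log y := by
  have h1 : Real.sqrt y ≤ y := Real.sqrt_le_iff.2 ⟨by linarith, by nlinarith⟩
  have h2 : Real.sqrt (1 + y) ≤ 2 * y := Real.sqrt_le_iff.2 ⟨by linarith, by nlinarith⟩
  rw [Real.arsinh, Real.sq_sqrt (by linarith), ← Real.log_exp 2,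
    ← Real.log_mul (Real.exp_pos 2).ne' (by positivity)]
  refine Real.log_le_log (by positivity) ?_
  nlinarith [Real.add_one_le_exp (2 : ℝ)]

namespace EVSol

variable {S : EVSol} {t θ : ℝ} {C : ℝ}

lemma Bound.integral_f_le (hB : S.Bound C) (ht : t ∈ Ioc S.tp S.tm) (θ : ℝ) {V : ℝ} (hV : 0 ≤ V)
    (hf : ∀ v, S.f t θ v ≠ 0 → |v.1| ≤ V) {φ : ℝ → ℝ} (hφ : Continuous φ) (hφ0 : ∀ x, 0 ≤ φ x) :
    ∫ v : V3, S.f t θ v * φ v.1 ≤ C * (2 * C) ^ 2 * ∫ x in -V..V, φ x := by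
  have ht' := mem_of_Ioo (mem_Ioo_of_tm ht)
  have hC := hB.one_le
  set k : Set V3 := Icc (-V) V ×ˢ (Icc (-C) C ×ˢ Icc (-C) C) with hk
  have hkc : IsCompact k := isCompact_Icc.prod (isCompact_Icc.prod isCompact_Icc)
  have hi : IntegrableOn (fun v : V3 => C * φ v.1) k :=
    (by fun_prop : Continuous fun v : V3 => C * φ v.1).continuousOn.integrableOn_compact hkc
  have h1 : ∫ v : V3, S.f t θ v * φ v.1 ≤ ∫ v, k.indicator (fun v : V3 => C * φ v.1) v := by
    refine integral_mono (integrable_f_mul ht' θ (by fun_prop))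
      ((integrable_indicator_iff hkc.measurableSet).2 hi) fun v => ?_
    have hφv := hφ0 v.1
    by_cases hv : v ∈ k
    · simp only [indicator_of_mem hv]
      exact mul_le_mul_of_nonneg_right (hB.f t ht θ v) hφv
    · simp only [indicator_of_notMem hv]
      have : S.f t θ v = 0 := by
        by_contra h0
        have h2 := hB.v t ht θ v h0
        exact hv ⟨abs_le.1 (hf v h0), abs_le.1 h2.1, abs_le.1 h2.2⟩
      simp [this]
  have h2 : ∫ v in k, φ v.1 = (∫ x in Icc (-V) V, φ x) * (2 * C) ^ 2 := by
    have h3 := setIntegral_prod_mul (μ := (volume : Measure ℝ)) (ν := (volume : Measure (ℝ × ℝ)))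
      φ (fun _ => (1 : ℝ)) (Icc (-V) V) (Icc (-C) C ×ˢ Icc (-C) C)
    simp only [mul_one] at h3
    rw [← Measure.volume_eq_prod] at h3
    rw [hk]
    refine h3.trans ?_
    have h4 : volume.real (Icc (-C) C ×ˢ Icc (-C) C) = (2 * C) ^ 2 := by
      rw [Measure.volume_eq_prod, measureReal_prod_prod, Real.volume_real_Icc_of_le (by linarith)]
      ring
    rw [setIntegral_const, h4, smul_eq_mul, mul_one]
  rw [integral_indicator hkc.measurableSet, integral_const_mul, h2, integral_Icc_eq_integral_Ioc,
    ← intervalIntegral.integral_of_le (by linarith)] at h1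
  linarith

lemma Bound.exp_neg_four_le (hB : S.Bound C) (ht : t ∈ Ioc S.tp S.tm) (θ : ℝ) :
    Real.exp (-4 * S.U t θ) ≤ Real.exp (4 * C) :=
  Real.exp_le_exp.2 (by linarith [(abs_le.1 (hB.U t ht θ)).1])

lemma Bound.α_mul_exp_le (hB : S.Bound C) (ht : t ∈ Ioc S.tp S.tm) (θ : ℝ) :
    S.α t θ * Real.exp (2 * S.ν t θ) ≤ C ^ 2 := by
  have ht' := mem_of_Ioo (mem_Ioo_of_tm ht)
  have hs := s_pos ht' θ
  have e : S.α t θ * Real.exp (2 * S.ν t θ) = (S.s t θ * Real.exp (S.ν t θ)) ^ 2 := by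
    rw [mul_pow, s_sq ht', ← Real.exp_nat_mul]
    norm_num
  rw [e]
  exact pow_le_pow_left₀ (by positivity) (hB.sν t ht θ) 2

lemma abs_v1_le_of_sq (ht : t ∈ Ioc S.tp S.ti) {y x : ℝ} (h : S.α t θ * x ^ 2 ≤ y) :
    |x| ≤ Real.sqrt y * S.sinv t θ := by
  have hs := s_pos ht θ
  have h1 : S.s t θ * |x| ≤ Real.sqrt y := by
    refine Real.le_sqrt_of_sq_le ?_
    rw [mul_pow, sq_abs, s_sq ht]
    exact h
  unfold sinv
  rw [← div_eq_mul_inv, le_div_iff₀ hs]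
  linarith

/-- In terms of a momentum bound, `-α_t / α` grows at most logarithmically. -/
lemma Bound.exists_κ_le (hB : S.Bound C) : ∃ k, 0 < k ∧ ∀ t ∈ Ioc S.tp S.tm, ∀ θ y, 1 ≤ y →
    (∀ v : V3, S.f t θ v ≠ 0 → S.α t θ * v.1 ^ 2 ≤ y) → S.κ t θ ≤ k * (1 + Real.log y) := by
  have hC := hB.one_le
  have htp0 := S.htp
  obtain ⟨B, hB0, hw⟩ := S.exists_w_le (t2 := S.tm) htp0 C C
  set M := 1 + C ^ 2 * B with hM
  have hM1 : 1 ≤ M := by rw [hM]; nlinarith [mul_nonneg (sq_nonneg C) hB0]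
  set a := C ^ 2 * (Real.exp (4 * C) * C ^ 2 / S.tp + (C + C * C) ^ 2 / S.tp ^ 3) with ha
  have ha0 : 0 ≤ a := by positivity
  set b := 2 * (M * (C * (2 * C) ^ 2 * 2)) with hb
  have hb0 : 0 ≤ b := by positivity
  refine ⟨a + 2 * b + 1, by linarith, fun t ht θ y hy hf => ?_⟩
  have ht' := mem_of_Ioo (mem_Ioo_of_tm ht)
  have htp := time_pos ht'
  have hs := s_pos ht' θ
  have hP := hB.α_mul_exp_le ht θ
  set P := S.α t θ * Real.exp (2 * S.ν t θ) with hPdef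
  have hP0 : 0 ≤ P := mul_nonneg (S.hαpos t ht' θ).le (Real.exp_pos _).le
  have htt : S.tp ≤ t := ht.1.le
  have h1 : P * (Real.exp (-4 * S.U t θ) * S.J t θ ^ 2 / t
      + (S.K t θ - S.A t θ * S.J t θ) ^ 2 / t ^ 3) ≤ a := by
    have hJ : S.J t θ ^ 2 ≤ C ^ 2 := by
      rw [← sq_abs]; exact pow_le_pow_left₀ (abs_nonneg _) (hB.J t ht θ) 2
    have hKJ : (S.K t θ - S.A t θ * S.J t θ) ^ 2 ≤ (C + C * C) ^ 2 := by
      rw [← sq_abs]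
      refine pow_le_pow_left₀ (abs_nonneg _) ((abs_sub _ _).trans ?_) 2
      rw [abs_mul]
      exact add_le_add (hB.K t ht θ) (mul_le_mul (hB.A t ht θ) (hB.J t ht θ) (abs_nonneg _)
        (by linarith))
    rw [ha]
    have := hB.exp_neg_four_le ht θ
    gcongr
  have h2 : P * ∫ v : V3, S.f t θ v * (S.w v.2.1 v.2.2 t θ / S.ρ t θ v)
      ≤ M * ∫ v : V3, S.f t θ v * (S.s t θ / Real.sqrt (1 + (S.s t θ * v.1) ^ 2)) := by
    have h3 : ∫ v : V3, S.f t θ v * (P * (S.w v.2.1 v.2.2 t θ / S.ρ t θ v))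
        ≤ ∫ v : V3, S.f t θ v * (M * (S.s t θ / Real.sqrt (1 + (S.s t θ * v.1) ^ 2))) := by
      refine integral_f_mono ht' θ
        (continuous_const.mul (continuous_div_ρ ht' θ (continuous_w_v ht' θ)))
        (continuous_const.mul (continuous_const.div (by fun_prop)
          fun v => (Real.sqrt_pos.2 (by positivity)).ne')) fun v hv => ?_
      have hρ := S.ρ_pos t θ v
      have hv' := hB.v t ht θ v hv
      have hwB := hw t ⟨htt, ht.2⟩ θ v.2.1 v.2.2 (hB.U t ht θ) (hB.A t ht θ) hv'.1 hv'.2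
      have hw0 := S.w_pos (t := t) θ v.2.1 v.2.2
      set w := S.w v.2.1 v.2.2 t θ
      have hm0 : 0 ≤ P * w := mul_nonneg hP0 hw0.le
      have hmM : P * w ≤ M := by
        have : P * w ≤ C ^ 2 * B := mul_le_mul hP hwB hw0.le (sq_nonneg C)
        linarith
      have hr : 0 < Real.sqrt (1 + (S.s t θ * v.1) ^ 2) := Real.sqrt_pos.2 (by positivity)
      rw [← mul_div_assoc, ← mul_div_assoc, div_le_div_iff₀ hρ hr]
      have h4 : P * w * Real.sqrt (1 + (S.s t θ * v.1) ^ 2) ≤ M * (S.s t θ * S.ρ t θ v) := by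
        refine abs_le_of_sq_le_sq' ?_ (by positivity) |>.2
        have h5 : S.ρ t θ v ^ 2 = Real.exp (2 * S.ν t θ) * w + v.1 ^ 2 := S.ρ_sq t θ v
        rw [mul_pow, Real.sq_sqrt (by positivity), mul_pow M, mul_pow (S.s t θ) (S.ρ t θ v), h5]
        have h6 : S.s t θ ^ 2 * (Real.exp (2 * S.ν t θ) * w + v.1 ^ 2)
            = P * w + (S.s t θ * v.1) ^ 2 := by
          rw [hPdef, ← s_sq ht']; ring
        rw [h6]
        set m := P * w
        have h8 : m ^ 2 ≤ M ^ 2 := pow_le_pow_left₀ hm0 hmM 2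
        have h7 : m ^ 2 ≤ M ^ 2 * m := by
          have : m ≤ M ^ 2 := hmM.trans (le_self_pow₀ hM1 two_ne_zero)
          rw [sq m]
          exact mul_le_mul_of_nonneg_right this hm0
        have h9 := mul_le_mul_of_nonneg_right h8 (sq_nonneg (S.s t θ * v.1))
        linarith
      linarith
    rw [← integral_const_mul, ← integral_const_mul]
    refine Eq.trans_le ?_ (h3.trans_eq ?_)
    · exact integral_congr_ae (Eventually.of_forall fun v => by ring)
    · exact integral_congr_ae (Eventually.of_forall fun v => by ring)
  have h3 := hB.integral_f_le ht θ (mul_nonneg (Real.sqrt_nonneg y) (sinv_pos ht' θ).le)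
    (fun v hv => abs_v1_le_of_sq ht' (hf v hv))
    (φ := fun x => S.s t θ / Real.sqrt (1 + (S.s t θ * x) ^ 2))
    (continuous_const.div (by fun_prop) fun v => (Real.sqrt_pos.2 (by positivity)).ne')
    (fun x => by positivity)
  rw [integral_div_sqrt_one_add_sq] at h3
  have e1 : S.s t θ * (Real.sqrt y * S.sinv t θ) = Real.sqrt y := by
    unfold EVSol.sinv; field_simp
  rw [e1] at h3
  have hL : 0 ≤ Real.log y := Real.log_nonneg hy
  have h4 := arsinh_sqrt_le hy
  have h5 : P * ∫ v : V3, S.f t θ v * (S.w v.2.1 v.2.2 t θ / S.ρ t θ v)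
      ≤ M * (C * (2 * C) ^ 2 * (2 * (2 + Real.log y))) := by
    refine h2.trans (mul_le_mul_of_nonneg_left (h3.trans ?_) (by linarith))
    refine mul_le_mul_of_nonneg_left ?_ (by positivity)
    linarith
  have h6 : S.κ t θ = P * (Real.exp (-4 * S.U t θ) * S.J t θ ^ 2 / t
      + (S.K t θ - S.A t θ * S.J t θ) ^ 2 / t ^ 3)
      + 2 * (P * ∫ v : V3, S.f t θ v * (S.w v.2.1 v.2.2 t θ / S.ρ t θ v)) := by
    unfold κ; ring
  have h7 : 2 * (M * (C * (2 * C) ^ 2 * (2 * (2 + Real.log y)))) = b * (2 + Real.log y) := by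
    rw [hb]; ring
  rw [h6]
  nlinarith [mul_nonneg ha0 hL, mul_nonneg hb0 hL]

/-- derivative of `U` along a null direction -/
def Us (S : EVSol) (σ : ℝ) : ℝ → ℝ → ℝ := fun t θ => pt S.U t θ + σ * (S.s t θ * pθ S.U t θ)

/-- derivative of `A` along a null direction -/
def As (S : EVSol) (σ : ℝ) : ℝ → ℝ → ℝ := fun t θ => pt S.A t θ + σ * (S.s t θ * pθ S.A t θ)

/-- null component of the energy density -/
def hh (S : EVSol) (σ : ℝ) : ℝ → ℝ → ℝ := fun t θ =>
  S.Us σ t θ ^ 2 + Real.exp (4 * S.U t θ) / (4 * t ^ 2) * S.As σ t θ ^ 2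

lemma hh_nonneg (S : EVSol) (σ t θ : ℝ) : 0 ≤ S.hh σ t θ := by
  unfold hh; positivity

lemma Bound.exists_bθ_le (hB : S.Bound C) : ∃ k, 0 < k ∧ ∀ t ∈ Ioc S.tp S.tm, ∀ θ y, 0 ≤ y →
    S.hh 1 t θ ≤ y → S.hh (-1) t θ ≤ y →
    (∀ v : V3, S.f t θ v ≠ 0 → S.α t θ * v.1 ^ 2 ≤ y) → S.s t θ * |S.bθ t θ| ≤ k * y := by
  have hC := hB.one_le
  refine ⟨S.tm + C * (2 * C) ^ 2 * 2, ?_, fun t ht θ y hy h1 h2 hf => ?_⟩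
  · have := S.htp.trans S.tm_mem.1
    positivity
  have ht' := mem_of_Ioo (mem_Ioo_of_tm ht)
  have htp := time_pos ht'
  have hs := s_pos ht' θ
  have hV : 0 ≤ Real.sqrt y * S.sinv t θ := mul_nonneg (Real.sqrt_nonneg y) (sinv_pos ht' θ).le
  have hf' := fun v hv => abs_v1_le_of_sq ht' (hf v hv)
  have h3 := hB.integral_f_le ht θ hV hf' (φ := fun x => Real.sqrt y * S.sinv t θ) continuous_const
    fun _ => hV
  rw [intervalIntegral.integral_const, smul_eq_mul] at h3
  have h4 : |∫ v : V3, S.f t θ v * v.1| ≤ ∫ v : V3, S.f t θ v * (Real.sqrt y * S.sinv t θ) :=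
    abs_integral_f_le ht' θ (by fun_prop) continuous_const hf'
  have h5 : S.s t θ ^ 2 * |∫ v : V3, S.f t θ v * v.1| ≤ C * (2 * C) ^ 2 * 2 * y := by
    refine (mul_le_mul_of_nonneg_left (h4.trans h3) (sq_nonneg _)).trans (le_of_eq ?_)
    have e1 : y = Real.sqrt y ^ 2 := (Real.sq_sqrt hy).symm
    conv_rhs => rw [e1]
    unfold EVSol.sinv
    field_simp
    ring
  have e2 : S.s t θ * S.bθ t θ = t / 2 * (S.hh 1 t θ - S.hh (-1) t θ)
      - S.s t θ ^ 2 * ∫ v : V3, S.f t θ v * v.1 := by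
    rw [bθ_eq ht']
    unfold hh Us As
    ring
  rw [show S.s t θ * |S.bθ t θ| = |S.s t θ * S.bθ t θ| by rw [abs_mul, abs_of_pos hs], e2]
  have h6 : |t / 2 * (S.hh 1 t θ - S.hh (-1) t θ)| ≤ S.tm * y := by
    rw [abs_mul, abs_of_pos (by positivity)]
    have h7 : |S.hh 1 t θ - S.hh (-1) t θ| ≤ y := by
      have := S.hh_nonneg 1 t θ
      have := S.hh_nonneg (-1) t θ
      rw [abs_le]; constructor <;> linarith
    refine mul_le_mul (by linarith [ht.2]) h7 (abs_nonneg _) (htp.le.trans ht.2)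
  have h8 : |S.s t θ ^ 2 * ∫ v : V3, S.f t θ v * v.1| ≤ C * (2 * C) ^ 2 * 2 * y := by
    rw [abs_mul, abs_of_pos (by positivity)]
    exact h5
  refine (abs_sub _ _).trans ?_
  linarith

end EVSol

namespace EVSol

variable {S : EVSol} {t θ : ℝ}

/-- the matter and twist source in the wave equation for `U` -/
def srcU (S : EVSol) (t θ : ℝ) : ℝ :=
  S.α t θ * Real.exp (2 * S.ν t θ) / (2 * t) * (Real.exp (-4 * S.U t θ) * S.J t θ ^ 2 / t
    + ∫ v : V3, S.f t θ v * (Real.exp (-2 * S.U t θ)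
      * (1 + 2 * Real.exp (-2 * S.U t θ) * v.2.1 ^ 2) / S.ρ t θ v))

/-- the matter and twist source in the wave equation for `A` -/
def srcA (S : EVSol) (t θ : ℝ) : ℝ :=
  S.α t θ * Real.exp (2 * S.ν t θ) / t * Real.exp (-4 * S.U t θ)
    * (S.J t θ * (S.K t θ - S.A t θ * S.J t θ) / t
      + 2 * ∫ v : V3, S.f t θ v * (v.2.1 * (v.2.2 - S.A t θ * v.2.1) / S.ρ t θ v))

lemma exp_sub_two (S : EVSol) (t θ : ℝ) : Real.exp (2 * S.ν t θ - 2 * S.U t θ)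
    = Real.exp (2 * S.ν t θ) * Real.exp (-2 * S.U t θ) := by
  rw [← Real.exp_add]; congr 1; ring

lemma pt_pt_U (ht : t ∈ Ioc S.tp S.ti) (θ : ℝ) : pt (pt S.U) t θ
    = S.α t θ * pθ (pθ S.U) t θ - pt S.U t θ / t - S.κ t θ / 2 * pt S.U t θ
      + pθ S.α t θ * pθ S.U t θ / 2
      + Real.exp (4 * S.U t θ) / (2 * t ^ 2) * (pt S.A t θ ^ 2 - S.α t θ * pθ S.A t θ ^ 2)
      + S.srcU t θ := by
  rw [S.hutt t ht θ, integral_div_abs_v0 ht, exp_sub_two, exp_sub_four, pt_α ht,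
    show Real.sqrt (S.α t θ) = S.s t θ from rfl]
  have hα := S.hαpos t ht θ
  have hs := s_pos ht θ
  have htp := time_pos ht
  have e1 : ∫ v : V3, S.f t θ v * (1 + 2 * Real.exp (-2 * S.U t θ) * v.2.1 ^ 2) / S.ρ t θ v
      = (Real.exp (-2 * S.U t θ))⁻¹ * ∫ v : V3, S.f t θ v * (Real.exp (-2 * S.U t θ)
      * (1 + 2 * Real.exp (-2 * S.U t θ) * v.2.1 ^ 2) / S.ρ t θ v) := by
    rw [← integral_const_mul]
    refine integral_congr_ae (Eventually.of_forall fun v => ?_)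
    have := S.ρ_pos t θ v
    field_simp
  rw [e1]
  unfold srcU
  generalize (∫ v : V3, S.f t θ v * (Real.exp (-2 * S.U t θ)
      * (1 + 2 * Real.exp (-2 * S.U t θ) * v.2.1 ^ 2) / S.ρ t θ v)) = I
  field_simp
  ring

lemma pt_pt_A (ht : t ∈ Ioc S.tp S.ti) (θ : ℝ) : pt (pt S.A) t θ
    = S.α t θ * pθ (pθ S.A) t θ + pt S.A t θ / t - S.κ t θ / 2 * pt S.A t θ
      + pθ S.α t θ * pθ S.A t θ / 2
      - 4 * (pt S.A t θ * pt S.U t θ - S.α t θ * pθ S.A t θ * pθ S.U t θ)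
      + S.srcA t θ := by
  rw [S.hatt t ht θ, integral_div_abs_v0 ht, exp_sub_four, pt_α ht,
    show Real.sqrt (S.α t θ) = S.s t θ from rfl]
  have hα := S.hαpos t ht θ
  have hs := s_pos ht θ
  have htp := time_pos ht
  have e1 : ∫ v : V3, S.f t θ v * v.2.1 * (v.2.2 - S.A t θ * v.2.1) / S.ρ t θ v
      = ∫ v : V3, S.f t θ v * (v.2.1 * (v.2.2 - S.A t θ * v.2.1) / S.ρ t θ v) :=
    integral_congr_ae (Eventually.of_forall fun v => by ring)
  rw [e1]
  unfold srcA
  generalize (∫ v : V3, S.f t θ v * (v.2.1 * (v.2.2 - S.A t θ * v.2.1) / S.ρ t θ v)) = I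
  field_simp
  ring

lemma srcU_nonneg (ht : t ∈ Ioc S.tp S.ti) (θ : ℝ) : 0 ≤ S.srcU t θ := by
  have h1 := (S.hαpos t ht θ).le
  have h2 := (time_pos ht).le
  have h3 := integral_f_nonneg ht θ (H := fun v : V3 => Real.exp (-2 * S.U t θ)
      * (1 + 2 * Real.exp (-2 * S.U t θ) * v.2.1 ^ 2) / S.ρ t θ v)
      (fun v => by have := S.ρ_pos t θ v; positivity)
  unfold srcU
  positivity

lemma srcU_le (ht : t ∈ Ioc S.tp S.ti) (θ : ℝ) : S.srcU t θ ≤ S.κ t θ / (2 * t) := by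
  have h1 := (S.hαpos t ht θ).le
  have h2 := time_pos ht
  have h3 : ∫ v : V3, S.f t θ v * (Real.exp (-2 * S.U t θ)
      * (1 + 2 * Real.exp (-2 * S.U t θ) * v.2.1 ^ 2) / S.ρ t θ v)
      ≤ ∫ v : V3, S.f t θ v * (2 * (S.w v.2.1 v.2.2 t θ / S.ρ t θ v)) := by
    refine integral_f_mono ht θ (continuous_div_ρ ht θ (by fun_prop))
      (continuous_const.mul (continuous_div_ρ ht θ (continuous_w_v ht θ))) fun v _ => ?_
    rw [← mul_div_assoc]
    refine div_le_div_of_nonneg_right ?_ (S.ρ_pos t θ v).le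
    have e : Real.exp (-4 * S.U t θ) = Real.exp (-2 * S.U t θ) * Real.exp (-2 * S.U t θ) := by
      rw [← Real.exp_add]; congr 1; ring
    have h4 : 0 ≤ (t ^ 2)⁻¹ * (v.2.2 - S.A t θ * v.2.1) ^ 2 := by positivity
    have := Real.exp_pos (-2 * S.U t θ)
    unfold w
    rw [e]
    linarith
  have h4 : ∫ v : V3, S.f t θ v * (2 * (S.w v.2.1 v.2.2 t θ / S.ρ t θ v))
      = 2 * ∫ v : V3, S.f t θ v * (S.w v.2.1 v.2.2 t θ / S.ρ t θ v) := by
    rw [← integral_const_mul]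
    exact integral_congr_ae (Eventually.of_forall fun v => by ring)
  have h5 : 0 ≤ (S.K t θ - S.A t θ * S.J t θ) ^ 2 / t ^ 3 := by positivity
  rw [h4] at h3
  have e : S.κ t θ / (2 * t) = S.α t θ * Real.exp (2 * S.ν t θ) / (2 * t)
      * (Real.exp (-4 * S.U t θ) * S.J t θ ^ 2 / t
    + (S.K t θ - S.A t θ * S.J t θ) ^ 2 / t ^ 3
    + 2 * ∫ v : V3, S.f t θ v * (S.w v.2.1 v.2.2 t θ / S.ρ t θ v)) := by
    unfold κ; ring
  rw [e]
  unfold srcU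
  refine mul_le_mul_of_nonneg_left ?_ (by positivity)
  linarith

lemma abs_srcA_le (ht : t ∈ Ioc S.tp S.ti) (θ : ℝ) :
    Real.exp (2 * S.U t θ) / (2 * t) * |S.srcA t θ| ≤ S.κ t θ / t := by
  have h1 := (S.hαpos t ht θ).le
  have h2 := time_pos ht
  set E := Real.exp (-2 * S.U t θ) with hE
  have hE0 : 0 < E := Real.exp_pos _
  have e4 : Real.exp (-4 * S.U t θ) = E * E := by
    rw [hE, ← Real.exp_add]; congr 1; ring
  have e2 : Real.exp (2 * S.U t θ) = E⁻¹ := by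
    rw [hE, ← Real.exp_neg]; congr 1; ring
  have h3 : |∫ v : V3, S.f t θ v * (v.2.1 * (v.2.2 - S.A t θ * v.2.1) / S.ρ t θ v)|
      ≤ ∫ v : V3, S.f t θ v * (E⁻¹ * t * (S.w v.2.1 v.2.2 t θ / S.ρ t θ v)) := by
    refine abs_integral_f_le ht θ (continuous_div_ρ ht θ (by fun_prop))
      (continuous_const.mul (continuous_div_ρ ht θ (continuous_w_v ht θ))) fun v _ => ?_
    rw [← mul_div_assoc, abs_div, abs_of_pos (S.ρ_pos t θ v)]
    refine div_le_div_of_nonneg_right ?_ (S.ρ_pos t θ v).le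
    unfold w
    rw [e4, ← hE]
    set a := v.2.1
    set b := v.2.2 - S.A t θ * v.2.1
    have h4 : |a * b| = E⁻¹ * t * |(E * a) * (b / t)| := by
      rw [← abs_of_pos (mul_pos (inv_pos.2 hE0) h2), ← abs_mul]
      congr 1
      field_simp
    rw [h4]
    refine mul_le_mul_of_nonneg_left ?_ (by positivity)
    have h5 : |(E * a) * (b / t)| ≤ (E * a) ^ 2 + (b / t) ^ 2 := by
      rw [abs_le]
      constructor <;> nlinarith [sq_nonneg (E * a + b / t), sq_nonneg (E * a - b / t)]
    refine h5.trans ?_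
    have e5 : (b / t) ^ 2 = (t ^ 2)⁻¹ * b ^ 2 := by field_simp
    rw [e5]
    linarith
  have h4 : ∫ v : V3, S.f t θ v * (E⁻¹ * t * (S.w v.2.1 v.2.2 t θ / S.ρ t θ v))
      = E⁻¹ * t * ∫ v : V3, S.f t θ v * (S.w v.2.1 v.2.2 t θ / S.ρ t θ v) := by
    rw [← integral_const_mul]
    exact integral_congr_ae (Eventually.of_forall fun v => by ring)
  rw [h4] at h3
  have hw := integral_f_nonneg ht θ (fun v => (div_pos (S.w_pos (t := t) θ v.2.1 v.2.2)
    (S.ρ_pos t θ v)).le)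
  unfold srcA κ
  rw [e4, e2]
  set I := ∫ v : V3, S.f t θ v * (v.2.1 * (v.2.2 - S.A t θ * v.2.1) / S.ρ t θ v)
  set W := ∫ v : V3, S.f t θ v * (S.w v.2.1 v.2.2 t θ / S.ρ t θ v)
  set P := S.α t θ * Real.exp (2 * S.ν t θ) with hP
  have hP0 : 0 ≤ P := by positivity
  set j := S.J t θ
  set k := S.K t θ - S.A t θ * j
  have h5 : |j * k / t + 2 * I| ≤ E⁻¹ * t * (E * E * j ^ 2 / t + k ^ 2 / t ^ 3 + 2 * W) := by
    have h6 : |j * k / t| ≤ E⁻¹ * t * (E * E * j ^ 2 / t + k ^ 2 / t ^ 3) := by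
      have h7 : |j * k / t| = E⁻¹ * |(E * j) * (k / t)| := by
        rw [← abs_of_pos (inv_pos.2 hE0), ← abs_mul]
        congr 1
        field_simp
      have h8 : |(E * j) * (k / t)| ≤ (E * j) ^ 2 + (k / t) ^ 2 := by
        rw [abs_le]
        constructor <;> nlinarith [sq_nonneg (E * j + k / t), sq_nonneg (E * j - k / t)]
      rw [h7, mul_assoc E⁻¹ t]
      refine mul_le_mul_of_nonneg_left (h8.trans (le_of_eq ?_)) (by positivity)
      field_simp
    refine (abs_add_le _ _).trans ?_
    rw [abs_mul, abs_two]
    linarith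
  have h6 : |P / t * (E * E) * (j * k / t + 2 * I)| = P / t * (E * E) * |j * k / t + 2 * I| := by
    rw [abs_mul, abs_of_nonneg (by positivity)]
  rw [h6]
  calc E⁻¹ / (2 * t) * (P / t * (E * E) * |j * k / t + 2 * I|)
      ≤ E⁻¹ / (2 * t) * (P / t * (E * E)
        * (E⁻¹ * t * (E * E * j ^ 2 / t + k ^ 2 / t ^ 3 + 2 * W))) := by gcongr
    _ = P * (E * E * j ^ 2 / t + k ^ 2 / t ^ 3 + 2 * W) / t / 2 := by field_simp
    _ ≤ P * (E * E * j ^ 2 / t + k ^ 2 / t ^ 3 + 2 * W) / t :=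
        half_le_self (by positivity)

lemma smUs (S : EVSol) (σ : ℝ) : SmOn (Ioo S.tp S.ti) (S.Us σ) := by
  have h1 := (smU (S := S)).mono Ioo_subset_Ioc_self
  have h2 := (sms (S := S)).mono Ioo_subset_Ioc_self
  exact (h1.dt isOpen_Ioo).add ((h2.mul (h1.dθ isOpen_Ioo)).const_mul σ)

lemma smAs (S : EVSol) (σ : ℝ) : SmOn (Ioo S.tp S.ti) (S.As σ) := by
  have h1 := (smA (S := S)).mono Ioo_subset_Ioc_self
  have h2 := (sms (S := S)).mono Ioo_subset_Ioc_self
  exact (h1.dt isOpen_Ioo).add ((h2.mul (h1.dθ isOpen_Ioo)).const_mul σ)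

lemma smhh (S : EVSol) (σ : ℝ) : SmOn (Ioo S.tp S.ti) (S.hh σ) := by
  have h1 := (smU (S := S)).mono Ioo_subset_Ioc_self
  exact ((S.smUs σ).pow 2).add ((((h1.const_mul 4).exp).div ((SmOn.time.pow 2).const_mul 4)
    fun t ht θ => by have := time_pos (mem_of_Ioo ht); positivity).mul ((S.smAs σ).pow 2))

lemma perhh (S : EVSol) (σ : ℝ) : Per (S.hh σ) := fun t θ => by
  unfold hh Us As
  rw [Per.dθ (G := S.U) S.hUper, Per.dt (G := S.U) S.hUper, Per.dθ (G := S.A) S.hAper,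
    Per.dt (G := S.A) S.hAper, S.hUper, pers]

lemma hasDerivAt_Us (ht : t ∈ Ioo S.tp S.ti) (θ : ℝ) {σ : ℝ} (hσ : σ ^ 2 = 1) :
    HasDerivAt (fun r => S.Us σ (t + r) (θ + (-σ * S.s t θ) * r))
      (-(pt S.U t θ / t) - S.κ t θ / 2 * S.Us σ t θ
        + Real.exp (4 * S.U t θ) / (2 * t ^ 2) * (S.As σ t θ * S.As (-σ) t θ)
        + S.srcU t θ) 0 := by
  have ht' := mem_of_Ioo ht
  have h1 := (smU (S := S)).mono Ioo_subset_Ioc_self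
  have h2 := (sms (S := S)).mono Ioo_subset_Ioc_self
  have d1 := (h1.dt isOpen_Ioo).hasDerivAt_line isOpen_Ioo ht (θ := θ) (-σ * S.s t θ)
  have d2 := (h1.dθ isOpen_Ioo).hasDerivAt_line isOpen_Ioo ht (θ := θ) (-σ * S.s t θ)
  have d3 := h2.hasDerivAt_line isOpen_Ioo ht (θ := θ) (-σ * S.s t θ)
  refine (d1.add ((d3.mul d2).const_mul σ)).congr_deriv ?_
  have hs := s_pos ht' θ
  rw [pt_pt_U ht', h1.pθ_pt isOpen_Ioo ht, pt_s ht, pθ_s ht, pt_α ht']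
  unfold Us As
  have e : S.α t θ = S.s t θ ^ 2 := (s_sq ht' θ).symm
  rw [e]
  simp only [add_zero, mul_zero]
  have htp := time_pos ht'
  field_simp
  linear_combination (-(2 * t ^ 2 * S.s t θ ^ 2 * pθ (pθ S.U) t θ + t ^ 2 * pθ S.α t θ * pθ S.U t θ
    - S.s t θ ^ 2 * Real.exp (4 * S.U t θ) * pθ S.A t θ ^ 2)) * hσ

lemma hasDerivAt_As (ht : t ∈ Ioo S.tp S.ti) (θ : ℝ) {σ : ℝ} (hσ : σ ^ 2 = 1) :
    HasDerivAt (fun r => S.As σ (t + r) (θ + (-σ * S.s t θ) * r))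
      (pt S.A t θ / t - S.κ t θ / 2 * S.As σ t θ
        - 2 * (S.As σ t θ * S.Us (-σ) t θ + S.As (-σ) t θ * S.Us σ t θ)
        + S.srcA t θ) 0 := by
  have ht' := mem_of_Ioo ht
  have h1 := (smA (S := S)).mono Ioo_subset_Ioc_self
  have h2 := (sms (S := S)).mono Ioo_subset_Ioc_self
  have d1 := (h1.dt isOpen_Ioo).hasDerivAt_line isOpen_Ioo ht (θ := θ) (-σ * S.s t θ)
  have d2 := (h1.dθ isOpen_Ioo).hasDerivAt_line isOpen_Ioo ht (θ := θ) (-σ * S.s t θ)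
  have d3 := h2.hasDerivAt_line isOpen_Ioo ht (θ := θ) (-σ * S.s t θ)
  refine (d1.add ((d3.mul d2).const_mul σ)).congr_deriv ?_
  have hs := s_pos ht' θ
  rw [pt_pt_A ht', h1.pθ_pt isOpen_Ioo ht, pt_s ht, pθ_s ht, pt_α ht']
  unfold Us As
  have e : S.α t θ = S.s t θ ^ 2 := (s_sq ht' θ).symm
  rw [e]
  simp only [add_zero, mul_zero]
  have htp := time_pos ht'
  field_simp
  linear_combination (-(2 * t * S.s t θ ^ 2 * pθ (pθ S.A) t θ + t * pθ S.α t θ * pθ S.A t θ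
    + 8 * t * S.s t θ ^ 2 * pθ S.A t θ * pθ S.U t θ)) * hσ

/-- The evolution of the energy density along null directions, where all cubic terms cancel. -/
lemma hasDerivAt_hh (ht : t ∈ Ioo S.tp S.ti) (θ : ℝ) {σ : ℝ} (hσ : σ ^ 2 = 1) :
    HasDerivAt (fun r => S.hh σ (t + r) (θ + (-σ * S.s t θ) * r))
      (2 * S.Us σ t θ * (-(pt S.U t θ / t) + S.srcU t θ)
        + Real.exp (4 * S.U t θ) / (4 * t ^ 2)
          * (2 * S.As σ t θ * (pt S.A t θ / t + S.srcA t θ) - 2 / t * S.As σ t θ ^ 2)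
        - S.κ t θ * S.hh σ t θ) 0 := by
  have ht' := mem_of_Ioo ht
  have htp := time_pos ht'
  have h1 := (smU (S := S)).mono Ioo_subset_Ioc_self
  have d0 := h1.hasDerivAt_line isOpen_Ioo ht (θ := θ) (-σ * S.s t θ)
  have d1 := hasDerivAt_Us ht θ hσ
  have d2 := hasDerivAt_As ht θ hσ
  have d3 : HasDerivAt (fun r : ℝ => t + r) 1 0 := (hasDerivAt_id (0 : ℝ)).const_add t
  have d4 := ((d0.const_mul 4).exp).div ((d3.pow 2).const_mul 4) (by simpa using htp.ne')
  refine ((d1.pow 2).add (d4.mul (d2.pow 2))).congr_deriv ?_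
  simp only [Pi.pow_apply, Pi.div_apply, add_zero, mul_zero, Nat.cast_ofNat, Nat.add_one_sub_one, pow_one, mul_one]
  have e : pt S.U t θ + -σ * S.s t θ * pθ S.U t θ = S.Us (-σ) t θ := by unfold Us; ring
  rw [e]
  unfold hh
  generalize S.Us σ t θ = u
  generalize S.Us (-σ) t θ = u'
  generalize S.As σ t θ = a
  generalize S.As (-σ) t θ = a'
  field_simp
  ring

lemma exists_deriv_hh_ge (S : EVSol) : ∃ k, 0 < k ∧ ∀ t ∈ Ioo S.tp S.ti, ∀ θ y σ, 1 ≤ y →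
    S.hh 1 t θ ≤ 2 * y → S.hh (-1) t θ ≤ 2 * y → (σ = 1 ∨ σ = -1) →
    ∃ a d, -(k * (1 + S.κ t θ) * y) ≤ d ∧
      HasDerivAt (fun r => S.hh σ (t + r) (θ + a * r)) d 0 := by
  have htp0 := S.htp
  refine ⟨16 / S.tp + 2, by positivity, fun t ht θ y σ hy hp hm hσ => ?_⟩
  have ht' := mem_of_Ioo ht
  have htp := time_pos ht'
  have hσ2 : σ ^ 2 = 1 := by rcases hσ with rfl | rfl <;> norm_num
  refine ⟨_, _, ?_, hasDerivAt_hh ht θ hσ2⟩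
  have hσh : S.hh σ t θ ≤ 2 * y := by rcases hσ with rfl | rfl <;> assumption
  have hκ := κ_nonneg ht' θ
  set κ := S.κ t θ
  have hti : t⁻¹ ≤ S.tp⁻¹ := inv_anti₀ htp0 ht.1.le
  set m := Real.exp (2 * S.U t θ) / (2 * t) with hmdef
  have hm0 : 0 < m := by positivity
  have hm2 : Real.exp (4 * S.U t θ) / (4 * t ^ 2) = m ^ 2 := by
    rw [hmdef, div_pow, ← Real.exp_nat_mul]
    congr 1
    · congr 1; push_cast; ring
    · ring
  have sU0 := srcU_nonneg ht' θ
  have sU := srcU_le ht' θ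
  have sA := abs_srcA_le ht' θ
  rw [← hmdef] at sA
  have hb : ∀ x, x ^ 2 ≤ 2 * y → |x| ≤ 2 * y := fun x hx =>
    abs_le_of_sq_le_sq (by nlinarith) (by linarith)
  have eU : pt S.U t θ = (S.Us 1 t θ + S.Us (-1) t θ) / 2 := by unfold Us; ring
  have eA : pt S.A t θ = (S.As 1 t θ + S.As (-1) t θ) / 2 := by unfold As; ring
  have bU : pt S.U t θ ^ 2 ≤ 2 * y := by
    rw [eU]
    unfold hh at hp hm
    rw [hm2] at hp hm
    nlinarith [sq_nonneg (S.Us 1 t θ - S.Us (-1) t θ), sq_nonneg (m * S.As 1 t θ),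
      sq_nonneg (m * S.As (-1) t θ)]
  have bA : (m * pt S.A t θ) ^ 2 ≤ 2 * y := by
    rw [eA]
    unfold hh at hp hm
    rw [hm2] at hp hm
    nlinarith [sq_nonneg (m * S.As 1 t θ - m * S.As (-1) t θ), sq_nonneg (S.Us 1 t θ),
      sq_nonneg (S.Us (-1) t θ)]
  have e0 : S.hh σ t θ = S.Us σ t θ ^ 2 + (m * S.As σ t θ) ^ 2 := by unfold hh; rw [hm2]; ring
  have bu : S.Us σ t θ ^ 2 ≤ 2 * y := by linarith [sq_nonneg (m * S.As σ t θ)]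
  have ba : (m * S.As σ t θ) ^ 2 ≤ 2 * y := by linarith [sq_nonneg (S.Us σ t θ)]
  have hti0 : 0 < t⁻¹ := inv_pos.2 htp
  have hy0 : 0 < y := by linarith
  have t1 : -(4 * y * t⁻¹) ≤ -(2 * (S.Us σ t θ * pt S.U t θ)) * t⁻¹ := by
    rw [← neg_mul]
    refine mul_le_mul_of_nonneg_right ?_ hti0.le
    linarith [sq_nonneg (S.Us σ t θ - pt S.U t θ), sub_sq (S.Us σ t θ) (pt S.U t θ)]
  have t2 : -(4 * y * t⁻¹) ≤ 2 * ((m * S.As σ t θ) * (m * pt S.A t θ)) * t⁻¹ := by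
    rw [← neg_mul]
    refine mul_le_mul_of_nonneg_right ?_ hti0.le
    linarith [sq_nonneg (m * S.As σ t θ + m * pt S.A t θ),
      add_sq (m * S.As σ t θ) (m * pt S.A t θ)]
  have t3 : -(4 * y * t⁻¹) ≤ -(2 * t⁻¹ * (m * S.As σ t θ) ^ 2) := by
    linarith [mul_le_mul_of_nonneg_left ba hti0.le]
  have t4 : -(2 * y * κ * t⁻¹) ≤ 2 * (S.Us σ t θ * S.srcU t θ) := by
    have h1 : |S.Us σ t θ * S.srcU t θ| ≤ 2 * y * (κ / (2 * t)) := by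
      rw [abs_mul, abs_of_nonneg sU0]
      exact mul_le_mul (hb _ bu) sU sU0 (by linarith)
    have h2 := (abs_le.1 h1).1
    have h3 : 2 * y * (κ / (2 * t)) = y * κ * t⁻¹ := by field_simp
    linarith
  have t5 : -(4 * y * κ * t⁻¹) ≤ 2 * ((m * S.As σ t θ) * (m * S.srcA t θ)) := by
    have h1 : |(m * S.As σ t θ) * (m * S.srcA t θ)| ≤ 2 * y * (κ / t) := by
      rw [abs_mul, abs_mul m (S.srcA t θ), abs_of_pos hm0]
      exact mul_le_mul (hb _ ba) sA (by positivity) (by linarith)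
    have h2 := (abs_le.1 h1).1
    have h3 : 2 * y * (κ / t) = 2 * (y * κ * t⁻¹) := by field_simp
    linarith
  have t6 : κ * S.hh σ t θ ≤ 2 * y * κ := by
    linarith [mul_le_mul_of_nonneg_left hσh hκ]
  have t7 : y * κ * t⁻¹ ≤ y * κ * S.tp⁻¹ := mul_le_mul_of_nonneg_left hti (by positivity)
  have t8 : y * t⁻¹ ≤ y * S.tp⁻¹ := mul_le_mul_of_nonneg_left hti hy0.le
  have t9 : 0 ≤ y * κ * S.tp⁻¹ := by positivity
  have t10 : 0 ≤ y * S.tp⁻¹ := by positivity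
  have goal_eq : 2 * S.Us σ t θ * (-(pt S.U t θ / t) + S.srcU t θ)
        + Real.exp (4 * S.U t θ) / (4 * t ^ 2)
          * (2 * S.As σ t θ * (pt S.A t θ / t + S.srcA t θ) - 2 / t * S.As σ t θ ^ 2)
        - κ * S.hh σ t θ
      = -(2 * (S.Us σ t θ * pt S.U t θ)) * t⁻¹ + 2 * ((m * S.As σ t θ) * (m * pt S.A t θ)) * t⁻¹
        + -(2 * t⁻¹ * (m * S.As σ t θ) ^ 2) + 2 * (S.Us σ t θ * S.srcU t θ)
        + 2 * ((m * S.As σ t θ) * (m * S.srcA t θ)) - κ * S.hh σ t θ := by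
    rw [hm2]; ring
  rw [goal_eq]
  have e1 : -((16 / S.tp + 2) * (1 + κ) * y) = -(16 * (y * S.tp⁻¹)) - 16 * (y * κ * S.tp⁻¹)
      - 2 * y - 2 * y * κ := by ring
  rw [e1]
  linarith

end EVSol

namespace EVSol

variable {S : EVSol} {t θ : ℝ} {C : ℝ}

lemma Bound.abs_derivs_le (hB : S.Bound C) (ht : t ∈ Ioc S.tp S.tm) {Y : ℝ}
    (h1 : S.hh 1 t θ ≤ Y) (h2 : S.hh (-1) t θ ≤ Y) :
    |pt S.U t θ| ≤ Real.sqrt Y ∧ S.s t θ * |pθ S.U t θ| ≤ Real.sqrt Y ∧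
    |pt S.A t θ| ≤ 2 * S.tm * Real.exp (2 * C) * Real.sqrt Y ∧
    S.s t θ * |pθ S.A t θ| ≤ 2 * S.tm * Real.exp (2 * C) * Real.sqrt Y := by
  have ht' := mem_of_Ioo (mem_Ioo_of_tm ht)
  have htp := time_pos ht'
  have hs := s_pos ht' θ
  set m := Real.exp (2 * S.U t θ) / (2 * t) with hmdef
  have hm0 : 0 < m := by positivity
  have hm2 : Real.exp (4 * S.U t θ) / (4 * t ^ 2) = m ^ 2 := by
    rw [hmdef, div_pow, ← Real.exp_nat_mul]
    congr 1
    · congr 1; push_cast; ring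
    · ring
  unfold hh at h1 h2
  rw [hm2] at h1 h2
  set a := S.Us 1 t θ with ha
  set b := S.Us (-1) t θ with hb
  set c := m * S.As 1 t θ with hc
  set d := m * S.As (-1) t θ with hd
  have h1' : a ^ 2 + c ^ 2 ≤ Y := by rw [hc]; linarith
  have h2' : b ^ 2 + d ^ 2 ≤ Y := by rw [hd]; linarith
  have key : ∀ x y z w : ℝ, x ^ 2 + z ^ 2 ≤ Y → y ^ 2 + w ^ 2 ≤ Y →
      |(x + y) / 2| ≤ Real.sqrt Y ∧ |(x - y) / 2| ≤ Real.sqrt Y := fun x y z w h h' => by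
    have hx := Real.abs_le_sqrt (show x ^ 2 ≤ Y by linarith [sq_nonneg z])
    have hy := Real.abs_le_sqrt (show y ^ 2 ≤ Y by linarith [sq_nonneg w])
    rw [abs_le] at hx hy
    constructor <;> rw [abs_le] <;> constructor <;> linarith
  have kU := key a b c d h1' h2'
  have kA := key c d a b (by linarith) (by linarith)
  have eA : ∀ x, m * |x| ≤ Real.sqrt Y → |x| ≤ 2 * S.tm * Real.exp (2 * C) * Real.sqrt Y := by
    intro x hx
    have e : |x| = 2 * t * Real.exp (-(2 * S.U t θ)) * (m * |x|) := by
      rw [hmdef, Real.exp_neg]; field_simp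
    rw [e]
    have htm := htp.le.trans ht.2
    have h3 : Real.exp (-(2 * S.U t θ)) ≤ Real.exp (2 * C) :=
      Real.exp_le_exp.2 (by linarith [(abs_le.1 (hB.U t ht θ)).1])
    have := ht.2
    gcongr
  refine ⟨?_, ?_, eA _ ?_, ?_⟩
  · convert kU.1 using 2; rw [ha, hb]; unfold Us; ring
  · rw [show S.s t θ * |pθ S.U t θ| = |S.s t θ * pθ S.U t θ| by rw [abs_mul, abs_of_pos hs]]
    convert kU.2 using 2; rw [ha, hb]; unfold Us; ring
  · rw [show m * |pt S.A t θ| = |m * pt S.A t θ| by rw [abs_mul, abs_of_pos hm0]]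
    convert kA.1 using 2; rw [hc, hd]; unfold As; ring
  · rw [show S.s t θ * |pθ S.A t θ| = |S.s t θ * pθ S.A t θ| by rw [abs_mul, abs_of_pos hs]]
    refine eA _ ?_
    rw [show m * |S.s t θ * pθ S.A t θ| = |m * (S.s t θ * pθ S.A t θ)| by
      rw [abs_mul m, abs_of_pos hm0]]
    convert kA.2 using 2; rw [hc, hd]; unfold As; ring

/-- The evolution of the rescaled momentum along characteristics. -/
lemma hasDerivAt_momentum (ht : t ∈ Ioo S.tp S.ti) (θ : ℝ) (v : V3) :
    HasDerivAt (fun r => S.α (t + r) (θ + S.aa t θ v * r) * (v.1 + S.bb t θ v * r) ^ 2)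
      (-(S.κ t θ * (S.α t θ * v.1 ^ 2)) + 2 * (S.s t θ * v.1)
        * (-(S.α t θ * Real.exp (2 * S.ν t θ) / S.ρ t θ v
          * (S.bθ t θ * S.w v.2.1 v.2.2 t θ + pθ (S.w v.2.1 v.2.2) t θ / 2))
          + S.s t θ * S.frc v.2.1 v.2.2 t θ)) 0 := by
  have ht' := mem_of_Ioo ht
  have h1 := (smα (S := S)).mono Ioo_subset_Ioc_self
  have d1 := h1.hasDerivAt_line isOpen_Ioo ht (θ := θ) (S.aa t θ v)
  have d2 : HasDerivAt (fun r => v.1 + S.bb t θ v * r) (S.bb t θ v) 0 := by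
    simpa using ((hasDerivAt_id (0 : ℝ)).const_mul (S.bb t θ v)).const_add v.1
  refine (d1.mul (d2.pow 2)).congr_deriv ?_
  simp only [Pi.pow_apply, add_zero, mul_zero, Nat.cast_ofNat, Nat.add_one_sub_one, pow_one]
  rw [pt_α ht']
  unfold bb aa bθ
  rw [pθ_g ht, pθ_s ht]
  have hρ := S.ρ_pos t θ v
  have hρ2 := S.ρ_sq t θ v
  have hs := s_pos ht' θ
  unfold g at hρ2
  rw [← s_sq ht' θ]
  set s := S.s t θ
  set ρ := S.ρ t θ v
  field_simp
  linear_combination (-(v.1 * pθ S.α t θ)) * hρ2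

set_option maxHeartbeats 800000 in
lemma Bound.exists_deriv_momentum_le (hB : S.Bound C) {k : ℝ} (hk : 0 ≤ k) :
    ∃ k', 0 < k' ∧ ∀ t ∈ Ioc S.tp S.tm, ∀ θ (v : V3) y, 1 ≤ y → S.α t θ * v.1 ^ 2 = y →
    |v.2.1| ≤ C → |v.2.2| ≤ C → S.hh 1 t θ ≤ 2 * y → S.hh (-1) t θ ≤ 2 * y →
    S.s t θ * |S.bθ t θ| ≤ k * y → ∃ d, |d| ≤ k' * (1 + S.κ t θ) * y ∧
      HasDerivAt (fun r => S.α (t + r) (θ + S.aa t θ v * r) * (v.1 + S.bb t θ v * r) ^ 2) d 0 := by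
  have hC := hB.one_le
  have htp0 := S.htp
  have htm0 : 0 < S.tm := htp0.trans S.tm_mem.1
  obtain ⟨B1, hB1, hw⟩ := S.exists_w_le (t2 := S.tm) htp0 C C
  obtain ⟨B2, hB2, hpw⟩ := S.exists_pθ_w_le (t2 := S.tm) htp0 C C
  obtain ⟨B3, hB3, hfr⟩ := S.exists_frc_le (t2 := S.tm) htp0 C C
  set M := 2 * S.tm * Real.exp (2 * C) with hM
  have hM0 : 0 ≤ M := by positivity
  refine ⟨1 + 2 * (C ^ 2 * (k * B1 + B2 * (1 + M) * 2 / 2 + B3)), by positivity,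
    fun t ht θ v y hy hα h2 h3 hp hm hb => ?_⟩
  have hto := mem_Ioo_of_tm ht
  have ht' := mem_of_Ioo hto
  refine ⟨_, ?_, hasDerivAt_momentum hto θ v⟩
  have htc : t ∈ Icc S.tp S.tm := Ioc_subset_Icc_self ht
  have hs := s_pos ht' θ
  have hρ := S.ρ_pos t θ v
  have hκ := κ_nonneg ht' θ
  obtain ⟨-, dU, -, dA⟩ := hB.abs_derivs_le ht hp hm
  rw [← hM] at dA
  have hw := hw t htc θ v.2.1 v.2.2 (hB.U t ht θ) (hB.A t ht θ) h2 h3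
  have hw0 := S.w_pos (t := t) θ v.2.1 v.2.2
  have hpw := hpw t htc hto θ v.2.1 v.2.2 (hB.U t ht θ) (hB.A t ht θ) h2 h3
  have hfr := hfr t htc hto θ v.2.1 v.2.2 (hB.U t ht θ) (hB.A t ht θ) (hB.J t ht θ)
    (hB.K t ht θ) h2 h3
  have hP := hB.α_mul_exp_le ht θ
  have hP0 : 0 ≤ S.α t θ * Real.exp (2 * S.ν t θ) :=
    mul_nonneg (S.hαpos t ht' θ).le (Real.exp_pos _).le
  have hfr' : S.s t θ * |S.frc v.2.1 v.2.2 t θ| ≤ C ^ 2 * B3 := by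
    refine (mul_le_mul_of_nonneg_left hfr hs.le).trans ?_
    calc S.s t θ * (S.s t θ * Real.exp (2 * S.ν t θ) * B3)
        = S.α t θ * Real.exp (2 * S.ν t θ) * B3 := by rw [← s_sq ht']; ring
      _ ≤ _ := mul_le_mul_of_nonneg_right hP hB3
  set r := Real.sqrt y with hr
  have hr1 : 1 ≤ r := Real.one_le_sqrt.2 hy
  have hr2 : r ^ 2 = y := Real.sq_sqrt (by linarith)
  have hsv : |S.s t θ * v.1| = r := by
    rw [hr, ← hα, ← s_sq ht', ← mul_pow, Real.sqrt_sq_eq_abs]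
  have hsρ : r ≤ S.s t θ * S.ρ t θ v := by
    rw [← hsv, abs_mul, abs_of_pos hs]
    exact mul_le_mul_of_nonneg_left (S.abs_v1_le t θ v) hs.le
  have hY : Real.sqrt (2 * y) ≤ 2 * r :=
    Real.sqrt_le_iff.2 ⟨by linarith, by rw [mul_pow, hr2]; linarith⟩
  have hq : S.s t θ * |S.bθ t θ * S.w v.2.1 v.2.2 t θ + pθ (S.w v.2.1 v.2.2) t θ / 2|
      ≤ (k * B1 + B2 * (1 + M) * 2 / 2) * y := by
    have a1 : S.s t θ * |S.bθ t θ * S.w v.2.1 v.2.2 t θ| ≤ k * y * B1 := by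
      rw [abs_mul, abs_of_pos hw0, ← mul_assoc]
      exact mul_le_mul hb hw hw0.le (by nlinarith)
    have a2 : S.s t θ * |pθ (S.w v.2.1 v.2.2) t θ / 2| ≤ B2 * (1 + M) * 2 / 2 * y := by
      rw [abs_div, abs_two]
      have a3 : S.s t θ * (|pθ S.U t θ| + |pθ S.A t θ|) ≤ (1 + M) * (2 * y) := by
        have a4 : r ≤ y := by nlinarith
        have a5 : S.s t θ * (|pθ S.U t θ| + |pθ S.A t θ|) ≤ (1 + M) * Real.sqrt (2 * y) := by
          linarith
        refine a5.trans (mul_le_mul_of_nonneg_left (by linarith) (by linarith))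
      have a6 := mul_le_mul_of_nonneg_left hpw hs.le
      have a7 := mul_le_mul_of_nonneg_left a3 hB2
      linarith
    have a8 := mul_le_mul_of_nonneg_left
      (abs_add_le (S.bθ t θ * S.w v.2.1 v.2.2 t θ) (pθ (S.w v.2.1 v.2.2) t θ / 2)) hs.le
    linarith
  set q := S.bθ t θ * S.w v.2.1 v.2.2 t θ + pθ (S.w v.2.1 v.2.2) t θ / 2
  set L := k * B1 + B2 * (1 + M) * 2 / 2
  have hL : 0 ≤ L := by positivity
  set P := S.α t θ * Real.exp (2 * S.ν t θ)
  have hPq : |P / S.ρ t θ v * q| ≤ C ^ 2 * L * r := by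
    rw [abs_mul, abs_of_nonneg (by positivity), div_mul_eq_mul_div, div_le_iff₀ hρ]
    have a1 : P * (S.s t θ * |q|) ≤ C ^ 2 * (L * y) :=
      mul_le_mul hP hq (by positivity) (by positivity)
    have a2 : S.s t θ * (P * |q|) ≤ S.s t θ * (C ^ 2 * L * r * S.ρ t θ v) := by
      have a3 : C ^ 2 * L * r * r ≤ C ^ 2 * L * r * (S.s t θ * S.ρ t θ v) :=
        mul_le_mul_of_nonneg_left hsρ (by positivity)
      have a4 : C ^ 2 * (L * y) = C ^ 2 * L * r * r := by rw [← hr2]; ring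
      linarith
    exact le_of_mul_le_mul_left a2 hs
  have hin : |-(P / S.ρ t θ v * q) + S.s t θ * S.frc v.2.1 v.2.2 t θ| ≤ C ^ 2 * (L + B3) * r := by
    refine (abs_add_le _ _).trans ?_
    rw [abs_neg, abs_mul (S.s t θ), abs_of_pos hs]
    have : C ^ 2 * B3 * 1 ≤ C ^ 2 * B3 * r := mul_le_mul_of_nonneg_left hr1 (by positivity)
    linarith
  refine (abs_add_le _ _).trans ?_
  rw [abs_neg, abs_mul, abs_mul (2 * _), abs_mul 2, hsv, abs_two, hα, abs_of_nonneg hκ,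
    abs_of_nonneg (by linarith : (0 : ℝ) ≤ y)]
  have h9 := mul_le_mul_of_nonneg_left hin (show 0 ≤ 2 * r by linarith)
  have h10 : 2 * r * (C ^ 2 * (L + B3) * r) = 2 * (C ^ 2 * (L + B3)) * y := by rw [← hr2]; ring
  rw [h10] at h9
  have h11 : 0 ≤ 2 * (C ^ 2 * (L + B3)) * (S.κ t θ * y) := by positivity
  linarith

end EVSol

/-- Backward continuous induction on a half-open interval. -/
lemma forall_Ioc_of_backward_step {P : ℝ → Prop} {a b : ℝ} (hb : P b)
    (hc : ∀ t ∈ Ioo a b, (∀ r ∈ Ioc t b, P r) → P t)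
    (hs : ∀ t ∈ Ioc a b, P t → ∃ δ, 0 < δ ∧ ∀ r ∈ Icc (t - δ) t, P r) : ∀ t ∈ Ioc a b, P t := by
  intro t1 ht1
  set B : Set ℝ := {t | t ∈ Icc t1 b ∧ ∀ r ∈ Icc t b, P r} with hB
  have hbB : b ∈ B := ⟨right_mem_Icc.2 ht1.2, fun r hr => by rwa [le_antisymm hr.2 hr.1]⟩
  have hbdd : BddBelow B := ⟨t1, fun t ht => ht.1.1⟩
  set c := sInf B with hcdef
  have h1c : t1 ≤ c := le_csInf ⟨b, hbB⟩ fun t ht => ht.1.1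
  have hcb : c ≤ b := csInf_le hbdd hbB
  have hgt : ∀ r ∈ Ioc c b, P r := fun r hr => by
    obtain ⟨t, ht, htr⟩ := exists_lt_of_csInf_lt ⟨b, hbB⟩ hr.1
    exact ht.2 r ⟨htr.le, hr.2⟩
  have hPc : P c := by
    rcases hcb.eq_or_lt with h | h
    · rwa [h]
    · exact hc c ⟨ht1.1.trans_le h1c, h⟩ hgt
  obtain ⟨δ, hδ, h⟩ := hs c ⟨ht1.1.trans_le h1c, hcb⟩ hPc
  rcases h1c.eq_or_lt with h1 | h1
  · rwa [h1]
  · have hm : max t1 (c - δ) ∈ B := by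
      refine ⟨⟨le_max_left _ _, max_le ht1.2 (by linarith)⟩, fun r hr => ?_⟩
      rcases le_or_gt r c with hrc | hrc
      · exact h r ⟨(le_max_right _ _).trans hr.1, hrc⟩
      · exact hgt r ⟨hrc, hr.2⟩
    have := csInf_le hbdd hm
    rw [← hcdef] at this
    rcases le_max_iff.1 this with h2 | h2 <;> linarith

namespace EVSol

variable {S : EVSol} {t θ C : ℝ}

/-- the wave energy densities and the squared characteristic momenta at time `t` are at most `Y` -/
def Good (S : EVSol) (t Y : ℝ) : Prop := ∀ θ, S.hh 1 t θ ≤ Y ∧ S.hh (-1) t θ ≤ Y ∧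
  ∀ v : V3, S.f t θ v ≠ 0 → S.α t θ * v.1 ^ 2 ≤ Y

lemma κ_eq (ht : t ∈ Ioc S.tp S.ti) (θ : ℝ) : S.κ t θ = -(pt S.α t θ / S.α t θ) := by
  rw [pt_α ht, neg_div, neg_neg, mul_div_cancel_right₀ _ (S.hαpos t ht θ).ne']

/-- Pointwise bounds at a good time persist, up to a factor two, near that time. -/
lemma Bound.exists_delta (hB : S.Bound C) {T Y k1 k2 : ℝ} (hT : T ∈ Ioc S.tp S.tm) (hk1 : 0 < k1)
    (hk2 : 0 < k2) (hY : 1 ≤ Y) (hG : S.Good T Y)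
    (hκ : ∀ θ, S.κ T θ ≤ k1 * (1 + Real.log Y)) (hbθ : ∀ θ, S.s T θ * |S.bθ T θ| ≤ k2 * Y) :
    ∃ δ, 0 < δ ∧ S.tp < T - δ ∧ ∀ t ∈ Icc (T - δ) T, ∀ θ, S.κ t θ ≤ 2 * k1 * (1 + Real.log Y) ∧
      S.s t θ * |S.bθ t θ| ≤ 2 * k2 * Y ∧ S.hh 1 t θ ≤ 2 * Y ∧ S.hh (-1) t θ ≤ 2 * Y := by
  have hT' := mem_Ioo_of_tm hT
  have hlog := Real.log_nonneg hY
  have hsub : Ioo S.tp S.ti ⊆ Ioc S.tp S.ti := Ioo_subset_Ioc_self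
  have sα := (smα (S := S)).mono hsub
  have sd : SmOn (Ioo S.tp S.ti) (fun t θ => -1 * (pt S.α t θ / S.α t θ)) :=
    ((sα.dt isOpen_Ioo).div sα fun t ht θ => (S.hαpos t (hsub ht) θ).ne').const_mul (-1)
  have sb : SmOn (Ioo S.tp S.ti) (fun t θ => S.s t θ * S.bθ t θ) :=
    ((sms (S := S)).mono hsub).mul ((((smν (S := S)).mono hsub).dθ isOpen_Ioo).add
      ((sα.dθ isOpen_Ioo).div (sα.const_mul 2) fun t ht θ => by
        have := S.hαpos t (hsub ht) θ
        positivity))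
  have pd : Per (fun t θ => -1 * (pt S.α t θ / S.α t θ)) := fun t θ => by
    have := Per.dt (G := S.α) S.hαper t θ
    simp only [this, S.hαper]
  have pb : Per (fun t θ => S.s t θ * S.bθ t θ) := fun t θ => by
    simp only [pers t θ, perbθ t θ]
  have pb' : Per (fun t θ => -1 * (S.s t θ * S.bθ t θ)) := fun t θ => by
    simp only [pers t θ, perbθ t θ]
  have hab : ∀ t ∈ Ioo S.tp S.ti, ∀ θ, S.s t θ * |S.bθ t θ| = |S.s t θ * S.bθ t θ| :=
    fun t ht θ => by rw [abs_mul, abs_of_pos (s_pos (hsub ht) θ)]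
  have hkY : 0 < k2 * Y := by positivity
  have e1 := eventually_lt_of_periodic pd isOpen_Ioo sd.continuousOn hT'
    (c := 2 * k1 * (1 + Real.log Y)) fun θ => by
      have := hκ θ
      rw [κ_eq (hsub hT')] at this
      have : 0 < k1 * (1 + Real.log Y) := by positivity
      linarith
  have e2 := eventually_lt_of_periodic pb isOpen_Ioo sb.continuousOn hT' (c := 2 * k2 * Y)
    fun θ => by
      have := hbθ θ
      rw [hab T hT'] at this
      linarith [le_abs_self (S.s T θ * S.bθ T θ)]
  have e3 := eventually_lt_of_periodic pb' isOpen_Ioo (sb.const_mul (-1)).continuousOn hT'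
    (c := 2 * k2 * Y) fun θ => by
      have := hbθ θ
      rw [hab T hT'] at this
      linarith [neg_le_abs (S.s T θ * S.bθ T θ)]
  have e4 := fun σ (h : ∀ θ, S.hh σ T θ ≤ Y) => eventually_lt_of_periodic (perhh S σ) isOpen_Ioo
    (smhh S σ).continuousOn hT' (c := 2 * Y) fun θ => by linarith [h θ]
  have e5 : ∀ᶠ t in 𝓝 T, t ∈ Ioo S.tp S.ti := isOpen_Ioo.mem_nhds hT'
  obtain ⟨ε, hε, h⟩ := Metric.eventually_nhds_iff.1 ((((e1.and e2).and e3).and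
    (e4 1 fun θ => (hG θ).1)).and ((e4 (-1) fun θ => (hG θ).2.1).and e5))
  have key : ∀ t ∈ Icc (T - ε / 2) T, dist t T < ε := fun t ht => by
    rw [Real.dist_eq, abs_of_nonpos (by linarith [ht.2])]
    linarith [ht.1]
  refine ⟨ε / 2, by linarith, (h (key _ (left_mem_Icc.2 (by linarith)))).2.2.1, fun t ht θ => ?_⟩
  obtain ⟨⟨⟨⟨h1, h2⟩, h3⟩, h4⟩, h5, h6⟩ := h (key t ht)
  refine ⟨?_, ?_, (h4 θ).le, (h5 θ).le⟩
  · rw [κ_eq (hsub h6)]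
    linarith [h1 θ]
  · rw [hab t h6]
    exact abs_le.2 ⟨by linarith [h3 θ], (h2 θ).le⟩

/-- A supersolution of `-y' = Λ (1 + log y) y` dominates the wave energy densities and the
momenta a little further towards the past. -/
lemma Bound.exists_barrier (hB : S.Bound C) : ∃ Λ, 0 < Λ ∧ ∀ y : ℝ → ℝ, AntitoneOn y (Iic S.tm) →
    (∀ t ≤ S.tm, 1 ≤ y t) → (∀ t, HasDerivAt y (-(Λ * (1 + Real.log (y t)) * y t)) t) →
    ∀ T ∈ Ioc S.tp S.tm, S.Good T (y T) →
      ∃ δ, 0 < δ ∧ ∀ t ∈ Icc (T - δ) T, S.Good t (y t) := by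
  obtain ⟨k1, hk1, H1⟩ := hB.exists_κ_le
  obtain ⟨k2, hk2, H2⟩ := hB.exists_bθ_le
  obtain ⟨k3, hk3, H3⟩ := S.exists_deriv_hh_ge
  obtain ⟨k4, hk4, H4⟩ := hB.exists_deriv_momentum_le (k := 2 * k2) (by positivity)
  refine ⟨(k3 + k4) * (1 + 2 * k1) + 1, by positivity, fun y hy hy1 hyd T hT hG => ?_⟩
  set Λ := (k3 + k4) * (1 + 2 * k1) + 1 with hΛ
  have hY := hy1 T hT.2
  obtain ⟨δ, hδ, hδ', H⟩ := hB.exists_delta hT hk1 hk2 hY hG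
    (fun θ => H1 T hT θ (y T) hY (hG θ).2.2)
    (fun θ => H2 T hT θ (y T) (by linarith) (hG θ).1 (hG θ).2.1 (hG θ).2.2)
  have hyc : Continuous y := continuous_iff_continuousAt.2 fun t => (hyd t).continuousAt
  have hmem : ∀ t ∈ Icc (T - δ) T, t ∈ Ioc S.tp S.tm := fun t ht =>
    ⟨hδ'.trans_le ht.1, ht.2.trans hT.2⟩
  have H' : ∀ t ∈ Icc (T - δ) T, 1 ≤ y t ∧ ∀ θ, 1 + S.κ t θ ≤ (1 + 2 * k1) * (1 + Real.log (y t)) ∧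
      S.s t θ * |S.bθ t θ| ≤ 2 * k2 * y t ∧ S.hh 1 t θ ≤ 2 * y t ∧ S.hh (-1) t θ ≤ 2 * y t := by
    intro t ht
    have h1 : y T ≤ y t := hy (hmem t ht).2 hT.2 ht.2
    have h2 : Real.log (y T) ≤ Real.log (y t) := Real.log_le_log (by linarith) h1
    have h3 := Real.log_nonneg hY
    refine ⟨hY.trans h1, fun θ => ?_⟩
    obtain ⟨a1, a2, a3, a4⟩ := H t ht θ
    have b1 := mul_le_mul_of_nonneg_left h2 hk1.le
    have b2 := mul_le_mul_of_nonneg_left h1 hk2.le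
    exact ⟨by linarith, by linarith, by linarith, by linarith⟩
  have Hd : ∀ t ∈ Icc (T - δ) T, ∀ θ k, 0 < k → k ≤ k3 + k4 →
      k * (1 + S.κ t θ) * y t < Λ * (1 + Real.log (y t)) * y t := by
    intro t ht θ k hk hk'
    obtain ⟨h1, h2⟩ := H' t ht
    have h3 := Real.log_nonneg h1
    refine mul_lt_mul_of_pos_right ?_ (by linarith)
    calc k * (1 + S.κ t θ) ≤ (k3 + k4) * ((1 + 2 * k1) * (1 + Real.log (y t))) := by
          have := (h2 θ).1
          have hκ := κ_nonneg (mem_of_Ioo (mem_Ioo_of_tm (hmem t ht))) θ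
          gcongr
      _ < _ := by rw [hΛ]; linarith
  have hyshift : ∀ t, HasDerivAt (fun r => y (t + r)) (-(Λ * (1 + Real.log (y t)) * y t)) 0 :=
    fun t => by
      have h : HasDerivAt y (-(Λ * (1 + Real.log (y t)) * y t)) (t + 0) := by simpa using hyd t
      exact h.comp_const_add t 0
  have hhle : ∀ σ, (σ = 1 ∨ σ = -1) → (∀ θ, S.hh σ T θ ≤ y T) →
      ∀ t ∈ Icc (T - δ) T, ∀ θ, S.hh σ t θ ≤ y t := by
    intro σ hσ hT' t ht θ
    have := nonpos_of_exists_direction (t1 := T - δ) (t2 := T) (g := fun t θ => S.hh σ t θ - y t)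
      (fun t θ => by simp only [perhh S σ t θ])
      (((smhh S σ).continuousOn.mono (prod_mono (fun r hr => mem_Ioo_of_tm (hmem r hr))
        subset_rfl)).sub (hyc.comp continuous_fst).continuousOn)
      (fun r hr x hpos => by
        have hr' : r ∈ Icc (T - δ) T := ⟨hr.1, hr.2.le⟩
        obtain ⟨h1, h2⟩ := H' r hr'
        obtain ⟨a, d, hd, h⟩ := H3 r (mem_Ioo_of_tm (hmem r hr')) x (y r) σ h1 (h2 x).2.2.1
          (h2 x).2.2.2 hσ
        have h3 := Hd r hr' x k3 hk3 (by linarith)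
        exact ⟨a, _, by linarith, h.sub (hyshift r)⟩)
      (fun x => sub_nonpos.2 (hT' x)) t ht θ
    simpa using this
  have hmom : ∀ t ∈ Icc (T - δ) T, ∀ θ (v : V3), S.f t θ v ≠ 0 → S.α t θ * v.1 ^ 2 ≤ y t := by
    intro t ht θ v hv
    have hv23 := hB.v t (hmem t ht) θ v hv
    have hC : 0 ≤ C := by linarith [hB.one_le]
    obtain ⟨C', hC', hb⟩ := S.exists_bb_le hδ' hC
    have hsubI : Icc (T - δ) T ⊆ Icc (T - δ) S.ti :=
      Icc_subset_Icc le_rfl (hT.2.trans S.tm_mem.2.le)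
    have hico : ∀ r ∈ Ico (T - δ) T, r ∈ Icc (T - δ) T ∧ r ∈ Ico (T - δ) S.ti := fun r hr =>
      ⟨⟨hr.1, hr.2.le⟩, hr.1, hr.2.trans_le (hT.2.trans S.tm_mem.2.le)⟩
    have key := transport_le (t1 := T - δ) (t2 := T) (c := 0)
      (g := fun t x z => S.f t x (z, v.2.1, v.2.2))
      (a := fun t x z => S.aa t x (z, v.2.1, v.2.2)) (b := fun t x z => S.bb t x (z, v.2.1, v.2.2))
      (ψ := fun t x z => y t - S.α t x * z ^ 2)
      ((f_continuousOn_slice hδ' v.2.1 v.2.2).mono (prod_mono hsubI subset_rfl))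
      (fun t x z => S.hfper t x _)
      (by
        refine (hyc.comp continuous_fst).continuousOn.sub (ContinuousOn.mul ?_ (by fun_prop))
        exact (smα (S := S)).continuousOn.comp (f := fun p : ℝ × ℝ × ℝ => (p.1, p.2.1))
          (by fun_prop) fun p hp =>
            ⟨mem_of_Ioo (mem_Ioo_of_tm (hmem p.1 hp.1)), mem_univ _⟩)
      (fun t x z => by simp only [S.hαper])
      (fun r hr x z => hasDerivAt_f_char (mem_Ioo_of_tm (hmem r (hico r hr).1)) z v.2.1 v.2.2)
      (fun r hr x z h0 => by
        have hr' := (hico r hr).1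
        obtain ⟨h1, h2⟩ := H' r hr'
        obtain ⟨d, hd, h⟩ := H4 r (hmem r hr') x (z, v.2.1, v.2.2) (y r) h1 (by linarith)
          hv23.1 hv23.2 (h2 x).2.2.1 (h2 x).2.2.2 (h2 x).2.1
        have h3 := Hd r hr' x k4 hk4 (by linarith)
        exact ⟨_, by linarith [(abs_le.1 hd).1], (hyshift r).sub h⟩)
      hC' (fun r hr x z => hb r (hico r hr).2 x (z, v.2.1, v.2.2) hv23.1 hv23.2)
      (fun x z h0 => by
        have hT' := mem_of_Ioo (mem_Ioo_of_tm hT)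
        have hα := S.hαpos T hT' x
        have hcont : Continuous fun ε : ℝ => S.f T x (z * (1 + ε), v.2.1, v.2.2) :=
          (continuous_f hT').comp (by fun_prop :
            Continuous fun ε : ℝ => (x, ((z * (1 + ε), v.2.1, v.2.2) : V3)))
        have hlim : Tendsto (fun ε : ℝ => S.f T x (z * (1 + ε), v.2.1, v.2.2)) (𝓝[>] 0)
            (𝓝 (S.f T x (z, v.2.1, v.2.2))) := by
          have := (hcont.tendsto 0).mono_left (nhdsWithin_le_nhds (s := Ioi 0))
          simpa using this
        refine le_of_tendsto hlim (eventually_mem_nhdsWithin.mono fun ε hε => ?_)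
        by_contra! hne
        have h1 := (hG x).2.2 _ hne.ne'
        have hε' : 0 < ε := hε
        simp only [sub_nonpos] at h0
        have h2 : S.α T x * (z * (1 + ε)) ^ 2 = S.α T x * z ^ 2
          + S.α T x * z ^ 2 * (2 * ε + ε ^ 2) := by ring
        have h3 : 0 < S.α T x * z ^ 2 * (2 * ε + ε ^ 2) :=
          mul_pos (by linarith) (by positivity)
        simp only at h1
        linarith)
      t ht θ v.1
    by_contra! hcon
    exact hv (le_antisymm (key (by linarith))
      (S.hfnn t (mem_of_Ioo (mem_Ioo_of_tm (hmem t ht))) θ v))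
  exact ⟨δ, hδ, fun t ht θ => ⟨hhle 1 (Or.inl rfl) (fun θ => (hG θ).1) t ht θ,
    hhle (-1) (Or.inr rfl) (fun θ => (hG θ).2.1) t ht θ, hmom t ht θ⟩⟩

end EVSol

namespace EVSol

variable {S : EVSol} {t θ C : ℝ}

/-- The bounds `Good` are a closed condition as time decreases. -/
lemma good_of_forall_gt {y : ℝ → ℝ} (hy : Continuous y) {b : ℝ} (ht : t ∈ Ioo S.tp b)
    (hb : b ≤ S.ti) (h : ∀ r ∈ Ioc t b, S.Good r (y r)) : S.Good t (y t) := by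
  have ht' : t ∈ Ioo S.tp S.ti := ⟨ht.1, ht.2.trans_le hb⟩
  have hev : ∀ᶠ r in 𝓝[>] t, S.Good r (y r) :=
    (eventually_of_mem (Ioc_mem_nhdsGT ht.2) fun r hr => h r hr)
  have hy' : Tendsto y (𝓝[>] t) (𝓝 (y t)) := (hy.tendsto t).mono_left nhdsWithin_le_nhds
  have hslice : ∀ {G : ℝ → ℝ → ℝ}, SmOn (Ioo S.tp S.ti) G → ∀ θ,
      Tendsto (fun r => G r θ) (𝓝[>] t) (𝓝 (G t θ)) := fun hG θ =>
    (hG.hasDerivAt_t isOpen_Ioo ht').continuousAt.tendsto.mono_left nhdsWithin_le_nhds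
  refine fun θ => ⟨le_of_tendsto_of_tendsto (hslice (smhh S 1) θ) hy' (hev.mono fun r hr => (hr θ).1),
    le_of_tendsto_of_tendsto (hslice (smhh S (-1)) θ) hy' (hev.mono fun r hr => (hr θ).2.1),
    fun v hv => ?_⟩
  have hf : Tendsto (fun r => S.f r θ v) (𝓝[>] t) (𝓝 (S.f t θ v)) := by
    have h1 : ContinuousAt S.F (t, θ, v) := F_continuousOn.continuousAt
      (prod_mem_nhds (Ioc_mem_nhds ht'.1 ht'.2) univ_mem)
    have h2 : ContinuousAt (fun r : ℝ => (r, θ, v)) t := by fun_prop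
    exact (ContinuousAt.comp (f := fun r : ℝ => (r, θ, v)) h1 h2).tendsto.mono_left
      nhdsWithin_le_nhds
  refine le_of_tendsto_of_tendsto ((hslice ((smα (S := S)).mono Ioo_subset_Ioc_self) θ).mul_const _)
    hy' ?_
  filter_upwards [hev, hf.eventually_ne hv] with r hr hr' using (hr θ).2.2 v hr'

/-- At the time `tm` the bounds `Good` hold with some constant. -/
lemma exists_good (S : EVSol) : ∃ Y, 1 ≤ Y ∧ S.Good S.tm Y := by
  have htm := S.tm_mem
  have htm' := mem_of_Ioo htm
  obtain ⟨R, hR, hf⟩ := S.exists_support_bound htm.1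
  have hcont : ∀ σ, ∃ M, ∀ θ, |S.hh σ S.tm θ| ≤ M := fun σ => by
    obtain ⟨M, -, hM⟩ := exists_bound_of_periodic (a := S.tm) (b := S.tm) (perhh S σ)
      ((smhh S σ).continuousOn.mono (prod_mono (by simpa using htm) subset_rfl))
    exact ⟨M, hM S.tm (by simp)⟩
  obtain ⟨M1, h1⟩ := hcont 1
  obtain ⟨M2, h2⟩ := hcont (-1)
  obtain ⟨M3, -, h3⟩ := exists_bound_of_periodic (a := S.tm) (b := S.tm) S.hαper
    ((smα (S := S)).continuousOn.mono (prod_mono (by simpa using htm') subset_rfl))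
  replace h3 := h3 S.tm (by simp)
  have p1 := (abs_nonneg _).trans (h1 0)
  have p2 := (abs_nonneg _).trans (h2 0)
  have p3 := (abs_nonneg _).trans (h3 0)
  have p4 : 0 ≤ M3 * R ^ 2 := by positivity
  refine ⟨1 + M1 + M2 + M3 * R ^ 2, by linarith, fun θ => ⟨?_, ?_, fun v hv => ?_⟩⟩
  · linarith [le_abs_self (S.hh 1 S.tm θ), h1 θ]
  · linarith [le_abs_self (S.hh (-1) S.tm θ), h2 θ]
  · have hv1 : |v.1| ≤ R := (norm_fst_le v).trans (hf S.tm ⟨le_rfl, htm.2.le⟩ θ v hv)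
    have : S.α S.tm θ * v.1 ^ 2 ≤ M3 * R ^ 2 := by
      rw [← sq_abs v.1]
      have := (le_abs_self _).trans (h3 θ)
      gcongr
    linarith

/-- The wave energy densities and the momenta are bounded uniformly down to `tp`. -/
lemma Bound.exists_forall_good (hB : S.Bound C) : ∃ Y, 0 ≤ Y ∧ ∀ t ∈ Ioc S.tp S.tm, S.Good t Y := by
  obtain ⟨Λ, hΛ, H⟩ := hB.exists_barrier
  obtain ⟨Y, hY, hG⟩ := S.exists_good
  set z := 1 + Real.log Y with hz
  have hz1 : 1 ≤ z := by linarith [Real.log_nonneg hY]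
  set y : ℝ → ℝ := fun t => Real.exp (z * Real.exp (Λ * (S.tm - t)) - 1) with hy
  have hanti : Antitone y := fun a b hab => by
    simp only [hy]
    gcongr
  have hytm : y S.tm = Y := by
    simp only [hy, sub_self, mul_zero, Real.exp_zero, mul_one, hz, add_sub_cancel_left]
    exact Real.exp_log (by linarith)
  have hyd : ∀ t, HasDerivAt y (-(Λ * (1 + Real.log (y t)) * y t)) t := fun t => by
    have h := ((((((hasDerivAt_id t).const_sub S.tm).const_mul Λ).exp).const_mul z).sub_const 1).exp
    refine h.congr_deriv ?_
    simp only [hy, Real.log_exp, id]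
    ring
  have hyc : Continuous y := continuous_iff_continuousAt.2 fun t => (hyd t).continuousAt
  have hall := forall_Ioc_of_backward_step (P := fun t => S.Good t (y t)) (a := S.tp) (b := S.tm)
    (by rwa [hytm]) (fun t ht h => good_of_forall_gt hyc ht S.tm_mem.2.le h)
    (fun T hT h => H y (hanti.antitoneOn _) (fun t ht => by
      have := hanti ht
      rw [hytm] at this
      exact hY.trans this) hyd T hT h)
  refine ⟨y S.tp, (Real.exp_pos _).le, fun t ht θ => ?_⟩
  have hle := hanti ht.1.le
  obtain ⟨h1, h2, h3⟩ := hall t ht θ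
  exact ⟨h1.trans hle, h2.trans hle, fun v hv => (h3 v hv).trans hle⟩

lemma Bound.exists_derivs_le (hB : S.Bound C) : ∃ D, ∀ t ∈ Ioc S.tp S.tm, ∀ θ,
    |S.U t θ| ≤ D ∧ |S.A t θ| ≤ D ∧ |pt S.U t θ| ≤ D ∧ |pθ S.U t θ| ≤ D ∧ |pt S.A t θ| ≤ D ∧
      |pθ S.A t θ| ≤ D ∧ ∀ v : V3, S.f t θ v ≠ 0 → ‖v‖ ≤ D := by
  obtain ⟨Y, hY, hG⟩ := hB.exists_forall_good
  have hC := hB.one_le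
  set y := Real.sqrt Y with hy
  have hy0 : 0 ≤ y := Real.sqrt_nonneg _
  set m := 2 * S.tm * Real.exp (2 * C) * y with hm
  have hm0 : 0 ≤ m := by
    have := S.htp.trans S.tm_mem.1
    positivity
  have p1 : y ≤ y * C := le_mul_of_one_le_right hy0 hC
  have p2 : m ≤ m * C := le_mul_of_one_le_right hm0 hC
  refine ⟨C + y * C + m * C, fun t ht θ => ?_⟩
  have ht' := mem_of_Ioo (mem_Ioo_of_tm ht)
  obtain ⟨g1, g2, g3⟩ := hG t ht θ
  obtain ⟨d1, d2, d3, d4⟩ := hB.abs_derivs_le ht g1 g2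
  have hs := s_pos ht' θ
  have hsi : (S.s t θ)⁻¹ ≤ C := hB.sinv t ht θ
  have hdiv : ∀ {x b : ℝ}, 0 ≤ b → S.s t θ * |x| ≤ b → |x| ≤ b * C := fun {x b} hb h => by
    calc |x| = S.s t θ * |x| * (S.s t θ)⁻¹ := by field_simp
      _ ≤ b * C := by gcongr
  have q1 := hdiv hy0 d2
  have q2 := hdiv hm0 d4
  have hU := hB.U t ht θ
  have hA := hB.A t ht θ
  refine ⟨by linarith, by linarith, by linarith, by linarith, by linarith, by linarith,
    fun v hv => ?_⟩
  have hv1 : |v.1| ≤ y * C := (abs_v1_le_of_sq ht' (g3 v hv)).trans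
    (mul_le_mul_of_nonneg_left hsi hy0)
  obtain ⟨hv2, hv3⟩ := hB.v t ht θ v hv
  simp only [Prod.norm_def, Real.norm_eq_abs, sup_le_iff]
  exact ⟨by linarith, by linarith, by linarith⟩

theorem exists_bounds (S : EVSol) :
    (∃ C : ℝ, ∀ t ∈ Ioc S.tp S.ti, ∀ θ : ℝ,
      |S.U t θ| ≤ C ∧ |S.A t θ| ≤ C ∧ |pt S.U t θ| ≤ C ∧ |pθ S.U t θ| ≤ C
      ∧ |pt S.A t θ| ≤ C ∧ |pθ S.A t θ| ≤ C)
    ∧ ∃ Kc : Set V3, IsCompact Kc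
      ∧ ∀ t ∈ Ioc S.tp S.ti, ∀ (θ : ℝ) (v : V3), v ∉ Kc → S.f t θ v = 0 := by
  obtain ⟨C, hB⟩ := S.exists_bound
  obtain ⟨D, hD⟩ := hB.exists_derivs_le
  obtain ⟨CU, -, hU⟩ := (smU (S := S)).exists_bound_Icc S.hUper S.tm_mem.1 S.hti
  obtain ⟨CA, -, hA⟩ := (smA (S := S)).exists_bound_Icc S.hAper S.tm_mem.1 S.hti
  obtain ⟨R, -, hR⟩ := S.exists_support_bound S.tm_mem.1
  constructor
  · refine ⟨max D (max CU CA), fun t ht θ => ?_⟩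
    rcases le_or_gt t S.tm with h | h
    · obtain ⟨h1, h2, h3, h4, h5, h6, -⟩ := hD t ⟨ht.1, h⟩ θ
      have hle := le_max_left D (max CU CA)
      exact ⟨h1.trans hle, h2.trans hle, h3.trans hle, h4.trans hle, h5.trans hle, h6.trans hle⟩
    · obtain ⟨a1, a2, a3, -⟩ := hU t ⟨h.le, ht.2⟩ θ
      obtain ⟨b1, b2, b3, -⟩ := hA t ⟨h.le, ht.2⟩ θ
      have hleU : CU ≤ max D (max CU CA) := (le_max_left _ _).trans (le_max_right _ _)
      have hleA : CA ≤ max D (max CU CA) := (le_max_right _ _).trans (le_max_right _ _)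
      exact ⟨a1.trans hleU, b1.trans hleA, a2.trans hleU, a3.trans hleU, b2.trans hleA,
        b3.trans hleA⟩
  · refine ⟨Metric.closedBall 0 (max D R), isCompact_closedBall _ _, fun t ht θ v hv => ?_⟩
    by_contra h0
    refine hv (mem_closedBall_zero_iff.2 ?_)
    rcases le_or_gt t S.tm with h | h
    · exact ((hD t ⟨ht.1, h⟩ θ).2.2.2.2.2.2 v h0).trans (le_max_left _ _)
    · exact (hR t ⟨h.le, ht.2⟩ θ v h0).trans (le_max_right _ _)

end EVSol

end

theorem first_derivatives_bounded_and_support_bounded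
    (tp ti : ℝ) (htp : 0 < tp) (hti : tp < ti)
    (U A ν α J K : ℝ → ℝ → ℝ) (f : ℝ → ℝ → V3 → ℝ)
    (hUsm : ContDiffOn ℝ (⊤ : ℕ∞) (fun p : ℝ × ℝ => U p.1 p.2) (Ioc tp ti ×ˢ (univ : Set ℝ)))
    (hAsm : ContDiffOn ℝ (⊤ : ℕ∞) (fun p : ℝ × ℝ => A p.1 p.2) (Ioc tp ti ×ˢ (univ : Set ℝ)))
    (hνsm : ContDiffOn ℝ (⊤ : ℕ∞) (fun p : ℝ × ℝ => ν p.1 p.2) (Ioc tp ti ×ˢ (univ : Set ℝ)))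
    (hαsm : ContDiffOn ℝ (⊤ : ℕ∞) (fun p : ℝ × ℝ => α p.1 p.2) (Ioc tp ti ×ˢ (univ : Set ℝ)))
    (hJsm : ContDiffOn ℝ (⊤ : ℕ∞) (fun p : ℝ × ℝ => J p.1 p.2) (Ioc tp ti ×ˢ (univ : Set ℝ)))
    (hKsm : ContDiffOn ℝ (⊤ : ℕ∞) (fun p : ℝ × ℝ => K p.1 p.2) (Ioc tp ti ×ˢ (univ : Set ℝ)))
    (hfsm : ContDiffOn ℝ (⊤ : ℕ∞) (fun p : ℝ × ℝ × V3 => f p.1 p.2.1 p.2.2) (Ioc tp ti ×ˢ (univ : Set (ℝ × V3))))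
    (hUper : ∀ t θ, U t (θ + 1) = U t θ)
    (hAper : ∀ t θ, A t (θ + 1) = A t θ)
    (hνper : ∀ t θ, ν t (θ + 1) = ν t θ)
    (hαper : ∀ t θ, α t (θ + 1) = α t θ)
    (hJper : ∀ t θ, J t (θ + 1) = J t θ)
    (hKper : ∀ t θ, K t (θ + 1) = K t θ)
    (hfper : ∀ t θ v, f t (θ + 1) v = f t θ v)
    (hαpos : ∀ t ∈ Ioc tp ti, ∀ θ : ℝ, 0 < α t θ)
    (hfnn : ∀ t ∈ Ioc tp ti, ∀ (θ : ℝ) (v : V3), 0 ≤ f t θ v)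
    (hfsupp : ∀ t ∈ Ioc tp ti, ∃ R : ℝ, ∀ (θ : ℝ) (v : V3), R < ‖v‖ → f t θ v = 0)
    (hvlasov :
      ∀ t ∈ Ioc tp ti, ∀ (θ : ℝ) (v : V3),
      ptf f t θ v
        = pv1 (v0 α ν U A t θ) v * pθf f t θ v
          - (deriv (fun x => v0 α ν U A t x v) θ
              + Real.sqrt (α t θ) * Real.exp (2 * ν t θ) / t ^ 3 * (K t θ - A t θ * J t θ) * (v.2.2 - A t θ * v.2.1)
              + Real.sqrt (α t θ) * Real.exp (2 * ν t θ - 4 * U t θ) / t * J t θ * v.2.1)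
            * pv1 (f t θ) v)
    (hnut :
      ∀ t ∈ Ioc tp ti, ∀ θ : ℝ,
      (pt ν t θ)
        = t * ((pt U t θ) ^ 2 + α t θ * (pθ U t θ) ^ 2
              + Real.exp (4 * U t θ) / (4 * t ^ 2) * ((pt A t θ) ^ 2 + α t θ * (pθ A t θ) ^ 2))
          + α t θ * Real.exp (2 * ν t θ - 4 * U t θ) / (4 * t) * J t θ ^ 2
          + α t θ * Real.exp (2 * ν t θ) / (4 * t ^ 3) * (K t θ - A t θ * J t θ) ^ 2
          + Real.sqrt (α t θ) * ∫ v : V3, f t θ v * |v0 α ν U A t θ v|)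
    (hnuth :
      ∀ t ∈ Ioc tp ti, ∀ θ : ℝ,
      (pθ ν t θ)
        = 2 * t * ((pt U t θ) * (pθ U t θ) + Real.exp (4 * U t θ) / (4 * t ^ 2) * (pt A t θ) * (pθ A t θ))
          - (pθ α t θ) / (2 * α t θ)
          - Real.sqrt (α t θ) * ∫ v : V3, f t θ v * v.1)
    (halt :
      ∀ t ∈ Ioc tp ti, ∀ θ : ℝ,
      (pt α t θ) / α t θ
        = - (α t θ * Real.exp (2 * ν t θ - 4 * U t θ) * J t θ ^ 2 / t)
          - α t θ * Real.exp (2 * ν t θ) * (K t θ - A t θ * J t θ) ^ 2 / t ^ 3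
          - 2 * (α t θ * Real.sqrt (α t θ)) * Real.exp (2 * ν t θ)
            * ∫ v : V3, f t θ v
                * (Real.exp (-2 * U t θ) + Real.exp (-4 * U t θ) * v.2.1 ^ 2
                    + (t ^ 2)⁻¹ * (v.2.2 - A t θ * v.2.1) ^ 2)
                / |v0 α ν U A t θ v|)
    (hjt :
      ∀ t ∈ Ioc tp ti, ∀ θ : ℝ,
      (pt J t θ) = -2 * α t θ * ∫ v : V3, f t θ v * v.1 * v.2.1 / |v0 α ν U A t θ v|)
    (hjth :
      ∀ t ∈ Ioc tp ti, ∀ θ : ℝ,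
      (pθ J t θ) = 2 * ∫ v : V3, f t θ v * v.2.1)
    (hkt :
      ∀ t ∈ Ioc tp ti, ∀ θ : ℝ,
      (pt K t θ) = -2 * α t θ * ∫ v : V3, f t θ v * v.1 * v.2.2 / |v0 α ν U A t θ v|)
    (hkth :
      ∀ t ∈ Ioc tp ti, ∀ θ : ℝ,
      (pθ K t θ) = 2 * ∫ v : V3, f t θ v * v.2.2)
    (hutt :
      ∀ t ∈ Ioc tp ti, ∀ θ : ℝ,
      (pt (pt U) t θ)
        = α t θ * (pθ (pθ U) t θ) - (pt U t θ) / t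
          + (pt α t θ) * (pt U t θ) / (2 * α t θ) + (pθ α t θ) * (pθ U t θ) / 2
          + Real.exp (4 * U t θ) / (2 * t ^ 2) * ((pt A t θ) ^ 2 - α t θ * (pθ A t θ) ^ 2)
          + α t θ * Real.exp (2 * ν t θ - 4 * U t θ) / (2 * t ^ 2) * J t θ ^ 2
          + (α t θ * Real.sqrt (α t θ)) * Real.exp (2 * ν t θ - 2 * U t θ) / (2 * t)
            * ∫ v : V3, f t θ v * (1 + 2 * Real.exp (-2 * U t θ) * v.2.1 ^ 2) / |v0 α ν U A t θ v|)
    (hatt :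
      ∀ t ∈ Ioc tp ti, ∀ θ : ℝ,
      (pt (pt A) t θ)
        = α t θ * (pθ (pθ A) t θ) + (pt A t θ) / t
          + (pt α t θ) * (pt A t θ) / (2 * α t θ) + (pθ α t θ) * (pθ A t θ) / 2
          - 4 * ((pt A t θ) * (pt U t θ) - α t θ * (pθ A t θ) * (pθ U t θ))
          + α t θ * Real.exp (2 * ν t θ - 4 * U t θ) / t ^ 2 * J t θ * (K t θ - A t θ * J t θ)
          + 2 * (α t θ * Real.sqrt (α t θ)) * Real.exp (2 * ν t θ - 4 * U t θ) / t
            * ∫ v : V3, f t θ v * v.2.1 * (v.2.2 - A t θ * v.2.1) / |v0 α ν U A t θ v|)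
    (hnutt :
      ∀ t ∈ Ioc tp ti, ∀ θ : ℝ,
      (pt (pt ν) t θ)
        = α t θ * (pθ (pθ ν) t θ)
          + (pt α t θ) * (pt ν t θ) / (2 * α t θ) + (pθ α t θ) * (pθ ν t θ) / 2
          + (pθ (pθ α) t θ) / 2 - (pθ α t θ) ^ 2 / (4 * α t θ)
          - (pt U t θ) ^ 2 + α t θ * (pθ U t θ) ^ 2
          + Real.exp (4 * U t θ) / (4 * t ^ 2) * ((pt A t θ) ^ 2 - α t θ * (pθ A t θ) ^ 2)
          - α t θ * Real.exp (2 * ν t θ - 4 * U t θ) * J t θ ^ 2 / (4 * t ^ 2)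
          - 3 * α t θ * Real.exp (2 * ν t θ) * (K t θ - A t θ * J t θ) ^ 2 / (4 * t ^ 4)
          - (α t θ * Real.sqrt (α t θ)) * Real.exp (2 * ν t θ) / t ^ 3
            * ∫ v : V3, f t θ v * (v.2.2 - A t θ * v.2.1) ^ 2 / |v0 α ν U A t θ v|)
    (hC2 : 0 < ∫ θ in (0:ℝ)..1, ∫ v : V3, f ti θ v) :
    (∃ C : ℝ, ∀ t ∈ Ioc tp ti, ∀ θ : ℝ,
      |U t θ| ≤ C ∧ |A t θ| ≤ C ∧ |pt U t θ| ≤ C ∧ |pθ U t θ| ≤ C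
      ∧ |pt A t θ| ≤ C ∧ |pθ A t θ| ≤ C)
    ∧ ∃ Kc : Set V3, IsCompact Kc
      ∧ ∀ t ∈ Ioc tp ti, ∀ (θ : ℝ) (v : V3), v ∉ Kc → f t θ v = 0 := by
  exact EVSol.exists_bounds
    ⟨tp, ti, U, A, ν, α, J, K, f, htp, hti, hUsm, hAsm, hνsm, hαsm, hJsm, hKsm, hfsm, hUper,
      hAper, hνper, hαper, hJper, hKper, hfper, hαpos, hfnn, hfsupp, hvlasov, hnut, hnuth, halt,
      hjt, hjth, hkt, hkth, hutt, hatt, hnutt, hC2⟩
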